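/- (Weak-type (1,1) of the even-order Riesz transforms of the Gru\v{s}in operator.) Fix integers n, m ≥ 1, N ≥ 1, let s ≥ 1 be an integer and let α be a word of elements of 𝒳 with |α| = 2s. Then there exists a constant c > 0 such that for every φ ∈ C_c^∞(ℝ^(n+m)) and every λ > 0, the Lebesgue measure of the set { z ∈ ℝ^(n+m) : |(X^α φ)(z)| > λ } is at most c · λ^(−1) · ‖H_N^s φ‖_1, where H_N^s denotes the s-fold composition of H_N. -/

import Mathlib

open MeasureTheory
open scoped ENNReal NNReal

/-- Points of `ℝ^(n+m)`, written `(x, y)` with `x ∈ ℝⁿ`, `y ∈ ℝᵐ`. -/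
abbrev Pt (n m : ℕ) := (Fin n → ℝ) × (Fin m → ℝ)

/-- The partial derivative operator `∂_{x_j}`. -/
noncomputable def Dx (n m : ℕ) (j : Fin n) (f : Pt n m → ℝ) : Pt n m → ℝ :=
  fun z => fderiv ℝ f z (Pi.single j 1, 0)

/-- The partial derivative operator `∂_{y_k}`. -/
noncomputable def Dy (n m : ℕ) (k : Fin m) (f : Pt n m → ℝ) : Pt n m → ℝ :=
  fun z => fderiv ℝ f z (0, Pi.single k 1)

/-- Index set for the family `𝒳`: either `j ∈ {1,…,n}` (giving `X_j = ∂_{x_j}`) or a pair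
of a multi-index `ν ∈ ℕⁿ` with `|ν| = N` and `k ∈ {1,…,m}` (giving
`X_{ν,k} = (N!/ν!)^(1/2) x^ν ∂_{y_k}`). -/
def XIdx (n m N : ℕ) := Fin n ⊕ ({ν : Fin n → ℕ // ∑ i, ν i = N} × Fin m)

/-- The family `𝒳` of first-order operators `X_j = ∂_{x_j}` and
`X_{ν,k} = (N!/ν!)^(1/2) x^ν ∂_{y_k}` for `|ν| = N`. -/
noncomputable def Xop (n m N : ℕ) : XIdx n m N → (Pt n m → ℝ) → (Pt n m → ℝ)
  | Sum.inl j => Dx n m j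
  | Sum.inr (ν, k) => fun f z =>
      Real.sqrt ((Nat.factorial N : ℝ) / ∏ i, (Nat.factorial (ν.1 i) : ℝ)) *
        (∏ i, z.1 i ^ ν.1 i) * Dy n m k f z

/-- Composition `Z_1 ∘ Z_2 ∘ ⋯ ∘ Z_s` of a word of operators. -/
def compOps {n m : ℕ} (l : List ((Pt n m → ℝ) → (Pt n m → ℝ))) :
    (Pt n m → ℝ) → (Pt n m → ℝ) :=
  l.foldr (· ∘ ·) id

/-- `X^α` for a word `α` of elements of `𝒳`. -/
noncomputable def Xw {n m N M : ℕ} (α : Fin M → XIdx n m N) :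
    (Pt n m → ℝ) → (Pt n m → ℝ) :=
  compOps (List.ofFn fun i => Xop n m N (α i))

/-- The Gru\v{s}in operator `H_N = −Δ_x − |x|^(2N) Δ_y`. -/
noncomputable def grusin (n m N : ℕ) (f : Pt n m → ℝ) : Pt n m → ℝ :=
  fun z => -(∑ j, Dx n m j (Dx n m j f) z) -
    (∑ i, z.1 i ^ 2) ^ N * ∑ k, Dy n m k (Dy n m k f) z

/-- The operators `Y_j = ∂_{x_j}` for `j ≤ n` and `Y_{n+l} = |x|^N ∂_{y_l}` for `l ≤ m`. -/
noncomputable def Yop (n m N : ℕ) : (Fin n ⊕ Fin m) → (Pt n m → ℝ) → (Pt n m → ℝ)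
  | Sum.inl j => Dx n m j
  | Sum.inr l => fun f z => Real.sqrt (∑ i, z.1 i ^ 2) ^ N * Dy n m l f z

/-- `Y^α` for a word `α ∈ {1,…,n+m}^M`. -/
noncomputable def Yw {n m N M : ℕ} (α : Fin M → (Fin n ⊕ Fin m)) :
    (Pt n m → ℝ) → (Pt n m → ℝ) :=
  compOps (List.ofFn fun i => Yop n m N (α i))


open scoped ContDiff

/-- A sequence which is log-convex up to constants interpolates between its end values. -/
lemma exists_interp_succ (C : ℝ) (hC : 0 ≤ C) (k : ℕ) : ∀ ε > (0 : ℝ), ∃ D ≥ (0 : ℝ),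
    ∀ y : ℕ → ℝ, (∀ i, 0 ≤ y i) →
      (∀ i, 1 ≤ i → i ≤ k → y i ^ 2 ≤ C * (y (i + 1) + y i) * y (i - 1)) →
      y k ≤ ε * y (k + 1) + D * y 0 := by
  induction k with
  | zero =>
    intro ε hε
    refine ⟨1, zero_le_one, fun y hy _ => ?_⟩
    have := mul_nonneg hε.le (hy 1)
    simpa using this
  | succ k ih =>
    intro ε hε
    set A := C * (1 / ε + 1) + 1 with hA
    have hA1 : 1 ≤ A := by
      have : 0 ≤ C * (1 / ε + 1) := by positivity
      linarith
    obtain ⟨D', hD', h'⟩ := ih (1 / (2 * A)) (by positivity)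
    refine ⟨2 * A * D' + 1, by positivity, fun y hy hl => ?_⟩
    have h1 := h' y hy (fun i h1 h2 => hl i h1 (by omega))
    have h2 := hl (k + 1) (by omega) le_rfl
    simp only [Nat.add_sub_cancel] at h2
    by_contra! hcon
    have hy0 := hy 0
    have hy1 := hy (k + 1)
    have hy2 := hy (k + 1 + 1)
    set Y := y (k + 1)
    set Z := y (k + 1 + 1)
    have hYpos : 0 < Y := by
      have : 0 ≤ ε * Z + (2 * A * D' + 1) * y 0 := by positivity
      linarith
    have hZ : Z ≤ Y / ε := by
      rw [le_div_iff₀ hε]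
      have : 0 ≤ (2 * A * D' + 1) * y 0 := by positivity
      nlinarith
    have hD : 2 * A * (D' * y 0) < Y := by
      have : 0 ≤ ε * Z := by positivity
      nlinarith
    have hk : 2 * A * y k ≤ Y + 2 * A * (D' * y 0) := by
      have h3 : 2 * A * y k ≤ 2 * A * (1 / (2 * A) * Y + D' * y 0) :=
        mul_le_mul_of_nonneg_left h1 (by positivity)
      have h4 : 2 * A * (1 / (2 * A) * Y + D' * y 0) = Y + 2 * A * (D' * y 0) := by
        field_simp
      linarith
    have hk2 : A * y k < Y := by linarith
    have h5 : Y ^ 2 ≤ (A - 1) * Y * y k := by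
      have : C * (Z + Y) ≤ (A - 1) * Y := by
        have : C * (Z + Y) ≤ C * (Y / ε + Y) := by gcongr
        calc _ ≤ _ := this
          _ = (A - 1) * Y := by rw [hA]; ring
      calc _ ≤ _ := h2
        _ ≤ _ := mul_le_mul_of_nonneg_right this (hy k)
    have hyk := hy k
    nlinarith [mul_nonneg hYpos.le hyk]

lemma exists_interp (C : ℝ) (hC : 0 ≤ C) (K : ℕ) : ∀ ε > (0 : ℝ), ∃ D ≥ (0 : ℝ),
    ∀ y : ℕ → ℝ, (∀ i, 0 ≤ y i) →
      (∀ i, 1 ≤ i → i < K → y i ^ 2 ≤ C * (y (i + 1) + y i) * y (i - 1)) →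
      ∀ k < K, y k ≤ ε * y K + D * y 0 := by
  induction K with
  | zero => exact fun ε hε => ⟨0, le_rfl, fun y _ _ k hk => absurd hk (by omega)⟩
  | succ K ih =>
    intro ε hε
    obtain ⟨D1, hD1, h1⟩ := exists_interp_succ C hC K ε hε
    obtain ⟨D2, hD2, h2⟩ := ih 1 one_pos
    refine ⟨D1 + D2, by positivity, fun y hy hl k hk => ?_⟩
    have h3 := h1 y hy (fun i hi hi' => hl i hi (by omega))
    have hy0 := hy 0
    rcases Nat.lt_succ_iff_lt_or_eq.mp hk with h | rfl
    · have := h2 y hy (fun i hi hi' => hl i hi (by omega)) k h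
      linarith
    · have : 0 ≤ D2 * y 0 := by positivity
      linarith

/-- Families of operators satisfying the canonical commutation relations. -/
structure IsCCR {n : ℕ} {I S : Type*} [SeminormedAddCommGroup S] [InnerProductSpace ℝ S]
    (p q : Fin n → I → Module.End ℝ S) : Prop where
  p_anti : ∀ i μ u v, inner ℝ (p i μ u) v = - inner ℝ u (p i μ v)
  q_symm : ∀ i μ u v, inner ℝ (q i μ u) v = inner ℝ u (q i μ v)
  pp : ∀ i j, p i * p j = p j * p i
  qq : ∀ i j, q i * q j = q j * q i
  pq : ∀ i j, p i * q j - q j * p i = if i = j then 1 else 0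

namespace CCR

variable {n : ℕ} {I S : Type*} [SeminormedAddCommGroup S] [InnerProductSpace ℝ S]

/-- The square of the radius. -/
def rad (q : Fin n → I → Module.End ℝ S) : I → Module.End ℝ S := ∑ i, q i ^ 2

/-- The Laplacian. -/
def lap (p : Fin n → I → Module.End ℝ S) : I → Module.End ℝ S := - ∑ i, p i ^ 2

/-- The anharmonic oscillator. -/
def osc (N : ℕ) (p q : Fin n → I → Module.End ℝ S) : I → Module.End ℝ S := lap p + rad q ^ N

/-- The operator attached to a letter. -/
def letter (p q : Fin n → I → Module.End ℝ S) : Fin n ⊕ Fin n → I → Module.End ℝ S :=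
  Sum.elim p q

/-- The weight of a letter. -/
def wtL (N : ℕ) : Fin n ⊕ Fin n → ℤ := Sum.elim (fun _ => N) (fun _ => 1)

/-- The weight of a word. -/
def wt (N : ℕ) (w : List (Fin n ⊕ Fin n)) : ℤ := (w.map (wtL N)).sum

/-- The operator attached to a word. -/
def word (p q : Fin n → I → Module.End ℝ S) (w : List (Fin n ⊕ Fin n)) : I → Module.End ℝ S :=
  (w.map (letter p q)).prod

/-- Operators of weight at most `d`. -/
def filt (N : ℕ) (p q : Fin n → I → Module.End ℝ S) (d : ℤ) :
    Submodule ℝ (I → Module.End ℝ S) :=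
  Submodule.span ℝ {T | ∃ w, wt N w ≤ d ∧ T = word p q w}

variable {N : ℕ} {p q : Fin n → I → Module.End ℝ S}

@[simp] lemma word_nil : word p q [] = 1 := rfl
@[simp] lemma word_cons (l w) : word p q (l :: w) = letter p q l * word p q w := by
  simp [word]
lemma word_append (u v) : word p q (u ++ v) = word p q u * word p q v := by
  simp [word]
@[simp] lemma wt_nil : wt (n := n) N [] = 0 := rfl
@[simp] lemma wt_cons (l w) : wt (n := n) N (l :: w) = wtL N l + wt N w := by simp [wt]
lemma wt_append (u v) : wt (n := n) N (u ++ v) = wt N u + wt N v := by simp [wt]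

lemma word_mem {w : List (Fin n ⊕ Fin n)} {d : ℤ} (h : wt N w ≤ d) : word p q w ∈ filt N p q d :=
  Submodule.subset_span ⟨w, h, rfl⟩

lemma filt_mono {d e : ℤ} (h : d ≤ e) : filt N p q d ≤ filt N p q e :=
  Submodule.span_mono fun _ ⟨w, hw, hT⟩ => ⟨w, hw.trans h, hT⟩

lemma mul_mem {d e : ℤ} {T U : I → Module.End ℝ S} (hT : T ∈ filt N p q d)
    (hU : U ∈ filt N p q e) : T * U ∈ filt N p q (d + e) := by
  induction hT using Submodule.span_induction with
  | zero => simp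
  | add x y _ _ hx hy => rw [add_mul]; exact add_mem hx hy
  | smul c x _ hx => rw [smul_mul_assoc]; exact Submodule.smul_mem _ _ hx
  | mem x hx =>
    obtain ⟨u, hu, rfl⟩ := hx
    induction hU using Submodule.span_induction with
    | zero => simp
    | add x y _ _ hx hy => rw [mul_add]; exact add_mem hx hy
    | smul c x _ hx => rw [mul_smul_comm]; exact Submodule.smul_mem _ _ hx
    | mem x hx =>
      obtain ⟨v, hv, rfl⟩ := hx
      rw [← word_append]
      exact word_mem (by rw [wt_append]; linarith)

lemma one_mem {d : ℤ} (hd : 0 ≤ d) : (1 : I → Module.End ℝ S) ∈ filt N p q d :=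
  word_mem (w := []) (by simpa using hd)

lemma letter_mem (l : Fin n ⊕ Fin n) : letter p q l ∈ filt N p q (wtL N l) := by
  have : letter p q l = word p q [l] := by simp
  rw [this]; exact word_mem (by simp)

lemma p_mem (i : Fin n) : p i ∈ filt N p q N := letter_mem (p := p) (q := q) (Sum.inl i)
lemma q_mem (i : Fin n) : q i ∈ filt N p q 1 := letter_mem (p := p) (q := q) (Sum.inr i)

lemma pow_mem {d : ℤ} {T : I → Module.End ℝ S} (hT : T ∈ filt N p q d) (k : ℕ) :
    T ^ k ∈ filt N p q (k * d) := by
  induction k with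
  | zero => simpa using one_mem le_rfl
  | succ k ih =>
    rw [pow_succ]; convert mul_mem ih hT using 2; push_cast; ring

lemma osc_mem : osc N p q ∈ filt N p q (2 * N) := by
  refine add_mem (neg_mem (sum_mem fun i _ => ?_)) ?_
  · simpa using pow_mem (p_mem i) 2
  · have : rad q ∈ filt N p q 2 := sum_mem fun i _ => by simpa using pow_mem (q_mem (p := p) i) 2
    have := pow_mem this N
    rwa [mul_comm] at this

lemma comm_letter (h : IsCCR p q) (k l : Fin n ⊕ Fin n) :
    letter p q k * letter p q l - letter p q l * letter p q k ∈
      filt N p q (wtL N k + wtL N l - (N + 1)) := by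
  rcases k with i | i <;> rcases l with j | j
  · simp [letter, h.pp i j]
  · simp only [letter, Sum.elim_inl, Sum.elim_inr, h.pq, wtL]
    split_ifs
    · exact one_mem (by linarith)
    · simp
  · simp only [letter, Sum.elim_inl, Sum.elim_inr, wtL]
    rw [show q i * p j - p j * q i = -(p j * q i - q i * p j) by abel, h.pq]
    split_ifs
    · exact neg_mem (one_mem (by linarith))
    · simp
  · simp [letter, h.qq i j]

lemma comm_letter_word (h : IsCCR p q) (k : Fin n ⊕ Fin n) (w : List (Fin n ⊕ Fin n)) :
    letter p q k * word p q w - word p q w * letter p q k ∈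
      filt N p q (wtL N k + wt N w - (N + 1)) := by
  induction w with
  | nil => simp
  | cons l w ih =>
    have e : letter p q k * word p q (l :: w) - word p q (l :: w) * letter p q k =
        (letter p q k * letter p q l - letter p q l * letter p q k) * word p q w +
        letter p q l * (letter p q k * word p q w - word p q w * letter p q k) := by
      simp only [word_cons]; noncomm_ring
    rw [e, wt_cons]
    refine add_mem ?_ ?_
    · convert mul_mem (comm_letter h k l) (word_mem (N := N) (le_refl (wt N w))) using 2; ring
    · convert mul_mem (letter_mem (N := N) (p := p) (q := q) l) ih using 2; ring

lemma comm_word_word (h : IsCCR p q) (u w : List (Fin n ⊕ Fin n)) :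
    word p q u * word p q w - word p q w * word p q u ∈
      filt N p q (wt N u + wt N w - (N + 1)) := by
  induction u with
  | nil => simp
  | cons l u ih =>
    have e : word p q (l :: u) * word p q w - word p q w * word p q (l :: u) =
        letter p q l * (word p q u * word p q w - word p q w * word p q u) +
        (letter p q l * word p q w - word p q w * letter p q l) * word p q u := by
      simp only [word_cons]; noncomm_ring
    rw [e, wt_cons]
    refine add_mem ?_ ?_
    · convert mul_mem (letter_mem (N := N) (p := p) (q := q) l) ih using 2; ring
    · convert mul_mem (comm_letter_word h l w) (word_mem (N := N) (le_refl (wt N u))) using 2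
      ring

lemma comm_mem (h : IsCCR p q) {d e : ℤ} {T U : I → Module.End ℝ S} (hT : T ∈ filt N p q d)
    (hU : U ∈ filt N p q e) : T * U - U * T ∈ filt N p q (d + e - (N + 1)) := by
  induction hT using Submodule.span_induction with
  | zero => simp
  | add x y _ _ hx hy =>
    have : (x + y) * U - U * (x + y) = (x * U - U * x) + (y * U - U * y) := by noncomm_ring
    rw [this]; exact add_mem hx hy
  | smul c x _ hx =>
    rw [smul_mul_assoc, mul_smul_comm, ← smul_sub]; exact Submodule.smul_mem _ _ hx
  | mem x hx =>
    obtain ⟨u, hu, rfl⟩ := hx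
    induction hU using Submodule.span_induction with
    | zero => simp
    | add x y _ _ hx hy =>
      have : word p q u * (x + y) - (x + y) * word p q u =
        (word p q u * x - x * word p q u) + (word p q u * y - y * word p q u) := by noncomm_ring
      rw [this]; exact add_mem hx hy
    | smul c x _ hx =>
      rw [smul_mul_assoc, mul_smul_comm, ← smul_sub]; exact Submodule.smul_mem _ _ hx
    | mem x hx =>
      obtain ⟨v, hv, rfl⟩ := hx
      exact filt_mono (by linarith) (comm_word_word h u v)

end CCR

namespace CCR

variable {n : ℕ} {I S : Type*} [SeminormedAddCommGroup S] [InnerProductSpace ℝ S]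
variable {N : ℕ} {p q : Fin n → I → Module.End ℝ S}

lemma pp_apply (h : IsCCR p q) (i j μ) (u : S) : p i μ (p j μ u) = p j μ (p i μ u) :=
  LinearMap.congr_fun (congrFun (h.pp i j) μ) u

lemma pq_apply (h : IsCCR p q) (i j μ) (u : S) :
    p i μ (q j μ u) = q j μ (p i μ u) + if i = j then u else 0 := by
  have := LinearMap.congr_fun (congrFun (h.pq i j) μ) u
  rw [← sub_eq_iff_eq_add']
  refine Eq.trans ?_ (this.trans ?_)
  · simp
  · split_ifs <;> simp

lemma q_rad_comm (h : IsCCR p q) (i : Fin n) : Commute (q i) (rad q) :=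
  Commute.sum_right _ _ _ fun j _ => Commute.pow_right (h.qq i j) 2

lemma p_rad (h : IsCCR p q) (i : Fin n) : p i * rad q = rad q * p i + 2 * q i := by
  have key : ∀ j, p i * q j ^ 2 = q j ^ 2 * p i + if i = j then 2 * q i else 0 := by
    intro j
    have h1 := h.pq i j
    rw [sub_eq_iff_eq_add'] at h1
    rw [pow_two, ← mul_assoc, h1]
    split_ifs with hij
    · subst hij
      rw [add_mul, mul_assoc, h1, if_pos rfl, mul_add]; noncomm_ring
    · rw [add_zero, mul_assoc, h1, if_neg hij]; noncomm_ring
  rw [rad, Finset.mul_sum, Finset.sum_congr rfl fun j _ => key j, Finset.sum_add_distrib,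
    Finset.sum_mul, Finset.sum_ite_eq]
  simp

lemma p_rad_pow (h : IsCCR p q) (i : Fin n) (k : ℕ) :
    p i * rad q ^ (k + 1) = rad q ^ (k + 1) * p i + (2 * (k + 1) : ℕ) * (q i * rad q ^ k) := by
  induction k with
  | zero => simp [p_rad h]
  | succ k ih =>
    rw [pow_succ, ← mul_assoc, ih, add_mul, mul_assoc _ (p i), p_rad h, mul_add, ← mul_assoc,
      ← pow_succ, add_assoc]
    congr 1
    have h1 : rad q ^ (k + 1) * q i = q i * rad q ^ (k + 1) :=
      ((q_rad_comm h i).pow_right _).eq.symm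
    have h2 : rad q ^ (k + 1) * (2 * q i) = 2 * (q i * rad q ^ (k + 1)) := by
      rw [← h1]; noncomm_ring
    rw [h2, mul_assoc, mul_assoc, ← pow_succ]
    push_cast
    noncomm_ring

lemma rad_symm (h : IsCCR p q) (μ) (u v : S) :
    inner ℝ (rad q μ u) v = inner ℝ u (rad q μ v) := by
  simp only [rad, Finset.sum_apply, Pi.pow_apply, LinearMap.sum_apply, sum_inner, inner_sum]
  refine Finset.sum_congr rfl fun i _ => ?_
  simp [pow_two, h.q_symm]

lemma rad_pow_symm (h : IsCCR p q) (k : ℕ) (μ) (u v : S) :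
    inner ℝ ((rad q ^ k) μ u) v = inner ℝ u ((rad q ^ k) μ v) := by
  induction k generalizing u v with
  | zero => simp
  | succ k ih =>
    rw [pow_succ]
    conv_rhs => rw [← pow_succ, pow_succ']
    simp only [Pi.mul_apply, Module.End.mul_apply]
    rw [ih, rad_symm h]

/-- Moments of the square of the radius. -/
noncomputable def mom (q : Fin n → I → Module.End ℝ S) (μ : I) (ψ : S) (k : ℕ) : ℝ :=
  inner ℝ ((rad q ^ k) μ ψ) ψ

lemma rad_inner (h : IsCCR p q) (μ) (u v : S) :
    inner ℝ (rad q μ u) v = ∑ i, inner ℝ (q i μ u) (q i μ v) := by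
  simp only [rad, Finset.sum_apply, Pi.pow_apply, LinearMap.sum_apply, sum_inner]
  refine Finset.sum_congr rfl fun i _ => ?_
  simp [pow_two, h.q_symm]

lemma mom_add (h : IsCCR p q) (μ) (ψ : S) (j k : ℕ) :
    mom q μ ψ (j + k) = inner ℝ ((rad q ^ j) μ ψ) ((rad q ^ k) μ ψ) := by
  rw [mom, ← rad_pow_symm h, add_comm, pow_add]; rfl

lemma mom_zero (μ) (ψ : S) : mom q μ ψ 0 = ‖ψ‖ ^ 2 := by
  simp [mom]

lemma mom_even (h : IsCCR p q) (μ) (ψ : S) (k : ℕ) :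
    mom q μ ψ (2 * k) = ‖(rad q ^ k) μ ψ‖ ^ 2 := by
  rw [two_mul, mom_add h, real_inner_self_eq_norm_sq]

lemma mom_succ (h : IsCCR p q) (μ) (ψ : S) (k : ℕ) :
    mom q μ ψ (k + 1) = ∑ i, mom q μ (q i μ ψ) k := by
  rw [add_comm, mom_add h, pow_one, rad_inner h]
  refine Finset.sum_congr rfl fun i _ => ?_
  rw [mom, rad_pow_symm h]
  congr 1
  exact LinearMap.congr_fun (congrFun ((q_rad_comm h i).pow_right k).eq μ) ψ

lemma mom_nonneg (h : IsCCR p q) (μ) (ψ : S) (k : ℕ) : 0 ≤ mom q μ ψ k := by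
  induction k generalizing ψ with
  | zero => rw [mom_zero]; positivity
  | succ k ih => rw [mom_succ h]; exact Finset.sum_nonneg fun i _ => ih _

lemma mom_odd (h : IsCCR p q) (μ) (ψ : S) (k : ℕ) :
    mom q μ ψ (2 * k + 1) = ∑ i, ‖q i μ ((rad q ^ k) μ ψ)‖ ^ 2 := by
  rw [show 2 * k + 1 = (k + 1) + k by ring, mom_add h, pow_succ', Pi.mul_apply,
    Module.End.mul_apply, rad_inner h]
  simp only [real_inner_self_eq_norm_sq]

lemma mom_sq_le (h : IsCCR p q) (μ) (ψ : S) (k : ℕ) :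
    mom q μ ψ (k + 1) ^ 2 ≤ mom q μ ψ (k + 2) * mom q μ ψ k := by
  rcases Nat.even_or_odd' k with ⟨j, rfl | rfl⟩
  · rw [show 2 * j + 2 = 2 * (j + 1) by ring, mom_even h, mom_even h,
      show 2 * j + 1 = (j + 1) + j by ring, mom_add h, ← mul_pow]
    exact sq_le_sq' (by linarith [neg_le_of_abs_le (abs_real_inner_le_norm
      ((rad q ^ (j + 1)) μ ψ) ((rad q ^ j) μ ψ))]) (real_inner_le_norm _ _)
  · rw [show 2 * j + 1 + 2 = 2 * (j + 1) + 1 by ring, mom_odd h, mom_odd h,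
      show 2 * j + 1 + 1 = (j + 1) + (j + 1) by ring, mom_add h]
    have e : (rad q ^ (j + 1)) μ ψ = rad q μ ((rad q ^ j) μ ψ) := by rw [pow_succ']; rfl
    nth_rewrite 1 [e]
    rw [rad_inner h]
    calc (∑ i, inner ℝ (q i μ ((rad q ^ j) μ ψ)) (q i μ ((rad q ^ (j + 1)) μ ψ))) ^ 2
        ≤ (∑ i, ‖q i μ ((rad q ^ (j + 1)) μ ψ)‖ * ‖q i μ ((rad q ^ j) μ ψ)‖) ^ 2 := by
          refine sq_le_sq.mpr ?_
          rw [abs_of_nonneg (a := ∑ i, _ * _) (Finset.sum_nonneg fun i _ => by positivity)]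
          refine (Finset.abs_sum_le_sum_abs _ _).trans (Finset.sum_le_sum fun i _ => ?_)
          rw [mul_comm]; exact abs_real_inner_le_norm _ _
      _ ≤ _ := Finset.sum_mul_sq_le_sq_mul_sq _ _ _

/-- Moments interpolate. -/
lemma mom_interp (h : IsCCR p q) (K : ℕ) {ε : ℝ} (hε : 0 < ε) : ∃ D ≥ (0 : ℝ), ∀ μ (ψ : S),
    ∀ k < K, mom q μ ψ k ≤ ε * mom q μ ψ K + D * ‖ψ‖ ^ 2 := by
  obtain ⟨D, hD, H⟩ := exists_interp 1 zero_le_one K ε hε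
  refine ⟨D, hD, fun μ ψ k hk => ?_⟩
  rw [← mom_zero (q := q) μ ψ]
  refine H (mom q μ ψ) (mom_nonneg h μ ψ) (fun i hi _ => ?_) k hk
  obtain ⟨i, rfl⟩ : ∃ j, i = j + 1 := ⟨i - 1, by omega⟩
  have := mom_sq_le h μ ψ i
  have h1 := mom_nonneg h μ ψ (i + 1)
  have h2 := mom_nonneg h μ ψ i
  simp only [Nat.add_sub_cancel, one_mul]
  nlinarith [mul_nonneg h1 h2]

lemma mom_interp_le (h : IsCCR p q) (K : ℕ) : ∃ D ≥ (0 : ℝ), ∀ μ (ψ : S),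
    ∀ k ≤ K, mom q μ ψ k ≤ mom q μ ψ K + D * ‖ψ‖ ^ 2 := by
  obtain ⟨D, hD, H⟩ := mom_interp h K one_pos
  refine ⟨D, hD, fun μ ψ k hk => ?_⟩
  rcases hk.lt_or_eq with hk | rfl
  · simpa using H μ ψ k hk
  · have : 0 ≤ D * ‖ψ‖ ^ 2 := by positivity
    linarith

lemma lap_inner (h : IsCCR p q) (μ) (u v : S) :
    inner ℝ (lap p μ u) v = ∑ i, inner ℝ (p i μ u) (p i μ v) := by
  simp only [lap, Pi.neg_apply, Finset.sum_apply, Pi.pow_apply, LinearMap.neg_apply,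
    LinearMap.sum_apply, inner_neg_left, sum_inner, ← Finset.sum_neg_distrib]
  refine Finset.sum_congr rfl fun i _ => ?_
  simp [pow_two, h.p_anti]

lemma norm_sq_le_pq (h : IsCCR p q) (i : Fin n) (μ) (ψ : S) :
    ‖ψ‖ ^ 2 ≤ 2 * (‖p i μ ψ‖ * ‖q i μ ψ‖) := by
  have h1 : inner ℝ ψ ψ = -2 * inner ℝ (q i μ ψ) (p i μ ψ) := by
    have h2 := pq_apply h i i μ ψ
    rw [if_pos rfl] at h2
    have h3 : inner ℝ (p i μ (q i μ ψ)) ψ = inner ℝ (q i μ (p i μ ψ)) ψ + inner ℝ ψ ψ := by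
      rw [h2, inner_add_left]
    rw [h.p_anti, real_inner_comm ψ, ← h.q_symm] at h3
    linarith
  rw [← real_inner_self_eq_norm_sq, h1]
  have := abs_real_inner_le_norm (q i μ ψ) (p i μ ψ)
  have := neg_le_of_abs_le this
  nlinarith

lemma osc_inner_self (h : IsCCR p q) (μ) (ψ : S) :
    inner ℝ (osc N p q μ ψ) ψ = ∑ i, ‖p i μ ψ‖ ^ 2 + mom q μ ψ N := by
  simp only [osc, Pi.add_apply, LinearMap.add_apply, inner_add_left, lap_inner h, mom,
    real_inner_self_eq_norm_sq]

/-- The bottom of the spectrum of the anharmonic oscillator is positive. -/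
lemma norm_le_osc (h : IsCCR p q) (hn : 1 ≤ n) (hN : 1 ≤ N) : ∃ C ≥ (0 : ℝ), ∀ μ (ψ : S),
    ‖ψ‖ ≤ C * ‖osc N p q μ ψ‖ := by
  obtain ⟨D, hD, H⟩ := mom_interp_le h N
  refine ⟨4 * (1 + D), by positivity, fun μ ψ => ?_⟩
  let i : Fin n := ⟨0, hn⟩
  have h1 := norm_sq_le_pq h i μ ψ
  have h2 := osc_inner_self (N := N) h μ ψ
  have h3 := real_inner_le_norm (osc N p q μ ψ) ψ
  rw [h2] at h3
  set a := ‖osc N p q μ ψ‖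
  have h4 : ‖p i μ ψ‖ ^ 2 ≤ ∑ i, ‖p i μ ψ‖ ^ 2 :=
    Finset.single_le_sum (f := fun i => ‖p i μ ψ‖ ^ 2) (fun i _ => by positivity)
      (Finset.mem_univ i)
  have h5 := mom_nonneg h μ ψ N
  have h6 := H μ ψ 1 hN
  have h7 : ‖q i μ ψ‖ ^ 2 ≤ mom q μ ψ 1 := by
    have := mom_odd h μ ψ 0
    simp only [mul_zero, zero_add, pow_zero, Pi.one_apply, Module.End.one_apply] at this
    rw [this]
    exact Finset.single_le_sum (f := fun i => ‖q i μ ψ‖ ^ 2) (fun i _ => by positivity)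
      (Finset.mem_univ i)
  set P := ‖p i μ ψ‖
  set R := ‖q i μ ψ‖
  set y := ‖ψ‖
  have hy : 0 ≤ y := norm_nonneg _
  have ha : 0 ≤ a := norm_nonneg _
  have h0 : 0 ≤ ∑ i, ‖p i μ ψ‖ ^ 2 := Finset.sum_nonneg fun i _ => by positivity
  rcases hy.eq_or_lt with hy0 | hy0
  · rw [← hy0]; positivity
  have hP : P ^ 2 ≤ a * y := by linarith
  have hR : R ^ 2 ≤ a * y + D * y ^ 2 := by linarith
  have h8 : (y ^ 2) ^ 2 ≤ 4 * ((a * y) * (a * y + D * y ^ 2)) := by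
    calc (y ^ 2) ^ 2 ≤ (2 * (P * R)) ^ 2 := by
          apply pow_le_pow_left₀ (by positivity) h1
      _ = 4 * (P ^ 2 * R ^ 2) := by ring
      _ ≤ _ := by gcongr
  have h9 : y ^ 2 ≤ 4 * (a * (a + D * y)) := by
    have : y ^ 2 * y ^ 2 ≤ (4 * (a * (a + D * y))) * y ^ 2 := by nlinarith
    exact le_of_mul_le_mul_right this (by positivity)
  by_contra! hc
  have h10 : 4 * a ≤ y := by nlinarith [mul_nonneg hD ha]
  have h11 : 4 * (D * a) ≤ y - 4 * a := by linarith
  nlinarith [mul_le_mul_of_nonneg_right h11 hy, mul_nonneg ha hy]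

/-- The commutator term in the square of the anharmonic oscillator. -/
lemma lap_rad_inner (h : IsCCR p q) (μ) (ψ : S) (k : ℕ) :
    |inner ℝ (lap p μ ψ) ((rad q ^ (k + 1)) μ ψ) - ∑ i, mom q μ (p i μ ψ) (k + 1)| ≤
      (k + 1) * (‖lap p μ ψ‖ * ‖ψ‖ + mom q μ ψ (2 * k + 1)) := by
  have h1 : ∀ i, p i μ ((rad q ^ (k + 1)) μ ψ) =
      (rad q ^ (k + 1)) μ (p i μ ψ) + (2 * (k + 1) : ℝ) • q i μ ((rad q ^ k) μ ψ) := by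
    intro i
    have := LinearMap.congr_fun (congrFun (p_rad_pow h i k) μ) ψ
    refine this.trans ?_
    simp only [Pi.add_apply, Pi.mul_apply, LinearMap.add_apply, Module.End.mul_apply]
    congr 1
    rw [Pi.natCast_apply, Module.End.natCast_apply, ← Nat.cast_smul_eq_nsmul ℝ]
    push_cast; rfl
  have h2 : inner ℝ (lap p μ ψ) ((rad q ^ (k + 1)) μ ψ) - ∑ i, mom q μ (p i μ ψ) (k + 1) =
      ∑ i, (2 * (k + 1) : ℝ) * inner ℝ (p i μ ψ) (q i μ ((rad q ^ k) μ ψ)) := by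
    rw [lap_inner h, ← Finset.sum_sub_distrib]
    refine Finset.sum_congr rfl fun i _ => ?_
    rw [h1, inner_add_right, inner_smul_right, mom, rad_pow_symm h]; ring
  have h3 : ∑ i, ‖p i μ ψ‖ ^ 2 ≤ ‖lap p μ ψ‖ * ‖ψ‖ := by
    have := real_inner_le_norm (lap p μ ψ) ψ
    rw [lap_inner h] at this
    simpa only [real_inner_self_eq_norm_sq] using this
  rw [h2, mom_odd h]
  calc _ ≤ ∑ i, |(2 * (k + 1) : ℝ) * inner ℝ (p i μ ψ) (q i μ ((rad q ^ k) μ ψ))| :=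
        Finset.abs_sum_le_sum_abs _ _
    _ ≤ ∑ i, ((k + 1) * ‖p i μ ψ‖ ^ 2 + (k + 1) * ‖q i μ ((rad q ^ k) μ ψ)‖ ^ 2) := by
        refine Finset.sum_le_sum fun i _ => ?_
        rw [abs_mul, abs_of_nonneg (by positivity)]
        have := abs_real_inner_le_norm (p i μ ψ) (q i μ ((rad q ^ k) μ ψ))
        have h5 : (0 : ℝ) ≤ k + 1 := by positivity
        nlinarith [sq_nonneg (‖p i μ ψ‖ - ‖q i μ ((rad q ^ k) μ ψ)‖)]
    _ ≤ _ := by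
        rw [Finset.sum_add_distrib, ← Finset.mul_sum, ← Finset.mul_sum, ← mul_add]
        gcongr

lemma osc_scalar_aux {a y L z z' Z J D C k : ℝ} (hk : 0 < k) (hD : 0 ≤ D) (_ : 0 ≤ C)
    (hy : 0 ≤ y) (h1 : y ≤ C * a) (h2 : z' ≤ 1 / (4 * k) * z + D * y ^ 2)
    (h3 : -(k * (L * y + z')) ≤ J - Z) (h5 : a ^ 2 = L ^ 2 + 2 * J + z) :
    L ^ 2 / 2 + z / 2 + 2 * Z ≤ (1 + (k ^ 2 * 4 + 4 * k * D) * C ^ 2) * a ^ 2 := by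
  have hy2 : y ^ 2 ≤ C ^ 2 * a ^ 2 := by
    rw [← mul_pow]; exact pow_le_pow_left₀ hy h1 2
  have h8 : k * z' ≤ z / 4 + k * D * y ^ 2 := by
    calc k * z' ≤ k * (1 / (4 * k) * z + D * y ^ 2) := by gcongr
      _ = _ := by field_simp
  have h9 : k * (L * y) ≤ L ^ 2 / 4 + k ^ 2 * y ^ 2 := by
    nlinarith [sq_nonneg (L / 2 - k * y)]
  have h10 : 0 ≤ k * D := by positivity
  have e1 : L ^ 2 / 2 + z / 2 + 2 * Z ≤ a ^ 2 + (2 * k ^ 2 + 2 * (k * D)) * y ^ 2 := by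
    linarith
  have e2 : (2 * k ^ 2 + 2 * (k * D)) * y ^ 2 ≤ (k ^ 2 * 4 + 4 * k * D) * (C ^ 2 * a ^ 2) := by
    have : 2 * k ^ 2 + 2 * (k * D) ≤ k ^ 2 * 4 + 4 * k * D := by
      have := sq_nonneg k
      linarith
    gcongr
  linarith

lemma lap_rad_le (h : IsCCR p q) (hn : 1 ≤ n) (hN : 1 ≤ N) : ∃ C ≥ (0 : ℝ), ∀ μ (ψ : S),
    ‖ψ‖ ^ 2 ≤ C * ‖osc N p q μ ψ‖ ^ 2 ∧ ‖lap p μ ψ‖ ^ 2 ≤ C * ‖osc N p q μ ψ‖ ^ 2 ∧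
    mom q μ ψ (2 * N) ≤ C * ‖osc N p q μ ψ‖ ^ 2 ∧
    ∑ i, mom q μ (p i μ ψ) N ≤ C * ‖osc N p q μ ψ‖ ^ 2 := by
  obtain ⟨k, rfl⟩ : ∃ k, N = k + 1 := ⟨N - 1, by omega⟩
  obtain ⟨C₀, hC₀, H₀⟩ := norm_le_osc (N := k + 1) h hn hN
  obtain ⟨D, hD, H⟩ := mom_interp h (2 * (k + 1)) (ε := 1 / (4 * (k + 1))) (by positivity)
  set M : ℝ := 1 + ((k + 1) ^ 2 * 4 + 4 * (k + 1) * D) * C₀ ^ 2 with hM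
  have hM1 : 1 ≤ M := by
    have : 0 ≤ ((k + 1) ^ 2 * 4 + 4 * (k + 1) * D) * C₀ ^ 2 := by positivity
    linarith
  refine ⟨2 * M + C₀ ^ 2, by positivity, fun μ ψ => ?_⟩
  have hk : (0 : ℝ) < k + 1 := by positivity
  have h1 := H₀ μ ψ
  have h2 := H μ ψ (2 * k + 1) (by omega)
  have h3 := abs_le.mp (lap_rad_inner h μ ψ k)
  have h4 := mom_even h μ ψ (k + 1)
  have h5 : ‖osc (k + 1) p q μ ψ‖ ^ 2 = ‖lap p μ ψ‖ ^ 2 +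
      2 * inner ℝ (lap p μ ψ) ((rad q ^ (k + 1)) μ ψ) + ‖(rad q ^ (k + 1)) μ ψ‖ ^ 2 := by
    rw [← norm_add_sq_real]; rfl
  have h6 : 0 ≤ ∑ i, mom q μ (p i μ ψ) (k + 1) := Finset.sum_nonneg fun i _ => mom_nonneg h _ _ _
  rw [← h4] at h5
  have h7 := mom_nonneg h μ ψ (2 * (k + 1))
  set a := ‖osc (k + 1) p q μ ψ‖
  set y := ‖ψ‖
  set L := ‖lap p μ ψ‖
  set z := mom q μ ψ (2 * (k + 1))
  set z' := mom q μ ψ (2 * k + 1)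
  set Z := ∑ i, mom q μ (p i μ ψ) (k + 1)
  set J := inner ℝ (lap p μ ψ) ((rad q ^ (k + 1)) μ ψ)
  have hy : 0 ≤ y := norm_nonneg _
  have ha : 0 ≤ a := norm_nonneg _
  have h10 := osc_scalar_aux hk hD hC₀ hy h1 h2 h3.1 h5
  rw [← hM] at h10
  have hy2 : y ^ 2 ≤ C₀ ^ 2 * a ^ 2 := by
    rw [← mul_pow]; exact pow_le_pow_left₀ hy h1 2
  have h11 : 0 ≤ C₀ ^ 2 * a ^ 2 := by positivity
  have h12 : 0 ≤ M * a ^ 2 := by positivity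
  have h13 : 0 ≤ L ^ 2 := by positivity
  rw [add_mul, mul_assoc]
  refine ⟨?_, ?_, ?_, ?_⟩ <;> linarith

end CCR

namespace CCR

variable {n : ℕ} {I S : Type*} [SeminormedAddCommGroup S] [InnerProductSpace ℝ S]
variable {N : ℕ} {p q : Fin n → I → Module.End ℝ S}

/-- Products of momenta. -/
def pW (p : Fin n → I → Module.End ℝ S) (b : List (Fin n)) : I → Module.End ℝ S := (b.map p).prod

@[simp] lemma pW_nil : pW p [] = 1 := rfl
@[simp] lemma pW_cons (i b) : pW p (i :: b) = p i * pW p b := by simp [pW]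

/-- Operators in normal order, of weight at most `d`. -/
def nf (N : ℕ) (p q : Fin n → I → Module.End ℝ S) (d : ℤ) :
    Submodule ℝ (I → Module.End ℝ S) :=
  Submodule.span ℝ {T | ∃ b a : List (Fin n), (N * b.length + a.length : ℤ) ≤ d ∧
    T = pW p b * pW q a}

lemma nf_mem {b a : List (Fin n)} {d : ℤ} (h : (N * b.length + a.length : ℤ) ≤ d) :
    pW p b * pW q a ∈ nf N p q d := Submodule.subset_span ⟨b, a, h, rfl⟩

lemma nf_mono {d e : ℤ} (h : d ≤ e) : nf N p q d ≤ nf N p q e :=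
  Submodule.span_mono fun _ ⟨b, a, hw, hT⟩ => ⟨b, a, hw.trans h, hT⟩

lemma p_mul_nf {d : ℤ} {T : I → Module.End ℝ S} (hT : T ∈ nf N p q d) (i : Fin n) :
    p i * T ∈ nf N p q (N + d) := by
  induction hT using Submodule.span_induction with
  | zero => simp
  | add x y _ _ hx hy => rw [mul_add]; exact add_mem hx hy
  | smul c x _ hx => rw [mul_smul_comm]; exact Submodule.smul_mem _ _ hx
  | mem x hx =>
    obtain ⟨b, a, hu, rfl⟩ := hx
    rw [← mul_assoc, ← pW_cons]
    refine nf_mem ?_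
    push_cast [List.length_cons]; linarith

lemma q_mul_nf_basic (h : IsCCR p q) (i : Fin n) (b a : List (Fin n)) :
    q i * (pW p b * pW q a) ∈ nf N p q (N * b.length + a.length + 1) := by
  induction b with
  | nil =>
    simp only [pW_nil, one_mul, ← pW_cons]
    rw [← one_mul (pW q (i :: a)), ← pW_nil (p := p)]
    exact nf_mem (by simp)
  | cons j b ih =>
    have e : q i * (pW p (j :: b) * pW q a) = p j * (q i * (pW p b * pW q a)) -
        (p j * q i - q i * p j) * (pW p b * pW q a) := by
      simp only [pW_cons]; noncomm_ring
    rw [e, h.pq]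
    refine sub_mem (nf_mono ?_ (p_mul_nf ih j)) ?_
    · push_cast [List.length_cons]; linarith
    · split_ifs
      · rw [one_mul]; refine nf_mem ?_
        push_cast [List.length_cons]
        nlinarith
      · simp

lemma q_mul_nf (h : IsCCR p q) {d : ℤ} {T : I → Module.End ℝ S} (hT : T ∈ nf N p q d)
    (i : Fin n) : q i * T ∈ nf N p q (1 + d) := by
  induction hT using Submodule.span_induction with
  | zero => simp
  | add x y _ _ hx hy => rw [mul_add]; exact add_mem hx hy
  | smul c x _ hx => rw [mul_smul_comm]; exact Submodule.smul_mem _ _ hx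
  | mem x hx =>
    obtain ⟨b, a, hu, rfl⟩ := hx
    exact nf_mono (by linarith) (q_mul_nf_basic h i b a)

lemma filt_le_nf (h : IsCCR p q) (d : ℤ) : filt N p q d ≤ nf N p q d := by
  refine Submodule.span_le.mpr ?_
  rintro _ ⟨w, hw, rfl⟩
  refine nf_mono hw ?_
  clear hw
  induction w with
  | nil =>
    have : word p q [] = pW p [] * pW q [] := by simp
    rw [this]; exact nf_mem (by simp)
  | cons l w ih =>
    rw [word_cons, wt_cons]
    rcases l with i | i
    · exact p_mul_nf ih i
    · exact q_mul_nf h ih i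

lemma pW_p_mem (b : List (Fin n)) : pW p b ∈ filt N p q (N * b.length) := by
  induction b with
  | nil => simpa using one_mem le_rfl
  | cons i b ih =>
    rw [pW_cons]; convert mul_mem (p_mem i) ih using 1
    push_cast [List.length_cons]; ring_nf

lemma pW_q_mem (b : List (Fin n)) : pW q b ∈ filt N p q b.length := by
  induction b with
  | nil => simpa using one_mem le_rfl
  | cons i b ih =>
    rw [pW_cons]; convert mul_mem (q_mem (N := N) i) ih using 1
    push_cast [List.length_cons]; ring_nf

lemma norm_pW_q_sq_le (h : IsCCR p q) (μ) (a : List (Fin n)) (ψ : S) :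
    ‖pW q a μ ψ‖ ^ 2 ≤ mom q μ ψ a.length := by
  induction a using List.reverseRecOn generalizing ψ with
  | nil => simp [mom_zero]
  | append_singleton a i ih =>
    have e : pW q (a ++ [i]) μ ψ = pW q a μ (q i μ ψ) := by simp [pW]
    rw [e, List.length_append, List.length_singleton, mom_succ h]
    exact (ih _).trans (Finset.single_le_sum (f := fun i => mom q μ (q i μ ψ) a.length)
      (fun i _ => mom_nonneg h _ _ _) (Finset.mem_univ i))

lemma p_pW_q (h : IsCCR p q) (i : Fin n) (a : List (Fin n)) :
    ∃ L : List (List (Fin n)), (∀ a' ∈ L, a'.length ≤ a.length) ∧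
      p i * pW q a = pW q a * p i + (L.map (pW q)).sum := by
  induction a with
  | nil => exact ⟨[], by simp, by simp⟩
  | cons j a ih =>
    obtain ⟨L, hL, e⟩ := ih
    have e1 : p i * pW q (j :: a) = pW q (j :: a) * p i + (q j * (L.map (pW q)).sum +
        (p i * q j - q j * p i) * pW q a) := by
      calc p i * pW q (j :: a) = q j * (p i * pW q a) + (p i * q j - q j * p i) * pW q a := by
            rw [pW_cons]; noncomm_ring
        _ = _ := by rw [e, pW_cons]; noncomm_ring
    have e2 : q j * (L.map (pW q)).sum = ((L.map (j :: ·)).map (pW q)).sum := by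
      rw [← List.sum_map_mul_left]; simp [Function.comp_def]
    rw [h.pq] at e1
    by_cases hij : i = j
    · refine ⟨L.map (j :: ·) ++ [a], ?_, ?_⟩
      · intro a' ha'
        simp only [List.mem_append, List.mem_map, List.mem_singleton] at ha'
        rcases ha' with ⟨b, hb, rfl⟩ | rfl
        · simpa using hL b hb
        · simp
      · rw [e1, e2, if_pos hij]; simp
    · refine ⟨L.map (j :: ·), ?_, ?_⟩
      · intro a' ha'
        simp only [List.mem_map] at ha'
        obtain ⟨b, hb, rfl⟩ := ha'
        simpa using hL b hb
      · rw [e1, e2, if_neg hij]; simp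

/-- `T` is dominated by the operator `B`, uniformly in the parameter. -/
def Dom (B T : I → Module.End ℝ S) : Prop := ∃ C ≥ (0 : ℝ), ∀ μ ψ, ‖T μ ψ‖ ≤ C * ‖B μ ψ‖

lemma Dom.add {B T U : I → Module.End ℝ S} (hT : Dom B T) (hU : Dom B U) : Dom B (T + U) := by
  obtain ⟨C, hC, h1⟩ := hT
  obtain ⟨D, hD, h2⟩ := hU
  refine ⟨C + D, by positivity, fun μ ψ => (norm_add_le _ _).trans ?_⟩
  rw [add_mul]; exact add_le_add (h1 μ ψ) (h2 μ ψ)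

lemma Dom.smul {B T : I → Module.End ℝ S} (hT : Dom B T) (c : ℝ) : Dom B (c • T) := by
  obtain ⟨C, hC, h1⟩ := hT
  refine ⟨|c| * C, by positivity, fun μ ψ => ?_⟩
  rw [mul_assoc, Pi.smul_apply, LinearMap.smul_apply, norm_smul]
  exact mul_le_mul_of_nonneg_left (h1 μ ψ) (abs_nonneg c)

lemma Dom.zero {B : I → Module.End ℝ S} : Dom B 0 := ⟨0, le_rfl, fun μ ψ => by simp⟩

lemma Dom.trans {B T U : I → Module.End ℝ S} (hT : Dom B T) (hU : Dom T U) : Dom B U := by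
  obtain ⟨C, hC, h1⟩ := hT
  obtain ⟨D, hD, h2⟩ := hU
  refine ⟨D * C, by positivity, fun μ ψ => (h2 μ ψ).trans ?_⟩
  rw [mul_assoc]; exact mul_le_mul_of_nonneg_left (h1 μ ψ) hD

lemma Dom.mul_right {B T : I → Module.End ℝ S} (hT : Dom B T) (U : I → Module.End ℝ S) :
    Dom (B * U) (T * U) := by
  obtain ⟨C, hC, h1⟩ := hT
  exact ⟨C, hC, fun μ ψ => h1 μ (U μ ψ)⟩

lemma Dom.of_sq {B T : I → Module.End ℝ S} {C : ℝ}
    (h : ∀ μ ψ, ‖T μ ψ‖ ^ 2 ≤ C * ‖B μ ψ‖ ^ 2) : Dom B T := by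
  refine ⟨√(max C 0), by positivity, fun μ ψ => ?_⟩
  refine abs_le_of_sq_le_sq' ?_ (by positivity) |>.2
  rw [mul_pow, Real.sq_sqrt (by positivity)]
  exact (h μ ψ).trans (by gcongr; exact le_max_left _ _)

lemma Dom.span {B : I → Module.End ℝ S} {s : Set (I → Module.End ℝ S)}
    (h : ∀ T ∈ s, Dom B T) {T : I → Module.End ℝ S} (hT : T ∈ Submodule.span ℝ s) : Dom B T := by
  induction hT using Submodule.span_induction with
  | zero => exact .zero
  | add x y _ _ hx hy => exact hx.add hy
  | smul c x _ hx => exact hx.smul c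
  | mem x hx => exact h x hx

lemma dom_pW_q (h : IsCCR p q) (hn : 1 ≤ n) (hN : 1 ≤ N) (a : List (Fin n))
    (ha : a.length ≤ 2 * N) : Dom (osc N p q) (pW q a) := by
  obtain ⟨C, hC, H⟩ := lap_rad_le h hn hN
  obtain ⟨D, hD, H'⟩ := mom_interp_le h (2 * N)
  refine Dom.of_sq (C := C + D * C) fun μ ψ => ?_
  obtain ⟨h1, -, h3, -⟩ := H μ ψ
  have h4 := norm_pW_q_sq_le h μ a ψ
  have h5 := H' μ ψ _ ha
  have h6 := mul_le_mul_of_nonneg_left h1 hD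
  linarith

lemma dom_p_pW_q (h : IsCCR p q) (hn : 1 ≤ n) (hN : 1 ≤ N) (i : Fin n) (a : List (Fin n))
    (ha : a.length ≤ N) : Dom (osc N p q) (p i * pW q a) := by
  obtain ⟨L, hL, e⟩ := p_pW_q h i a
  rw [e]
  refine Dom.add ?_ ?_
  · obtain ⟨C, hC, H⟩ := lap_rad_le h hn hN
    obtain ⟨D, hD, H'⟩ := mom_interp_le h N
    refine Dom.of_sq (C := C + D * C) fun μ ψ => ?_
    obtain ⟨h1, h2, -, h4⟩ := H μ ψ
    have h5 := norm_pW_q_sq_le h μ a (p i μ ψ)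
    have h6 := H' μ (p i μ ψ) _ ha
    have h7 := Finset.single_le_sum (f := fun i => mom q μ (p i μ ψ) N)
      (fun i _ => mom_nonneg h _ _ _) (Finset.mem_univ i)
    have h8 : ‖p i μ ψ‖ ^ 2 ≤ ‖lap p μ ψ‖ * ‖ψ‖ := by
      have := real_inner_le_norm (lap p μ ψ) ψ
      rw [lap_inner h] at this
      refine le_trans ?_ this
      rw [← real_inner_self_eq_norm_sq]
      exact Finset.single_le_sum (f := fun i => inner ℝ (p i μ ψ) (p i μ ψ))
        (fun i _ => real_inner_self_nonneg) (Finset.mem_univ i)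
    have h9 : ‖p i μ ψ‖ ^ 2 ≤ C * ‖osc N p q μ ψ‖ ^ 2 := by
      nlinarith [sq_nonneg (‖lap p μ ψ‖ - ‖ψ‖)]
    have h10 := mul_le_mul_of_nonneg_left h9 hD
    change ‖pW q a μ (p i μ ψ)‖ ^ 2 ≤ _
    linarith
  · clear e
    induction L with
    | nil => simpa using Dom.zero
    | cons b L ih =>
      rw [List.map_cons, List.sum_cons]
      refine Dom.add (dom_pW_q h hn hN b ?_) (ih fun a' ha' => hL a' (List.mem_cons_of_mem _ ha'))
      have := hL b List.mem_cons_self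
      omega

lemma dom_pp (h : IsCCR p q) (hn : 1 ≤ n) (hN : 1 ≤ N) (i j : Fin n) :
    Dom (osc N p q) (p i * p j) := by
  obtain ⟨C, hC, H⟩ := lap_rad_le h hn hN
  refine Dom.of_sq (C := C) fun μ ψ => ?_
  obtain ⟨-, h2, -, -⟩ := H μ ψ
  refine le_trans ?_ h2
  have e : ‖lap p μ ψ‖ ^ 2 = ∑ i, ∑ j, ‖p i μ (p j μ ψ)‖ ^ 2 := by
    rw [← real_inner_self_eq_norm_sq, lap_inner h]
    refine Finset.sum_congr rfl fun i _ => ?_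
    rw [h.p_anti, real_inner_comm, ← inner_neg_left]
    have : -(p i μ (p i μ (lap p μ ψ))) = -(lap p μ (p i μ (p i μ ψ))) := by
      congr 1
      have hc : Commute (p i) (lap p) := by
        refine Commute.neg_right (Commute.sum_right _ _ _ fun j _ => Commute.pow_right (h.pp i j) 2)
      exact LinearMap.congr_fun (congrFun ((hc.pow_left 2).eq) μ) ψ |> fun t => by
        simpa [pow_two] using t
    rw [this, inner_neg_left, lap_inner h, ← Finset.sum_neg_distrib]
    refine Finset.sum_congr rfl fun j _ => ?_
    rw [pp_apply h j i, h.p_anti, neg_neg, pp_apply h j i, real_inner_self_eq_norm_sq]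
  rw [e]
  refine le_trans ?_ (Finset.single_le_sum (f := fun i => ∑ j, ‖p i μ (p j μ ψ)‖ ^ 2)
    (fun i _ => Finset.sum_nonneg fun j _ => by positivity) (Finset.mem_univ i))
  exact Finset.single_le_sum (f := fun j => ‖p i μ (p j μ ψ)‖ ^ 2)
    (fun j _ => by positivity) (Finset.mem_univ j)

/-- A normal word of weight at most `d + 2 N` splits off a factor dominated by the oscillator. -/
lemma exists_split (h : IsCCR p q) (hn : 1 ≤ n) (hN : 1 ≤ N) (d : ℕ) (b a : List (Fin n))
    (hw : (N * b.length + a.length : ℤ) ≤ d + 2 * N) :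
    ∃ U v : I → Module.End ℝ S, Dom (osc N p q) U ∧ v ∈ filt N p q d ∧
      pW p b * pW q a = U * v ∧ (d = 0 → v = 1) := by
  have e0 : ∀ k, pW q a = pW q (a.take k) * pW q (a.drop k) := fun k => by
    simp only [pW]
    rw [← List.prod_append, ← List.map_append, List.take_append_drop]
  match b with
  | [] =>
    refine ⟨pW q (a.take (2 * N)), pW q (a.drop (2 * N)), dom_pW_q h hn hN _ (by simp), ?_, ?_, ?_⟩
    · refine filt_mono ?_ (pW_q_mem _)
      simp only [List.length_nil, List.length_drop] at *
      omega
    · rw [pW_nil, one_mul]; exact e0 _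
    · rintro rfl
      rw [List.drop_eq_nil_of_le]
      · rfl
      · simp only [List.length_nil] at *; omega
  | [i] =>
    refine ⟨p i * pW q (a.take N), pW q (a.drop N), dom_p_pW_q h hn hN _ _ (by simp), ?_, ?_, ?_⟩
    · refine filt_mono ?_ (pW_q_mem _)
      simp only [List.length_singleton, List.length_drop] at *
      push_cast at hw
      omega
    · rw [pW_cons, pW_nil, mul_one, mul_assoc, ← e0]
    · rintro rfl
      rw [List.drop_eq_nil_of_le]
      · rfl
      · simp only [List.length_singleton] at *; push_cast at hw; omega
  | i :: j :: b =>
    refine ⟨p i * p j, pW p b * pW q a, dom_pp h hn hN i j, ?_, ?_, ?_⟩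
    · refine filt_mono ?_ (mul_mem (pW_p_mem b) (pW_q_mem a))
      simp only [List.length_cons] at *
      push_cast at hw
      linarith
    · simp only [pW_cons, mul_assoc]
    · rintro rfl
      simp only [List.length_cons] at *
      push_cast at hw
      have h1 : (N : ℤ) * b.length + a.length ≤ 0 := by linarith
      have h2 : (0 : ℤ) ≤ N * b.length := by positivity
      have h3 : a.length = 0 := by omega
      have h4 : (N : ℤ) * b.length = 0 := by omega
      have h5 : b.length = 0 := by
        rcases mul_eq_zero.mp h4 with h5 | h5 <;> omega
      rw [List.length_eq_zero_iff.mp h3, List.length_eq_zero_iff.mp h5]; simp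

/-- Powers of the anharmonic oscillator dominate all operators of the same weight. -/
theorem dom_osc_pow (h : IsCCR p q) (hn : 1 ≤ n) (hN : 1 ≤ N) (s : ℕ) :
    ∀ T ∈ filt N p q (2 * N * s), Dom (osc N p q ^ s) T := by
  induction s with
  | zero =>
    intro T hT
    have hT := filt_le_nf h _ hT
    refine Dom.span ?_ hT
    rintro _ ⟨b, a, hw, rfl⟩
    simp only [Nat.cast_zero, mul_zero] at hw
    have h2 : (0 : ℤ) ≤ N * b.length := by positivity
    have h3 : a.length = 0 := by omega
    have h4 : (N : ℤ) * b.length = 0 := by omega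
    have h5 : b.length = 0 := by
      rcases mul_eq_zero.mp h4 with h5 | h5 <;> omega
    rw [List.length_eq_zero_iff.mp h3, List.length_eq_zero_iff.mp h5]
    exact ⟨1, zero_le_one, fun μ ψ => by simp⟩
  | succ s ih =>
    have main : ∀ d : ℕ, d ≤ 2 * N * s → ∀ T ∈ filt N p q (d + 2 * N),
        Dom (osc N p q ^ (s + 1)) T := by
      intro d
      induction d with
      | zero =>
        intro _ T hT
        refine Dom.span ?_ (filt_le_nf h _ hT)
        rintro _ ⟨b, a, hw, rfl⟩
        obtain ⟨U, v, hU, -, e, hv⟩ := exists_split h hn hN 0 b a hw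
        rw [e, hv rfl, mul_one]
        refine Dom.trans ?_ hU
        rw [pow_succ]
        nth_rewrite 2 [← one_mul (osc N p q)]
        exact (ih 1 (one_mem (by positivity))).mul_right _
      | succ d ihd =>
        intro hd T hT
        refine Dom.span ?_ (filt_le_nf h _ hT)
        rintro _ ⟨b, a, hw, rfl⟩
        obtain ⟨U, v, hU, hv, e, -⟩ := exists_split h hn hN (d + 1) b a hw
        rw [e]
        refine Dom.trans ?_ (hU.mul_right v)
        have e2 : osc N p q * v = v * osc N p q + (osc N p q * v - v * osc N p q) := by abel
        rw [e2]
        refine Dom.add ?_ (ihd (by omega) _ (filt_mono ?_ (comm_mem h osc_mem hv)))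
        · rw [pow_succ]
          refine (ih v (filt_mono ?_ hv)).mul_right _
          exact_mod_cast hd
        · push_cast; linarith
    intro T hT
    refine main (2 * N * s) le_rfl T (filt_mono ?_ hT)
    push_cast; linarith

end CCR

/-- The space of test functions, as a subspace of all functions. -/
def testSub (E : Type*) [NormedAddCommGroup E] [NormedSpace ℝ E] : Submodule ℝ (E → ℝ) where
  carrier := {f | ContDiff ℝ ∞ f ∧ HasCompactSupport f}
  add_mem' hf hg := ⟨hf.1.add hg.1, hf.2.add hg.2⟩
  zero_mem' := ⟨contDiff_const, HasCompactSupport.zero⟩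
  smul_mem' c _ hf := ⟨hf.1.const_smul c, hf.2.smul_left (f := fun _ => c)⟩

/-- Smooth functions with compact support. -/
def TestFn (E : Type*) [NormedAddCommGroup E] [NormedSpace ℝ E] : Type _ := testSub E

namespace TestFn

variable {E : Type*} [NormedAddCommGroup E] [NormedSpace ℝ E]

noncomputable instance : AddCommGroup (TestFn E) := inferInstanceAs (AddCommGroup (testSub E))
noncomputable instance : Module ℝ (TestFn E) := inferInstanceAs (Module ℝ (testSub E))

instance : FunLike (TestFn E) E ℝ where
  coe f := f.1
  coe_injective := Subtype.val_injective

/-- Bundling a test function. -/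
def mk (f : E → ℝ) (h1 : ContDiff ℝ ∞ f) (h2 : HasCompactSupport f) : TestFn E := ⟨f, h1, h2⟩

@[simp] lemma coe_mk (f : E → ℝ) (h1 h2) : ⇑(mk f h1 h2) = f := rfl
@[simp] lemma coe_add (f g : TestFn E) : ⇑(f + g) = f + g := rfl
@[simp] lemma coe_sub (f g : TestFn E) : ⇑(f - g) = f - g := rfl
@[simp] lemma coe_neg (f : TestFn E) : ⇑(-f) = -f := rfl
@[simp] lemma coe_zero : ⇑(0 : TestFn E) = 0 := rfl
@[simp] lemma coe_smul (c : ℝ) (f : TestFn E) : ⇑(c • f) = c • ⇑f := rfl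

@[ext] lemma ext {f g : TestFn E} (h : ∀ x, f x = g x) : f = g := DFunLike.ext _ _ h

lemma smooth (f : TestFn E) : ContDiff ℝ ∞ f := f.2.1
lemma compact (f : TestFn E) : HasCompactSupport f := f.2.2
lemma continuous (f : TestFn E) : Continuous f := f.smooth.continuous
lemma differentiable (f : TestFn E) : Differentiable ℝ f := f.smooth.differentiable (by simp)

/-- Evaluation at a point. -/
def ev (x : E) : TestFn E →ₗ[ℝ] ℝ where
  toFun f := f x
  map_add' _ _ := rfl
  map_smul' _ _ := rfl

lemma sum_apply {ι : Type*} (s : Finset ι) (f : ι → TestFn E) (x : E) :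
    (∑ i ∈ s, f i) x = ∑ i ∈ s, f i x := map_sum (ev x) f s

noncomputable instance : Mul (TestFn E) :=
  ⟨fun f g => mk (f * g) (f.smooth.mul g.smooth) (f.compact.mul_right)⟩

@[simp] lemma coe_mul (f g : TestFn E) : ⇑(f * g) = f * g := rfl

/-- Multiplication by a smooth function. -/
def M (g : E → ℝ) (hg : ContDiff ℝ ∞ g) : Module.End ℝ (TestFn E) where
  toFun f := mk (g * f) (hg.mul f.smooth) (f.compact.mul_left)
  map_add' f h := by ext x; simp [mul_add]
  map_smul' c f := by ext x; simp

@[simp] lemma M_apply (g : E → ℝ) (hg) (f : TestFn E) (x : E) : M g hg f x = g x * f x := rfl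

/-- Directional derivative. -/
noncomputable def D (v : E) : Module.End ℝ (TestFn E) where
  toFun f := mk (fun x => fderiv ℝ f x v)
    ((f.smooth.fderiv_right (by simp)).clm_apply contDiff_const) (f.compact.fderiv_apply ℝ v)
  map_add' f h := by
    ext x
    simp [fderiv_add f.differentiable.differentiableAt h.differentiable.differentiableAt]
  map_smul' c f := by
    ext x
    simp [fderiv_const_smul f.differentiable.differentiableAt]

lemma D_apply (v : E) (f : TestFn E) (x : E) : D v f x = fderiv ℝ f x v := rfl

lemma D_mul (v : E) (f g : TestFn E) : D v (f * g) = D v f * g + f * D v g := by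
  ext x
  simp only [D_apply, coe_mul, coe_add, Pi.add_apply, Pi.mul_apply]
  rw [fderiv_mul f.differentiable.differentiableAt g.differentiable.differentiableAt]
  simp; ring

lemma D_M (v : E) (g : E → ℝ) (hg : ContDiff ℝ ∞ g) (f : TestFn E) (x : E) :
    D v (M g hg f) x = g x * D v f x + fderiv ℝ g x v * f x := by
  have e : ⇑(M g hg f) = g * ⇑f := rfl
  rw [D_apply, e, fderiv_mul (hg.differentiable (by simp)).differentiableAt
    f.differentiable.differentiableAt]
  simp [D_apply]; ring

lemma D_comm (v w : E) : D v * D w = D w * (D v : Module.End ℝ (TestFn E)) := by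
  ext f x
  simp only [Module.End.mul_apply]
  have key : ∀ a b : E, D a (D b f) x = fderiv ℝ (fderiv ℝ f) x a b := by
    intro a b
    rw [D_apply]
    have e : ⇑(D b f) = fun y => fderiv ℝ f y b := rfl
    have hd : DifferentiableAt ℝ (fderiv ℝ f) x :=
      ((f.smooth.fderiv_right (m := ∞) (by simp)).differentiable (by simp)).differentiableAt
    rw [e, fderiv_clm_apply hd (differentiableAt_const b)]
    simp
  rw [key, key]
  exact (f.smooth.contDiffAt.isSymmSndFDerivAt (by
    simp only [minSmoothness_of_isRCLikeNormedField]; exact WithTop.coe_le_coe.mpr le_top)) v w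

lemma M_comm (g h : E → ℝ) (hg hh) : M g hg * M h hh = M h hh * (M g hg) := by
  ext f x; simp; ring

variable [MeasureSpace E]

section

variable [BorelSpace E] [(volume : Measure E).IsAddHaarMeasure]

lemma integrable (f : TestFn E) : Integrable f := f.continuous.integrable_of_hasCompactSupport f.compact

lemma integrable_mul (f g : TestFn E) : Integrable (fun x => f x * g x) := (f * g).integrable

/-- The `L²` inner product is positive semidefinite. -/
@[reducible] noncomputable def core : PreInnerProductSpace.Core ℝ (TestFn E) where
  inner f g := ∫ x, f x * g x
  conj_inner_symm f g := by simp only [conj_trivial]; congr 1; ext x; ring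
  re_inner_nonneg f := integral_nonneg fun x => mul_self_nonneg _
  add_left f g h := by
    simp only [coe_add, Pi.add_apply, add_mul]
    exact integral_add (f.integrable_mul h) (g.integrable_mul h)
  smul_left f g c := by
    simp only [coe_smul, Pi.smul_apply, smul_eq_mul, mul_assoc, conj_trivial]
    exact integral_const_mul _ _

noncomputable instance : SeminormedAddCommGroup (TestFn E) :=
  @InnerProductSpace.Core.toSeminormedAddCommGroup ℝ (TestFn E) _ _ _ core

noncomputable instance : InnerProductSpace ℝ (TestFn E) := InnerProductSpace.ofCore core

lemma inner_def (f g : TestFn E) : inner ℝ f g = ∫ x, f x * g x := rfl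

lemma norm_sq (f : TestFn E) : ‖f‖ ^ 2 = ∫ x, f x ^ 2 := by
  rw [← real_inner_self_eq_norm_sq, inner_def]; simp only [pow_two]

lemma memLp (f : TestFn E) (p : ℝ≥0∞) : MemLp f p := f.continuous.memLp_of_hasCompactSupport f.compact

lemma eLpNorm_eq (f : TestFn E) : eLpNorm f 2 volume = ENNReal.ofReal ‖f‖ := by
  rw [← ENNReal.toReal_eq_toReal_iff' (f.memLp 2).2.ne ENNReal.ofReal_ne_top,
    ENNReal.toReal_ofReal (norm_nonneg _)]
  have h := (f.memLp 2).eLpNorm_eq_integral_rpow_norm (by simp) (by simp)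
  rw [h, ENNReal.toReal_ofReal (by positivity)]
  simp only [ENNReal.toReal_ofNat, Real.rpow_two, Real.norm_eq_abs, sq_abs]
  rw [← norm_sq, inv_eq_one_div, ← Real.sqrt_eq_rpow, Real.sqrt_sq (norm_nonneg _)]

lemma M_symm (g : E → ℝ) (hg : ContDiff ℝ ∞ g) (f h : TestFn E) :
    inner ℝ (M g hg f) h = inner ℝ f (M g hg h) := by
  simp only [inner_def, M_apply]; congr 1; ext x; ring

lemma inner_mul_left (f g h : TestFn E) : inner ℝ (f * g) h = inner ℝ g (f * h) := by
  simp only [inner_def, coe_mul, Pi.mul_apply]; congr 1; ext x; ring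

/-- A pointwise bound gives a bound of the norm. -/
lemma norm_le_of_abs_le {ι : Type*} (s : Finset ι) (f : TestFn E) (g : ι → TestFn E)
    (h : ∀ x, |f x| ≤ ∑ i ∈ s, |g i x|) : ‖f‖ ≤ ∑ i ∈ s, ‖g i‖ := by
  have h1 : eLpNorm f 2 volume ≤ ∑ i ∈ s, eLpNorm (fun x => |g i x|) 2 volume := by
    calc eLpNorm f 2 volume ≤ eLpNorm (∑ i ∈ s, fun x => |g i x|) 2 volume := by
          refine eLpNorm_mono_real fun x => ?_
          simpa using h x
      _ ≤ _ := eLpNorm_sum_le (fun i _ => (g i).continuous.abs.aestronglyMeasurable) (by simp)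
  have h2 : ∀ i, eLpNorm (fun x => |g i x|) 2 volume = ENNReal.ofReal ‖g i‖ := fun i => by
    rw [← eLpNorm_eq, ← eLpNorm_norm (g i)]; rfl
  simp only [h2, eLpNorm_eq] at h1
  rw [← ENNReal.ofReal_sum_of_nonneg fun i _ => norm_nonneg _] at h1
  exact (ENNReal.ofReal_le_ofReal_iff (Finset.sum_nonneg fun i _ => norm_nonneg _)).mp h1

variable [FiniteDimensional ℝ E]

lemma D_anti (v : E) (f g : TestFn E) : inner ℝ (D v f) g = - inner ℝ f (D v g) := by
  simp only [inner_def, D_apply]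
  have := integral_mul_fderiv_eq_neg_fderiv_mul_of_integrable (μ := volume) (f := g) (g := f)
    (v := v) (D v g |>.integrable_mul f) (g.integrable_mul (D v f)) (g.integrable_mul f)
    (fun x _ => g.differentiable x) (fun x _ => f.differentiable x)
  rw [← integral_neg]
  simp only [mul_comm] at this ⊢
  rw [this, integral_neg]

end

end TestFn

namespace TestFn

variable {n m : ℕ}

/-- The phase of the partial Fourier transform. -/
noncomputable def ph (η : Fin m → ℝ) (t : ℝ) (y : Fin m → ℝ) : ℝ :=
  Real.cos (2 * Real.pi * ∑ k, η k * y k + t)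

lemma ph_smooth (η : Fin m → ℝ) (t : ℝ) : ContDiff ℝ ∞ (ph η t) := by
  unfold ph; fun_prop

lemma abs_ph_le (η : Fin m → ℝ) (t : ℝ) (y) : |ph η t y| ≤ 1 := Real.abs_cos_le_one _

lemma fderiv_ph (η : Fin m → ℝ) (t : ℝ) (y) (k : Fin m) :
    fderiv ℝ (ph η t) y (Pi.single k 1) = 2 * Real.pi * η k * ph η (t + Real.pi / 2) y := by
  have h1 : HasFDerivAt (fun y : Fin m → ℝ => 2 * Real.pi * ∑ k, η k * y k + t)
      ((2 * Real.pi) • ∑ k, η k • ContinuousLinearMap.proj (R := ℝ) (φ := fun _ : Fin m => ℝ) k)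
      y := by
    refine HasFDerivAt.add_const t (HasFDerivAt.const_mul ?_ _)
    exact HasFDerivAt.fun_sum fun k _ => HasFDerivAt.const_mul
      (ContinuousLinearMap.proj (R := ℝ) (φ := fun _ : Fin m => ℝ) k).hasFDerivAt (η k)
  have h2 := h1.cos
  have e : ph η t = fun y => Real.cos (2 * Real.pi * ∑ k, η k * y k + t) := rfl
  rw [e, h2.fderiv, ph, ← add_assoc, Real.cos_add_pi_div_two]
  simp [Pi.single_apply]
  ring

lemma slice_compact (φ : TestFn (Pt n m)) : ∃ k : Set (Fin m → ℝ), IsCompact k ∧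
    ∀ x, ∀ y, y ∉ k → φ (x, y) = 0 := by
  refine ⟨Prod.snd '' tsupport φ, φ.compact.isCompact.image continuous_snd, fun x y hy => ?_⟩
  by_contra h
  exact hy ⟨(x, y), subset_tsupport _ h, rfl⟩

/-- Restriction of a test function to a slice. -/
noncomputable def slice (φ : TestFn (Pt n m)) (x : Fin n → ℝ) : TestFn (Fin m → ℝ) :=
  mk (fun y => φ (x, y)) (φ.smooth.comp (contDiff_const.prodMk contDiff_id)) (by
    obtain ⟨k, hk, h⟩ := slice_compact φ
    exact HasCompactSupport.intro hk fun y hy => h x y hy)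

/-- The partial Fourier transform. -/
noncomputable def PT (η : Fin m → ℝ) (t : ℝ) (φ : TestFn (Pt n m)) : TestFn (Fin n → ℝ) :=
  mk (fun x => ∫ y, ph η t y * φ (x, y)) (by
    obtain ⟨k, hk, h⟩ := slice_compact φ
    have := contDiffOn_convolution_right_with_param (n := ⊤) (μ := volume) (f := ph η t)
      (ContinuousLinearMap.mul ℝ ℝ) (g := fun (x : Fin n → ℝ) (y : Fin m → ℝ) => φ (x, -y))
      (s := Set.univ) (k := -k) isOpen_univ hk.neg
      (fun x y _ hy => h x (-y) (by simpa using hy)) (ph_smooth η t).continuous.locallyIntegrable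
      (by
        refine ContDiff.contDiffOn ?_
        exact φ.smooth.comp (contDiff_fst.prodMk contDiff_snd.neg))
    rw [Set.univ_prod_univ, contDiffOn_univ] at this
    have h2 := this.comp (contDiff_id.prodMk (contDiff_const (c := (0 : Fin m → ℝ))))
    convert h2 using 1
    ext x
    simp [MeasureTheory.convolution]) (by
    refine HasCompactSupport.intro (φ.compact.isCompact.image continuous_fst) fun x hx => ?_
    refine integral_eq_zero_of_ae (Filter.Eventually.of_forall fun y => ?_)
    have : φ (x, y) = 0 := by
      by_contra h
      exact hx ⟨(x, y), subset_tsupport _ h, rfl⟩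
    simp [this])

lemma PT_apply (η : Fin m → ℝ) (t : ℝ) (φ : TestFn (Pt n m)) (x) :
    PT η t φ x = ∫ y, ph η t y * φ (x, y) := rfl

lemma PT_Dx (η : Fin m → ℝ) (t : ℝ) (φ : TestFn (Pt n m)) (v : Fin n → ℝ) :
    PT η t (D (v, 0) φ) = D v (PT η t φ) := by
  ext x
  obtain ⟨k, hk, h⟩ := slice_compact φ
  obtain ⟨C, hC⟩ := (D (v, (0 : Fin m → ℝ)) φ).compact.exists_bound_of_continuous (D (v, 0) φ).continuous
  have hd : ∀ (y : Fin m → ℝ) (s : ℝ), HasDerivAt (fun s : ℝ => ph η t y * φ (x + s • v, y))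
      (ph η t y * D (v, 0) φ (x + s • v, y)) s := by
    intro y s
    refine HasDerivAt.const_mul _ ?_
    have h1 : HasDerivAt (fun s : ℝ => ((x + s • v, y) : Pt n m)) (v, 0) s := by
      refine HasDerivAt.prodMk ?_ (hasDerivAt_const _ _)
      simpa using ((hasDerivAt_id s).smul_const v).const_add x
    exact (φ.differentiable _).hasFDerivAt.comp_hasDerivAt s h1
  have hmeas : ∀ ψ : TestFn (Pt n m), ∀ s : ℝ, Integrable fun y => ph η t y * ψ (x + s • v, y) := by
    intro ψ s
    exact (M (ph η t) (ph_smooth η t) (slice ψ (x + s • v))).integrable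
  have key := hasDerivAt_integral_of_dominated_loc_of_deriv_le (μ := volume) (x₀ := (0 : ℝ))
    (F := fun s y => ph η t y * φ (x + s • v, y))
    (F' := fun s y => ph η t y * D (v, 0) φ (x + s • v, y)) (s := Set.univ)
    (bound := k.indicator fun _ => C) Filter.univ_mem
    (Filter.Eventually.of_forall fun s => (hmeas φ s).aestronglyMeasurable) (hmeas φ 0)
    (hmeas _ 0).aestronglyMeasurable
    (Filter.Eventually.of_forall fun y s _ => by
      by_cases hy : y ∈ k
      · rw [Set.indicator_of_mem hy, norm_mul]
        calc _ ≤ 1 * C := by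
              gcongr
              · exact abs_ph_le η t y
              · exact hC _
          _ = C := one_mul _
      · rw [Set.indicator_of_notMem hy]
        have h1 : HasDerivAt (fun s : ℝ => ph η t y * φ (x + s • v, y)) 0 s := by
          simp only [h _ y hy, mul_zero]; exact hasDerivAt_const _ _
        rw [(hd y s).unique h1, norm_zero])
    ((integrable_indicator_iff hk.measurableSet).mpr (integrableOn_const hk.measure_lt_top.ne))
    (Filter.Eventually.of_forall fun y s _ => hd y s)
  have h2 : HasDerivAt (fun s : ℝ => PT η t φ (x + s • v)) (D v (PT η t φ) x) 0 := by
    have h1 : HasDerivAt (fun s : ℝ => x + s • v) v 0 := by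
      simpa using ((hasDerivAt_id (0 : ℝ)).smul_const v).const_add x
    have h3 : HasDerivAt (fun s : ℝ => PT η t φ (x + s • v)) _ 0 :=
      ((PT η t φ).differentiable (x + (0 : ℝ) • v)).hasFDerivAt.comp_hasDerivAt 0 h1
    convert h3 using 1
    simp [D_apply]
  have := key.2.unique h2
  simpa [PT_apply] using this

lemma PT_Dy (η : Fin m → ℝ) (t : ℝ) (φ : TestFn (Pt n m)) (k : Fin m) :
    PT η t (D (0, Pi.single k 1) φ) = -(2 * Real.pi * η k) • PT η (t + Real.pi / 2) φ := by
  ext x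
  have e : ∀ y, D (0, Pi.single k 1) φ (x, y) = D (Pi.single k 1) (slice φ x) y := by
    intro y
    have h1 : HasFDerivAt (fun y : Fin m → ℝ => ((x, y) : Pt n m))
      (ContinuousLinearMap.inr ℝ _ _) y := hasFDerivAt_prodMk_right x y
    have h2 := (φ.differentiable (x, y)).hasFDerivAt.comp y h1
    have h3 : (slice φ x : (Fin m → ℝ) → ℝ) = φ ∘ fun y => (x, y) := rfl
    rw [D_apply, D_apply, h3, h2.fderiv]; simp
  rw [PT_apply]
  simp only [e, D_apply]
  have hi := integral_mul_fderiv_eq_neg_fderiv_mul_of_integrable (μ := volume) (f := ph η t)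
    (g := slice φ x) (v := Pi.single k 1)
    (by simp only [fderiv_ph, mul_assoc]
        exact ((M _ (ph_smooth η (t + Real.pi / 2)) (slice φ x)).integrable.const_mul _).const_mul _ |>.const_mul _)
    (M _ (ph_smooth η t) (D (Pi.single k 1) (slice φ x))).integrable
    (M _ (ph_smooth η t) (slice φ x)).integrable
    (fun y _ => (ph_smooth η t).differentiable (by simp) y) (fun y _ => (slice φ x).differentiable y)
  rw [hi]
  simp only [fderiv_ph, coe_smul, Pi.smul_apply, smul_eq_mul, PT_apply, mul_assoc,
    integral_const_mul]
  rw [← neg_mul, ← integral_const_mul]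
  simp only [neg_mul, integral_const_mul, mul_assoc]
  rfl

lemma PT_Mx (η : Fin m → ℝ) (t : ℝ) (φ : TestFn (Pt n m)) (g : (Fin n → ℝ) → ℝ)
    (hg : ContDiff ℝ ∞ g) :
    PT η t (M (fun z => g z.1)
      (show ContDiff ℝ ∞ (fun z : Pt n m => g z.1) from hg.comp contDiff_fst) φ) = M g hg (PT η t φ) := by
  ext x
  simp only [PT_apply, M_apply]
  rw [← integral_const_mul]
  congr 1; ext y; ring

lemma PT_add_pi (η : Fin m → ℝ) (t : ℝ) (φ : TestFn (Pt n m)) :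
    PT η (t + Real.pi) φ = - PT η t φ := by
  ext x
  simp [PT_apply, ph, ← add_assoc, Real.cos_add_pi, integral_neg]

lemma PT_add (η : Fin m → ℝ) (t : ℝ) (φ ψ : TestFn (Pt n m)) :
    PT η t (φ + ψ) = PT η t φ + PT η t ψ := by
  ext x
  simp only [PT_apply, coe_add, Pi.add_apply, mul_add]
  exact integral_add (M _ (ph_smooth η t) (slice φ x)).integrable
    (M _ (ph_smooth η t) (slice ψ x)).integrable

lemma PT_smul (η : Fin m → ℝ) (t : ℝ) (c : ℝ) (φ : TestFn (Pt n m)) :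
    PT η t (c • φ) = c • PT η t φ := by
  ext x
  simp only [PT_apply, coe_smul, Pi.smul_apply, smul_eq_mul, mul_left_comm _ c, integral_const_mul]

lemma plancherel_slice (f : TestFn (Fin m → ℝ)) :
    ∫⁻ η : Fin m → ℝ, ENNReal.ofReal ((∫ y, ph η 0 y * f y) ^ 2 +
      (∫ y, ph η (Real.pi / 2) y * f y) ^ 2) = ∫⁻ y, ENNReal.ofReal (f y ^ 2) := by
  let g : EuclideanSpace ℝ (Fin m) → ℂ := fun y => (f (WithLp.ofLp y) : ℂ)
  have hg1 : ContDiff ℝ ∞ g := Complex.ofRealCLM.contDiff.comp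
    (f.smooth.comp (PiLp.continuousLinearEquiv 2 ℝ (fun _ : Fin m => ℝ)).contDiff)
  have hg2 : HasCompactSupport g := by
    have : HasCompactSupport (fun y : EuclideanSpace ℝ (Fin m) => f (WithLp.ofLp y)) :=
      f.compact.comp_homeomorph (PiLp.continuousLinearEquiv 2 ℝ (fun _ : Fin m => ℝ)).toHomeomorph
    exact this.comp_left (g := fun t : ℝ => (t : ℂ)) (by simp)
  let G := hg2.toSchwartzMap hg1
  have hP := G.integral_norm_sq_fourier
  have hG : ∀ y, G y = g y := fun y => rfl
  have hF : ∀ η : Fin m → ℝ, ‖(FourierTransform.fourier G) (WithLp.toLp 2 η)‖ ^ 2 =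
      (∫ y, ph η 0 y * f y) ^ 2 + (∫ y, ph η (Real.pi / 2) y * f y) ^ 2 := by
    intro η
    rw [SchwartzMap.fourier_coe, Real.fourier_eq']
    have e1 : ∀ y : EuclideanSpace ℝ (Fin m), Complex.exp (↑(-2 * Real.pi * inner ℝ y (WithLp.toLp 2 η)) * Complex.I) • G y
        = (fun y : Fin m → ℝ => ((ph η 0 y * f y : ℝ) : ℂ) + ((ph η (Real.pi / 2) y * f y : ℝ) : ℂ) * Complex.I) (WithLp.ofLp y) := by
      intro y
      have : inner ℝ y (WithLp.toLp 2 η) = ∑ k, η k * y k := by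
        simp [PiLp.inner_apply]
      rw [this, hG, Complex.exp_mul_I]; simp only [ph]
      rw [add_zero, Real.cos_add_pi_div_two,
        ← Complex.ofReal_cos, ← Complex.ofReal_sin]
      rw [show -2 * Real.pi * ∑ k, η k * y k = -(2 * Real.pi * ∑ k, η k * y k) by ring,
        Real.cos_neg, Real.sin_neg]
      simp only [g, smul_eq_mul]
      push_cast; ring
    simp_rw [e1]
    rw [(PiLp.volume_preserving_ofLp (Fin m)).integral_comp
      (MeasurableEquiv.toLp 2 (Fin m → ℝ)).symm.measurableEmbedding
      (fun y : Fin m → ℝ => ((ph η 0 y * f y : ℝ) : ℂ) + ((ph η (Real.pi / 2) y * f y : ℝ) : ℂ) * Complex.I)]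
    have i1 : Integrable (fun y => ph η 0 y * f y) := (M _ (ph_smooth η 0) f).integrable
    have i2 : Integrable (fun y => ph η (Real.pi / 2) y * f y) :=
      (M _ (ph_smooth η (Real.pi / 2)) f).integrable
    have j1 : Integrable (fun y => ((ph η 0 y * f y : ℝ) : ℂ)) := i1.ofReal
    have j2 : Integrable (fun y => ((ph η (Real.pi / 2) y * f y : ℝ) : ℂ)) := i2.ofReal
    rw [integral_add j1 (j2.mul_const _), integral_mul_const]
    rw [integral_complex_ofReal, integral_complex_ofReal, ← Complex.normSq_eq_norm_sq, Complex.normSq_add_mul_I]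
  have hinterp := (FourierTransform.fourier G).memLp 2
  rw [← ofReal_integral_eq_lintegral_ofReal, ← ofReal_integral_eq_lintegral_ofReal]
  · congr 1
    have e2 := (PiLp.volume_preserving_toLp (Fin m)).integral_comp
      (MeasurableEquiv.toLp 2 (Fin m → ℝ)).measurableEmbedding
      (fun η => ‖(FourierTransform.fourier G) η‖ ^ 2)
    have e3 := (PiLp.volume_preserving_toLp (Fin m)).integral_comp
      (MeasurableEquiv.toLp 2 (Fin m → ℝ)).measurableEmbedding
      (fun η => ‖G η‖ ^ 2)
    rw [hP, ← e3] at e2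
    simp only [hF] at e2
    rw [e2]
    congr 1; ext y
    simp [hG, g]
  · simpa only [pow_two] using f.integrable_mul f
  · exact Filter.Eventually.of_forall fun y => by positivity
  · have h1 := hinterp.integrable_norm_pow (by norm_num)
    have h2 := (PiLp.volume_preserving_toLp (Fin m)).integrable_comp_of_integrable h1
    refine h2.congr (Filter.Eventually.of_forall fun η => ?_)
    simpa using hF η
  · exact Filter.Eventually.of_forall fun y => by positivity

lemma PT_measurable (t : ℝ) (φ : TestFn (Pt n m)) :
    Measurable fun p : (Fin n → ℝ) × (Fin m → ℝ) => PT p.2 t φ p.1 := by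
  have h : Continuous fun p : ((Fin n → ℝ) × (Fin m → ℝ)) × (Fin m → ℝ) =>
      ph p.1.2 t p.2 * φ (p.1.1, p.2) := by
    refine Continuous.mul ?_ (φ.continuous.comp (by fun_prop))
    unfold ph; fun_prop
  exact (h.stronglyMeasurable.integral_prod_right' (ν := volume)).measurable

lemma ofReal_norm_sq {E : Type*} [NormedAddCommGroup E] [NormedSpace ℝ E] [MeasureSpace E]
    [BorelSpace E] [FiniteDimensional ℝ E] [(volume : Measure E).IsAddHaarMeasure]
    (f : TestFn E) : ENNReal.ofReal (‖f‖ ^ 2) = ∫⁻ x, ENNReal.ofReal (f x ^ 2) := by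
  rw [norm_sq, ofReal_integral_eq_lintegral_ofReal]
  · simpa only [pow_two] using f.integrable_mul f
  · exact Filter.Eventually.of_forall fun y => by positivity

instance : (volume : Measure (Pt n m)).IsAddHaarMeasure :=
  Measure.prod.instIsAddHaarMeasure (volume : Measure (Fin n → ℝ)) (volume : Measure (Fin m → ℝ))

theorem plancherel (φ : TestFn (Pt n m)) :
    ENNReal.ofReal (‖φ‖ ^ 2) = ∫⁻ η : Fin m → ℝ,
      ENNReal.ofReal (‖PT η 0 φ‖ ^ 2 + ‖PT η (Real.pi / 2) φ‖ ^ 2) := by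
  rw [ofReal_norm_sq, Measure.volume_eq_prod, lintegral_prod]
  swap
  · exact (ENNReal.measurable_ofReal.comp (φ.continuous.pow 2).measurable).aemeasurable
  have e1 : ∀ x : Fin n → ℝ, ∫⁻ y, ENNReal.ofReal (φ (x, y) ^ 2) = ∫⁻ η : Fin m → ℝ,
      ENNReal.ofReal (PT η 0 φ x ^ 2 + PT η (Real.pi / 2) φ x ^ 2) :=
    fun x => (plancherel_slice (slice φ x)).symm
  simp_rw [e1]
  rw [lintegral_lintegral_swap]
  · congr 1; ext η
    rw [ENNReal.ofReal_add (by positivity) (by positivity), ofReal_norm_sq, ofReal_norm_sq,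
      ← lintegral_add_left]
    · congr 1; ext x
      rw [ENNReal.ofReal_add (by positivity) (by positivity)]
    · exact ENNReal.measurable_ofReal.comp ((PT η 0 φ).continuous.pow 2).measurable
  · exact (ENNReal.measurable_ofReal.comp (((PT_measurable 0 φ).pow_const 2).add
      ((PT_measurable _ φ).pow_const 2))).aemeasurable

end TestFn

namespace Grusin

open TestFn

variable {n m : ℕ}

/-- Multiplication by `x_i`. -/
noncomputable def ox (i : Fin n) : Module.End ℝ (TestFn (Pt n m)) :=
  M (fun z => z.1 i) (show ContDiff ℝ ∞ (fun z : Pt n m => z.1 i) by fun_prop)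

/-- The derivative in `x_i`. -/
noncomputable def odx (i : Fin n) : Module.End ℝ (TestFn (Pt n m)) := D (Pi.single i 1, 0)

/-- The derivative in `y_k`. -/
noncomputable def ody (k : Fin m) : Module.End ℝ (TestFn (Pt n m)) := D (0, Pi.single k 1)

@[simp] lemma ox_apply (i : Fin n) (φ : TestFn (Pt n m)) (z) : ox i φ z = z.1 i * φ z := rfl

/-- The Grušin operator on test functions. -/
noncomputable def gr (n m N : ℕ) : Module.End ℝ (TestFn (Pt n m)) :=
  -(∑ i, odx i ^ 2) - (∑ i, ox i ^ 2) ^ N * ∑ k, ody k ^ 2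

/-- Letters: coordinates and derivatives. -/
inductive Letter (n m : ℕ)
  | x (i : Fin n) : Letter n m
  | dx (i : Fin n) : Letter n m
  | dy (k : Fin m) : Letter n m

namespace Letter

/-- The operator attached to a letter. -/
noncomputable def op : Letter n m → Module.End ℝ (TestFn (Pt n m))
  | x i => ox i
  | dx i => odx i
  | dy k => ody k

/-- Counts the `x_i`. -/
def nx : Letter n m → ℕ
  | x _ => 1
  | _ => 0

/-- Counts the `∂_{x_i}`. -/
def ndx : Letter n m → ℕ
  | dx _ => 1
  | _ => 0

/-- Counts the `∂_{y_k}`. -/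
def ndy : Letter n m → ℕ
  | dy _ => 1
  | _ => 0

end Letter

/-- The operator attached to a word. -/
noncomputable def wop (w : List (Letter n m)) : Module.End ℝ (TestFn (Pt n m)) :=
  (w.map Letter.op).prod

lemma wop_cons (l : Letter n m) (w) : wop (l :: w) = l.op * wop w := by simp [wop]
lemma wop_append (u w : List (Letter n m)) : wop (u ++ w) = wop u * wop w := by simp [wop]

/-- Counts the `x_i` in a word. -/
def cx (w : List (Letter n m)) : ℕ := (w.map Letter.nx).sum
/-- Counts the `∂_{x_i}` in a word. -/
def cdx (w : List (Letter n m)) : ℕ := (w.map Letter.ndx).sum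
/-- Counts the `∂_{y_k}` in a word. -/
def cdy (w : List (Letter n m)) : ℕ := (w.map Letter.ndy).sum

/-- Scaled derivatives. -/
noncomputable def pS (i : Fin n) (μ : {μ : ℝ // 0 < μ}) : Module.End ℝ (TestFn (Fin n → ℝ)) :=
  (μ : ℝ)⁻¹ • D (Pi.single i 1)

/-- Scaled coordinates. -/
noncomputable def qS (i : Fin n) (μ : {μ : ℝ // 0 < μ}) : Module.End ℝ (TestFn (Fin n → ℝ)) :=
  (μ : ℝ) • M (fun x => x i) (show ContDiff ℝ ∞ (fun x : Fin n → ℝ => x i) by fun_prop)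

lemma isCCR_scaled : IsCCR (pS (n := n)) qS where
  p_anti i μ u v := by
    simp [pS, inner_smul_left, inner_smul_right, D_anti]
  q_symm i μ u v := by
    simp [qS, inner_smul_left, inner_smul_right, M_symm]
  pp i j := by
    ext1 μ
    simp [pS, D_comm (E := Fin n → ℝ) (Pi.single i 1) (Pi.single j 1)]
  qq i j := by
    ext1 μ
    simp only [qS, Pi.mul_apply, smul_mul_assoc, mul_smul_comm]
    rw [M_comm]
  pq i j := by
    ext μ f x
    have hμ := μ.2.ne'
    have e : fderiv ℝ (fun x : Fin n → ℝ => x j) x (Pi.single i 1) = if i = j then 1 else 0 := by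
      have h : HasFDerivAt (fun x : Fin n → ℝ => x j)
          (ContinuousLinearMap.proj (R := ℝ) (φ := fun _ : Fin n => ℝ) j) x :=
        (ContinuousLinearMap.proj (R := ℝ) (φ := fun _ : Fin n => ℝ) j).hasFDerivAt
      rw [h.fderiv]
      simp [Pi.single_apply, eq_comm]
    simp only [pS, qS, Pi.sub_apply, Pi.mul_apply, smul_mul_assoc, mul_smul_comm, smul_smul,
      LinearMap.sub_apply, LinearMap.smul_apply, Module.End.mul_apply, coe_sub, coe_smul,
      Pi.smul_apply, D_M, M_apply, e, smul_eq_mul]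
    split_ifs with h <;> simp <;> field_simp <;> simp

/-- The operator of a letter after partial Fourier transform and scaling. -/
noncomputable def sop (μ : {μ : ℝ // 0 < μ}) : Letter n m → Module.End ℝ (TestFn (Fin n → ℝ))
  | .x i => qS i μ
  | .dx i => pS i μ
  | .dy _ => 1

/-- The frequency scale. -/
noncomputable def freq (N : ℕ) (η : Fin m → ℝ) : ℝ :=
  (2 * Real.pi * Real.sqrt (∑ k, η k ^ 2)) ^ ((N + 1 : ℝ)⁻¹)

lemma freq_pow (N : ℕ) (η : Fin m → ℝ) :
    freq N η ^ (N + 1) = 2 * Real.pi * Real.sqrt (∑ k, η k ^ 2) := by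
  have : (0 : ℝ) ≤ 2 * Real.pi * Real.sqrt (∑ k, η k ^ 2) := by positivity
  rw [freq, ← Nat.cast_succ, Real.rpow_inv_natCast_pow this (by simp)]

lemma freq_pos (N : ℕ) {η : Fin m → ℝ} (h : η ≠ 0) : 0 < freq N η := by
  refine Real.rpow_pos_of_pos ?_ _
  have : 0 < ∑ k, η k ^ 2 := by
    obtain ⟨k, hk⟩ := Function.ne_iff.mp h
    exact Finset.sum_pos' (fun i _ => sq_nonneg _) ⟨k, Finset.mem_univ _, by
      have : η k ≠ 0 := hk
      positivity⟩
  positivity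

lemma abs_le_freq_pow (N : ℕ) (η : Fin m → ℝ) (k : Fin m) :
    |2 * Real.pi * η k| ≤ freq N η ^ (N + 1) := by
  rw [freq_pow, abs_mul, abs_of_pos Real.two_pi_pos]
  gcongr
  rw [← Real.sqrt_sq_eq_abs]
  exact Real.sqrt_le_sqrt (Finset.single_le_sum (f := fun k => η k ^ 2)
    (fun i _ => sq_nonneg _) (Finset.mem_univ k))

lemma PT_letter (N : ℕ) (η : Fin m → ℝ) (hη : η ≠ 0) (l : Letter n m) :
    ∃ c : ℝ, |c| * freq N η ^ l.nx ≤ freq N η ^ (l.ndx + (N + 1) * l.ndy) ∧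
      ∀ t φ, PT η t (l.op φ) =
        c • sop ⟨freq N η, freq_pos N hη⟩ l (PT η (t + l.ndy * (Real.pi / 2)) φ) := by
  have h0 := freq_pos N hη
  cases l with
  | x i =>
    refine ⟨(freq N η)⁻¹, ?_, fun t φ => ?_⟩
    · simp [Letter.nx, Letter.ndx, Letter.ndy, abs_of_pos h0, h0.ne']
    · have := PT_Mx η t φ (fun x => x i) (by fun_prop)
      simp [Letter.op, sop, qS, Letter.ndy, smul_smul, h0.ne']
      exact this
  | dx i =>
    refine ⟨freq N η, ?_, fun t φ => ?_⟩
    · simp [Letter.nx, Letter.ndx, Letter.ndy, abs_of_pos h0]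
    · have := PT_Dx η t φ (Pi.single i 1)
      simp [Letter.op, sop, pS, Letter.ndy, smul_smul, h0.ne']
      exact this
  | dy k =>
    refine ⟨-(2 * Real.pi * η k), ?_, fun t φ => ?_⟩
    · simpa [Letter.nx, Letter.ndx, Letter.ndy] using abs_le_freq_pow N η k
    · have := PT_Dy η t φ k
      simp only [Letter.op, ody, sop, Letter.ndy, Module.End.one_apply, Nat.cast_one, one_mul]
      exact this

/-- The transformed word. -/
noncomputable def swop (μ : {μ : ℝ // 0 < μ}) (w : List (Letter n m)) :
    Module.End ℝ (TestFn (Fin n → ℝ)) := (w.map (sop μ)).prod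

lemma PT_word (N : ℕ) (η : Fin m → ℝ) (hη : η ≠ 0) (w : List (Letter n m)) :
    ∃ c : ℝ, |c| * freq N η ^ cx w ≤ freq N η ^ (cdx w + (N + 1) * cdy w) ∧
      ∀ t φ, PT η t (wop w φ) =
        c • swop ⟨freq N η, freq_pos N hη⟩ w (PT η (t + cdy w * (Real.pi / 2)) φ) := by
  have h0 := freq_pos N hη
  induction w with
  | nil => exact ⟨1, by simp [cx, cdx, cdy], fun t φ => by simp [wop, swop, cdy]⟩
  | cons l w ih =>
    obtain ⟨c, h1, h2⟩ := ih
    obtain ⟨d, h3, h4⟩ := PT_letter N η hη l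
    refine ⟨d * c, ?_, fun t φ => ?_⟩
    · have e : cdx (l :: w) + (N + 1) * cdy (l :: w) =
          (l.ndx + (N + 1) * l.ndy) + (cdx w + (N + 1) * cdy w) := by
        simp [cdx, cdy]; ring
      rw [e, pow_add, show cx (l :: w) = l.nx + cx w by simp [cx], pow_add, abs_mul]
      calc |d| * |c| * (freq N η ^ l.nx * freq N η ^ cx w)
          = (|d| * freq N η ^ l.nx) * (|c| * freq N η ^ cx w) := by ring
        _ ≤ _ := mul_le_mul h3 h1 (by positivity) (by positivity)
    · rw [wop_cons, Module.End.mul_apply, h4, h2]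
      simp only [swop, List.map_cons, List.prod_cons, Module.End.mul_apply, map_smul, smul_smul]
      congr 4
      simp [cdy]; ring

lemma swop_mem (N : ℕ) (w : List (Letter n m)) :
    (fun μ => swop μ w) ∈ CCR.filt N (pS (n := n)) qS (cx w + N * cdx w) := by
  induction w with
  | nil => exact CCR.one_mem (by simp [cx, cdx])
  | cons l w ih =>
    have e : (fun μ => swop μ (l :: w)) = (fun μ => sop μ l) * fun μ => swop μ w := by
      ext1 μ; simp [swop]
    rw [e]
    have hl : (fun μ => sop μ l) ∈ CCR.filt N (pS (n := n)) qS (l.nx + N * l.ndx) := by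
      cases l with
      | x i => simpa [Letter.nx, Letter.ndx, sop] using CCR.q_mem (N := N) (p := pS (n := n)) i
      | dx i => simpa [Letter.nx, Letter.ndx, sop] using CCR.p_mem (N := N) (q := qS (n := n)) i
      | dy k =>
        exact CCR.one_mem (by simp [Letter.nx, Letter.ndx])
    have := CCR.mul_mem hl ih
    convert this using 1
    simp [cx, cdx]; ring_nf

lemma PT_sum (η : Fin m → ℝ) (t : ℝ) {ι : Type*} (s : Finset ι) (φ : ι → TestFn (Pt n m)) :
    PT η t (∑ i ∈ s, φ i) = ∑ i ∈ s, PT η t (φ i) := by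
  let L : TestFn (Pt n m) →ₗ[ℝ] TestFn (Fin n → ℝ) :=
    { toFun := PT η t, map_add' := PT_add η t, map_smul' := PT_smul η t }
  exact map_sum L φ s

lemma ox_rad_apply (φ : TestFn (Pt n m)) (z) : (∑ i, ox i ^ 2 : Module.End ℝ (TestFn (Pt n m))) φ z
    = (∑ i, z.1 i ^ 2) * φ z := by
  simp only [LinearMap.sum_apply, TestFn.sum_apply, pow_two, Module.End.mul_apply, ox_apply,
    Finset.sum_mul, mul_assoc]

lemma ox_rad_pow_apply (N : ℕ) (φ : TestFn (Pt n m)) (z) :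
    ((∑ i, ox i ^ 2 : Module.End ℝ (TestFn (Pt n m))) ^ N) φ z = (∑ i, z.1 i ^ 2) ^ N * φ z := by
  induction N with
  | zero => simp
  | succ N ih => rw [pow_succ', Module.End.mul_apply, ox_rad_apply, ih]; ring

lemma qS_rad_pow_apply (N : ℕ) (μ) (φ : TestFn (Fin n → ℝ)) (x) :
    ((CCR.rad (qS (n := n)) μ) ^ N) φ x = (μ : ℝ) ^ (2 * N) * (∑ i, x i ^ 2) ^ N * φ x := by
  induction N with
  | zero => simp
  | succ N ih =>
    rw [pow_succ', Module.End.mul_apply]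
    simp only [CCR.rad, Finset.sum_apply, LinearMap.sum_apply, TestFn.sum_apply, Pi.pow_apply]
    simp only [qS, pow_two, Module.End.mul_apply, LinearMap.smul_apply, map_smul, coe_smul,
      Pi.smul_apply, M_apply, smul_eq_mul]
    have : ∀ g : TestFn (Fin n → ℝ), ∑ i, (μ : ℝ) * (μ * (x i * (x i * g x))) =
      (μ : ℝ) ^ 2 * (∑ i, x i ^ 2) * g x := by
      intro g; rw [Finset.mul_sum, Finset.sum_mul]; congr 1; ext i; ring
    rw [this]
    have h2 : (∑ i, qS i * qS i : _ → Module.End ℝ (TestFn (Fin n → ℝ))) = CCR.rad qS := by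
      simp [CCR.rad, pow_two]
    have ih' := ih
    simp only [CCR.rad, pow_two, Finset.sum_apply] at ih'
    erw [ih']
    ring_nf

lemma PT_gr (N : ℕ) (η : Fin m → ℝ) (hη : η ≠ 0) (t : ℝ) (φ : TestFn (Pt n m)) :
    PT η t (gr n m N φ) = freq N η ^ 2 •
      CCR.osc N (pS (n := n)) qS ⟨freq N η, freq_pos N hη⟩ (PT η t φ) := by
  have h0 := freq_pos N hη
  have e1 : gr n m N φ = (-1 : ℝ) • (∑ i, odx i (odx i φ)) + (-1 : ℝ) •
      M (fun z => (fun x : Fin n → ℝ => (∑ i, x i ^ 2) ^ N) z.1)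
      (show ContDiff ℝ ∞ (fun z : Pt n m => (∑ i, z.1 i ^ 2) ^ N) by fun_prop)
      (∑ k, ody k (ody k φ)) := by
    ext z
    simp only [gr, LinearMap.sub_apply, LinearMap.neg_apply, Module.End.mul_apply, coe_sub, coe_neg,
      Pi.sub_apply, Pi.neg_apply, ox_rad_pow_apply, coe_add, coe_smul, Pi.add_apply, Pi.smul_apply,
      M_apply, smul_eq_mul, LinearMap.sum_apply]
    simp only [pow_two (odx _), pow_two (ody _), Module.End.mul_apply]
    ring
  have hDy : ∀ k, PT η t (ody k (ody k φ)) = -((2 * Real.pi * η k) ^ 2) • PT η t φ := by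
    intro k
    simp only [ody, PT_Dy]
    rw [add_assoc, add_halves, PT_add_pi, smul_smul, smul_neg, ← neg_smul]
    congr 1; ring
  have hDx : ∀ i, PT η t (odx i (odx i φ)) = D (Pi.single i 1) (D (Pi.single i 1) (PT η t φ)) := by
    intro i
    simp only [odx, PT_Dx]
  rw [e1, PT_add, PT_smul, PT_smul, PT_sum, PT_Mx η t _ (fun x : Fin n → ℝ => (∑ i, x i ^ 2) ^ N) (by fun_prop), PT_sum]
  simp only [hDx, hDy]
  ext x
  have hf : ∑ k, (2 * Real.pi * η k) ^ 2 = freq N η ^ (2 * (N + 1)) := by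
    rw [mul_comm 2 (N + 1), pow_mul, freq_pow, mul_pow, Real.sq_sqrt (by positivity), Finset.mul_sum]
    congr 1; ext k; ring
  simp only [CCR.osc, CCR.lap, Pi.add_apply, Pi.neg_apply, Pi.pow_apply, LinearMap.add_apply,
    coe_add, coe_smul, Pi.smul_apply, smul_eq_mul, qS_rad_pow_apply, LinearMap.neg_apply, coe_neg,
    Finset.sum_apply, LinearMap.sum_apply, TestFn.sum_apply, M_apply]
  rw [← Finset.sum_mul, Finset.sum_neg_distrib, hf]
  simp only [pS, pow_two (_ • D _), Module.End.mul_apply, LinearMap.smul_apply, map_smul, coe_smul,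
    Pi.smul_apply, smul_eq_mul, ← Finset.mul_sum]
  field_simp
  ring

lemma PT_gr_pow (N s : ℕ) (η : Fin m → ℝ) (hη : η ≠ 0) (t : ℝ) (φ : TestFn (Pt n m)) :
    PT η t ((gr n m N ^ s) φ) = freq N η ^ (2 * s) •
      (CCR.osc N (pS (n := n)) qS ^ s) ⟨freq N η, freq_pos N hη⟩ (PT η t φ) := by
  induction s with
  | zero => simp
  | succ s ih =>
    rw [pow_succ', Module.End.mul_apply, PT_gr N η hη, ih, pow_succ' (CCR.osc N (pS (n := n)) qS), Pi.mul_apply,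
      Module.End.mul_apply, map_smul, smul_smul]
    congr 1; ring

/-- Both components of the partial Fourier transform control any phase. -/
lemma norm_PT_shift (η : Fin m → ℝ) (t : ℝ) (c : ℕ) (φ : TestFn (Pt n m)) :
    ‖PT η (t + c * (Real.pi / 2)) φ‖ ^ 2 ≤ ‖PT η t φ‖ ^ 2 + ‖PT η (t + Real.pi / 2) φ‖ ^ 2 := by
  have h : ‖PT η (t + c * (Real.pi / 2)) φ‖ = ‖PT η t φ‖ ∨
      ‖PT η (t + c * (Real.pi / 2)) φ‖ = ‖PT η (t + Real.pi / 2) φ‖ := by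
    induction c using Nat.twoStepInduction with
    | zero => left; simp
    | one => right; simp
    | more c ih _ =>
      have : t + ((c + 2 : ℕ) : ℝ) * (Real.pi / 2) = t + c * (Real.pi / 2) + Real.pi := by
        push_cast; ring
      rw [this, PT_add_pi, norm_neg]
      exact ih
  rcases h with h | h <;> rw [h] <;> nlinarith [sq_nonneg ‖PT η t φ‖, sq_nonneg ‖PT η (t + Real.pi / 2) φ‖]

/-- Words of homogeneous degree `2s` are dominated in `L²` by the power of the operator. -/
theorem norm_wop_le (N : ℕ) (hn : 1 ≤ n) (hm : 1 ≤ m) (hN : 1 ≤ N) (s : ℕ)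
    (w : List (Letter n m)) (h1 : cdx w + (N + 1) * cdy w = 2 * s + cx w)
    (h2 : cx w + N * cdx w ≤ 2 * N * s) :
    ∃ C ≥ (0 : ℝ), ∀ φ, ‖wop w φ‖ ≤ C * ‖(gr n m N ^ s) φ‖ := by
  obtain ⟨C, hC, hT⟩ := CCR.dom_osc_pow (isCCR_scaled (n := n)) hn hN s _
    (CCR.filt_mono (by exact_mod_cast h2) (swop_mem N w))
  have key : ∀ (η : Fin m → ℝ), η ≠ 0 → ∀ t φ, ‖PT η t (wop w φ)‖ ≤
      C * ‖PT η (t + cdy w * (Real.pi / 2)) ((gr n m N ^ s) φ)‖ := by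
    intro η hη t φ
    have h0 := freq_pos N hη
    obtain ⟨c, hc, hP⟩ := PT_word N η hη w
    rw [h1, pow_add] at hc
    have hc' : |c| ≤ freq N η ^ (2 * s) := le_of_mul_le_mul_right hc (by positivity)
    rw [hP, PT_gr_pow N s η hη, norm_smul, norm_smul, Real.norm_eq_abs, Real.norm_eq_abs,
      abs_of_pos (pow_pos h0 _)]
    calc _ ≤ freq N η ^ (2 * s) * (C * _) :=
          mul_le_mul hc' (hT _ _) (norm_nonneg _) (by positivity)
      _ = _ := by ring
  refine ⟨2 * C, by positivity, fun φ => ?_⟩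
  have hsq : ENNReal.ofReal (‖wop w φ‖ ^ 2) ≤ ENNReal.ofReal ((2 * C * ‖(gr n m N ^ s) φ‖) ^ 2) := by
    rw [mul_pow, ENNReal.ofReal_mul (by positivity), plancherel, plancherel, ← lintegral_const_mul']
    swap
    · exact ENNReal.ofReal_ne_top
    have hne : ∀ᵐ η : Fin m → ℝ, η ≠ 0 := by
      have : Nonempty (Fin m) := ⟨⟨0, hm⟩⟩
      exact Measure.ae_ne volume 0
    refine lintegral_mono_ae (hne.mono fun η hη => ?_)
    rw [← ENNReal.ofReal_mul (by positivity)]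
    refine ENNReal.ofReal_le_ofReal ?_
    set u := (gr n m N ^ s) φ
    have a1 : _ ≤ (C * ‖PT η (0 + cdy w * (Real.pi / 2)) u‖) ^ 2 :=
      pow_le_pow_left₀ (norm_nonneg _) (key η hη 0 φ) 2
    have a2 : _ ≤ (C * ‖PT η (Real.pi / 2 + cdy w * (Real.pi / 2)) u‖) ^ 2 :=
      pow_le_pow_left₀ (norm_nonneg _) (key η hη (Real.pi / 2) φ) 2
    rw [mul_pow] at a1 a2
    have b1 := norm_PT_shift η 0 (cdy w) u
    have b2 := norm_PT_shift η (Real.pi / 2) (cdy w) u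
    rw [show Real.pi / 2 + Real.pi / 2 = 0 + Real.pi by ring, PT_add_pi, norm_neg] at b2
    rw [zero_add (Real.pi / 2)] at b1
    have hC2 := sq_nonneg C
    have c1 := mul_le_mul_of_nonneg_left b1 hC2
    have c2 := mul_le_mul_of_nonneg_left b2 hC2
    have d1 : 0 ≤ C ^ 2 * ‖PT η 0 u‖ ^ 2 := by positivity
    have d2 : 0 ≤ C ^ 2 * ‖PT η (Real.pi / 2) u‖ ^ 2 := by positivity
    nlinarith
  have := (ENNReal.ofReal_le_ofReal_iff (by positivity)).mp hsq
  exact le_of_sq_le_sq this (by positivity)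

end Grusin

lemma norm_list_sum_le_length_mul {α G : Type*} [SeminormedAddCommGroup G] (l : List α) (F : α → G)
    (B : ℝ) (h : ∀ p ∈ l, ‖F p‖ ≤ B) : ‖(l.map F).sum‖ ≤ l.length * B := by
  induction l with
  | nil => simp
  | cons a l ih =>
    simp only [List.map_cons, List.sum_cons, List.length_cons]
    have h1 := h a (by simp)
    have h2 := ih fun p hp => h p (by simp [hp])
    push_cast
    linarith [norm_add_le (F a) (l.map F).sum]

namespace TestFn

variable {E : Type*} [NormedAddCommGroup E] [NormedSpace ℝ E]

/-- Positive powers: `tpow θ k = θ ^ (k + 1)`. -/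
noncomputable def tpow (θ : TestFn E) : ℕ → TestFn E
  | 0 => θ
  | k + 1 => θ * tpow θ k

lemma tpow_apply (θ : TestFn E) (k : ℕ) (z : E) : tpow θ k z = θ z ^ (k + 1) := by
  induction k with
  | zero => simp [tpow]
  | succ k ih => simp [tpow, ih]; ring

/-- The proper terms in the iterated Leibniz rule. -/
def psplits {ι : Type*} : List ι → List (List ι × List ι)
  | [] => []
  | i :: β => ([i], β) :: ((psplits β).map (fun p => (i :: p.1, p.2)) ++
      (psplits β).map fun p => (p.1, i :: p.2))

lemma mem_psplits {ι : Type*} (β : List ι) : ∀ p ∈ psplits β,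
    p.1.length + p.2.length = β.length ∧ 1 ≤ p.1.length := by
  induction β with
  | nil => simp [psplits]
  | cons i β ih =>
    intro p hp
    simp only [psplits, List.mem_cons, List.mem_append, List.mem_map] at hp
    rcases hp with rfl | ⟨q, hq, rfl⟩ | ⟨q, hq, rfl⟩
    · simp; omega
    · have := ih q hq; simp; omega
    · have := ih q hq; simp; omega

lemma length_psplits {ι : Type*} (β : List ι) : (psplits β).length ≤ 2 ^ β.length := by
  have : (psplits β).length + 1 ≤ 2 ^ β.length := by
    induction β with
    | nil => simp [psplits]
    | cons i β ih => simp [psplits, pow_succ]; omega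
  omega

variable {ι : Type*}

/-- The operator of a word in a family. -/
noncomputable def zw (Z : ι → Module.End ℝ (TestFn E)) (β : List ι) : Module.End ℝ (TestFn E) :=
  (β.map Z).prod

lemma zw_nil (Z : ι → Module.End ℝ (TestFn E)) (f) : zw Z [] f = f := rfl
lemma zw_cons (Z : ι → Module.End ℝ (TestFn E)) (i β f) : zw Z (i :: β) f = Z i (zw Z β f) := by
  simp [zw]

lemma zw_mul (Z : ι → Module.End ℝ (TestFn E))
    (hL : ∀ i f g, Z i (f * g) = Z i f * g + f * Z i g) (β : List ι) (f w : TestFn E) :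
    zw Z β (f * w) = f * zw Z β w + ((psplits β).map fun p => zw Z p.1 f * zw Z p.2 w).sum := by
  induction β with
  | nil => simp [zw_nil, psplits]
  | cons i β ih =>
    rw [zw_cons, ih, map_add, hL, map_list_sum]
    simp only [psplits, List.map_cons, List.map_append, List.sum_cons, List.sum_append,
      List.map_map, Function.comp_def, hL, zw_cons, zw_nil, List.sum_map_add]
    abel

lemma zw_mul_apply (Z : ι → Module.End ℝ (TestFn E))
    (hL : ∀ i f g, Z i (f * g) = Z i f * g + f * Z i g) (β : List ι) (f w : TestFn E) (z : E) :
    zw Z β (f * w) z = f z * zw Z β w z +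
      ((psplits β).map fun p => zw Z p.1 f z * zw Z p.2 w z).sum := by
  rw [zw_mul Z hL]
  change ev z (f * zw Z β w + ((psplits β).map fun p => zw Z p.1 f * zw Z p.2 w).sum) = _
  rw [map_add, map_list_sum, List.map_map]
  rfl

lemma Z_tpow (Z : ι → Module.End ℝ (TestFn E))
    (hL : ∀ i f g, Z i (f * g) = Z i f * g + f * Z i g) (i : ι) (θ : TestFn E) (k : ℕ) (z : E) :
    Z i (tpow θ k) z = (k + 1) * θ z ^ k * Z i θ z := by
  induction k with
  | zero => simp [tpow]
  | succ k ih =>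
    simp only [tpow, hL, coe_add, coe_mul, Pi.add_apply, Pi.mul_apply, ih, tpow_apply]
    push_cast; ring

/-- Derivatives of powers of a cutoff function. -/
lemma exists_abs_zw_tpow_le (ι : Type*) (K : ℝ) (hK : 0 ≤ K) (L k : ℕ) : ∃ C ≥ (0 : ℝ),
    ∀ (Z : ι → Module.End ℝ (TestFn E)), (∀ i f g, Z i (f * g) = Z i f * g + f * Z i g) →
    ∀ θ : TestFn E, (∀ z, 0 ≤ θ z) → (∀ z, θ z ≤ 1) →
    (∀ γ : List ι, γ.length ≤ L → ∀ z, |zw Z γ θ z| ≤ K) →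
    ∀ γ : List ι, γ.length ≤ L → ∀ z, |zw Z γ (tpow θ k) z| ≤ C * θ z ^ (k + 1 - γ.length) := by
  induction k with
  | zero =>
    refine ⟨K + 1, by positivity, fun Z hL θ h0 h1 hθ γ hγ z => ?_⟩
    rcases γ with _ | ⟨i, γ⟩
    · simp only [zw_nil, tpow, List.length_nil, zero_add, tsub_zero, pow_one, abs_of_nonneg (h0 z)]
      nlinarith [h0 z]
    · simp only [List.length_cons, zero_add, Nat.sub_eq_zero_of_le (Nat.le_add_left 1 γ.length),
        pow_zero, mul_one, tpow]
      linarith [hθ _ hγ z]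
  | succ k ih =>
    obtain ⟨C, hC, ih⟩ := ih
    refine ⟨C + 2 ^ L * (K * C), by positivity, fun Z hL θ h0 h1 hθ γ hγ z => ?_⟩
    have hmain : |θ z * zw Z γ (tpow θ k) z| ≤ C * θ z ^ (k + 1 + 1 - γ.length) := by
      rw [abs_mul, abs_of_nonneg (h0 z)]
      calc θ z * |zw Z γ (tpow θ k) z| ≤ θ z * (C * θ z ^ (k + 1 - γ.length)) :=
            mul_le_mul_of_nonneg_left (ih Z hL θ h0 h1 hθ γ hγ z) (h0 z)
        _ = C * θ z ^ (k + 1 - γ.length + 1) := by ring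
        _ ≤ _ := mul_le_mul_of_nonneg_left (pow_le_pow_of_le_one (h0 z) (h1 z) (by omega)) hC
    have hrest : |((psplits γ).map fun p => zw Z p.1 θ z * zw Z p.2 (tpow θ k) z).sum| ≤
        2 ^ L * (K * C) * θ z ^ (k + 1 + 1 - γ.length) := by
      have hb : ∀ p ∈ psplits γ, ‖zw Z p.1 θ z * zw Z p.2 (tpow θ k) z‖ ≤
          K * C * θ z ^ (k + 1 + 1 - γ.length) := by
        intro p hp
        have hp' := mem_psplits γ p hp
        rw [Real.norm_eq_abs, abs_mul, mul_assoc]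
        refine mul_le_mul (hθ _ (by omega) z) ((ih Z hL θ h0 h1 hθ p.2 (by omega) z).trans ?_)
          (abs_nonneg _) hK
        exact mul_le_mul_of_nonneg_left (pow_le_pow_of_le_one (h0 z) (h1 z) (by omega)) hC
      have := norm_list_sum_le_length_mul _ _ _ hb
      rw [Real.norm_eq_abs] at this
      refine this.trans ?_
      rw [mul_assoc (2 ^ L)]
      refine mul_le_mul_of_nonneg_right ?_ (mul_nonneg (by positivity) (pow_nonneg (h0 z) _))
      calc ((psplits γ).length : ℝ) ≤ 2 ^ γ.length := by exact_mod_cast length_psplits γ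
        _ ≤ 2 ^ L := pow_le_pow_right₀ (by norm_num) hγ
    rw [tpow, zw_mul_apply Z hL, add_mul]
    exact (abs_add_le _ _).trans (add_le_add hmain hrest)

/-- The sum of squares attached to a family. -/
noncomputable def sqsum [Fintype ι] (Z : ι → Module.End ℝ (TestFn E)) : Module.End ℝ (TestFn E) :=
  -∑ i, Z i ^ 2

/-- The words in the power of a sum of squares. -/
noncomputable def hwords (ι : Type*) [Fintype ι] : ℕ → List (List ι)
  | 0 => [[]]
  | s + 1 => (Finset.univ : Finset ι).toList.flatMap fun i => (hwords ι s).map fun l => i :: i :: l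

lemma length_of_mem_hwords [Fintype ι] (s : ℕ) : ∀ l ∈ hwords ι s, l.length = 2 * s := by
  induction s with
  | zero => simp [hwords]
  | succ s ih =>
    intro l hl
    simp only [hwords, List.mem_flatMap, List.mem_map] at hl
    obtain ⟨i, -, l', hl', rfl⟩ := hl
    simp [ih l' hl']; ring

lemma sqsum_pow [Fintype ι] (Z : ι → Module.End ℝ (TestFn E)) (s : ℕ) (f : TestFn E) :
    (sqsum Z ^ s) f = (-1 : ℝ) ^ s • ((hwords ι s).map fun l => zw Z l f).sum := by
  induction s with
  | zero => simp [hwords, zw_nil]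
  | succ s ih =>
    rw [pow_succ', Module.End.mul_apply, ih, map_smul]
    have key : ((hwords ι (s + 1)).map fun l => zw Z l f).sum =
        ∑ i, Z i (Z i ((hwords ι s).map fun l => zw Z l f).sum) := by
      rw [← Finset.sum_map_toList, hwords]
      induction (Finset.univ : Finset ι).toList with
      | nil => simp
      | cons i l ih2 =>
        rw [List.flatMap_cons, List.map_append, List.sum_append, ih2, List.map_cons, List.sum_cons]
        simp only [map_list_sum, List.map_map, Function.comp_def, zw_cons]
    rw [key]
    simp only [sqsum, LinearMap.neg_apply, LinearMap.sum_apply, pow_two, Module.End.mul_apply]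
    rw [pow_succ, mul_neg_one, neg_smul, smul_neg]

variable [MeasureSpace E] [BorelSpace E] [FiniteDimensional ℝ E]
  [(volume : Measure E).IsAddHaarMeasure]

lemma norm_le_mul_of_abs_le (f g : TestFn E) {C : ℝ} (hC : 0 ≤ C) (h : ∀ x, |f x| ≤ C * |g x|) :
    ‖f‖ ≤ C * ‖g‖ := by
  have := norm_le_of_abs_le {()} f (fun _ => C • g) (fun x => by
    simpa [abs_mul, abs_of_nonneg hC] using h x)
  simpa [norm_smul, abs_of_nonneg hC] using this

/-- Integration by parts with a cutoff. -/
lemma norm_tpow_Z_sq_le (Z : ι → Module.End ℝ (TestFn E))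
    (hL : ∀ i f g, Z i (f * g) = Z i f * g + f * Z i g)
    (hA : ∀ i f g, inner ℝ (Z i f) g = - inner ℝ f (Z i g)) (θ : TestFn E) {K : ℝ} (hK : 0 ≤ K)
    (i : ι) (hθ : ∀ z, |Z i θ z| ≤ K) (j : ℕ) (u : TestFn E) :
    ‖tpow θ (j + 1) * Z i u‖ ^ 2 ≤ ‖tpow θ j * u‖ *
      (‖tpow θ (j + 2) * Z i (Z i u)‖ + 2 * (j + 2) * K * ‖tpow θ (j + 1) * Z i u‖) := by
  set F := tpow θ (j + 1) with hF
  have e1 : ‖F * Z i u‖ ^ 2 = - inner ℝ (tpow θ j * u)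
      (tpow θ (j + 2) * Z i (Z i u) + (2 * (j + 2) : ℝ) • (Z i θ * (F * Z i u))) := by
    rw [← real_inner_self_eq_norm_sq, inner_mul_left, hA, inner_def, inner_def]
    congr 2; ext z
    simp only [hL, hF, coe_add, coe_mul, Pi.add_apply, Pi.mul_apply, coe_smul, Pi.smul_apply,
      smul_eq_mul, Z_tpow Z hL, tpow_apply]
    push_cast; ring
  have e2 : ‖Z i θ * (F * Z i u)‖ ≤ K * ‖F * Z i u‖ :=
    norm_le_mul_of_abs_le _ _ hK fun x => by
      rw [coe_mul, Pi.mul_apply, abs_mul]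
      exact mul_le_mul_of_nonneg_right (hθ x) (abs_nonneg _)
  rw [e1, ← inner_neg_left]
  refine (real_inner_le_norm _ _).trans ?_
  rw [norm_neg]
  refine mul_le_mul_of_nonneg_left ((norm_add_le _ _).trans ?_) (norm_nonneg _)
  rw [norm_smul, Real.norm_of_nonneg (by positivity)]
  have := mul_le_mul_of_nonneg_left e2 (by positivity : (0 : ℝ) ≤ 2 * (j + 2))
  linarith

set_option maxHeartbeats 1000000 in
/-- The localized a priori estimate for the power of a sum of squares. -/
theorem exists_norm_sqsum_pow_cutoff_le (ι : Type*) [Fintype ι] [Nonempty ι] (s : ℕ) (hs : 1 ≤ s)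
    (A K : ℝ) (hA0 : 0 ≤ A) (hK : 0 ≤ K) : ∃ C ≥ (0 : ℝ),
    ∀ (Z : ι → Module.End ℝ (TestFn E)), (∀ i f g, Z i (f * g) = Z i f * g + f * Z i g) →
    (∀ i f g, inner ℝ (Z i f) g = - inner ℝ f (Z i g)) →
    (∀ β : List ι, β.length = 2 * s → ∀ f, ‖zw Z β f‖ ≤ A * ‖(sqsum Z ^ s) f‖) →
    ∀ θ : TestFn E, (∀ z, 0 ≤ θ z) → (∀ z, θ z ≤ 1) →
    (∀ γ : List ι, γ.length ≤ 2 * s → ∀ z, |zw Z γ θ z| ≤ K) → ∀ w : TestFn E,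
    ‖(sqsum Z ^ s) (tpow θ (2 * s) * w)‖ ≤
      C * (‖θ * w‖ + ‖tpow θ (2 * s) * (sqsum Z ^ s) w‖) := by
  obtain ⟨C1, hC1, hder⟩ := exists_abs_zw_tpow_le (E := E) ι K hK (2 * s) (2 * s)
  set C2 : ℝ := 2 ^ (2 * s) * C1 with hC2
  have hC2' : 0 ≤ C2 := by positivity
  set C3 : ℝ := (hwords ι s).length * C2 with hC3
  have hC3' : 0 ≤ C3 := by positivity
  set R : ℝ := (A * C3 + C2) * (2 * s) with hR
  have hR0 : 0 ≤ R := by positivity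
  obtain ⟨D, hD, hinterp⟩ := exists_interp (1 + 2 * (2 * s + 1) * K) (by positivity) (2 * s)
    (1 / (2 * (R + 1))) (by positivity)
  refine ⟨1 + C3 * (2 * s) * (1 / (2 * (R + 1)) * 2 * A +
    1 / (2 * (R + 1)) * 2 * (R * D) + D), by positivity, ?_⟩
  intro Z hL hA hbd θ h0 h1 hθ w
  let b : ℕ → ℝ := fun j => ⨆ β : Fin j → ι, ‖tpow θ j * zw Z (List.ofFn β) w‖
  have hb_le : ∀ l : List ι, ‖tpow θ l.length * zw Z l w‖ ≤ b l.length := by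
    intro l
    have := le_ciSup (f := fun β : Fin l.length → ι => ‖tpow θ l.length * zw Z (List.ofFn β) w‖)
      (Set.finite_range _).bddAbove l.get
    simpa [b, List.ofFn_get] using this
  have hb_ex : ∀ j, ∃ l : List ι, l.length = j ∧ b j = ‖tpow θ j * zw Z l w‖ := by
    intro j
    obtain ⟨β, hβ⟩ := exists_eq_ciSup_of_finite
      (f := fun β : Fin j → ι => ‖tpow θ j * zw Z (List.ofFn β) w‖)
    exact ⟨List.ofFn β, by simp, hβ.symm⟩
  have hb0 : ∀ j, 0 ≤ b j := by
    intro j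
    obtain ⟨l, -, h⟩ := hb_ex j
    rw [h]; exact norm_nonneg _
  have hbz : b 0 = ‖θ * w‖ := by
    obtain ⟨l, hl, h⟩ := hb_ex 0
    rw [List.length_eq_zero_iff.mp hl] at h
    simpa [tpow, zw_nil] using h
  have hrec : ∀ j, 1 ≤ j → j < 2 * s →
      b j ^ 2 ≤ (1 + 2 * (2 * s + 1) * K) * (b (j + 1) + b j) * b (j - 1) := by
    intro j hj hj2
    obtain ⟨l, hl, h⟩ := hb_ex j
    rcases l with _ | ⟨i, l⟩
    · simp at hl; omega
    obtain rfl : j = l.length + 1 := by simpa using hl.symm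
    have key := norm_tpow_Z_sq_le Z hL hA θ hK i
      (fun z => by simpa [zw_cons, zw_nil] using hθ [i] (by simp; omega) z) l.length (zw Z l w)
    have a1 := hb_le l
    have a2 := hb_le (i :: i :: l)
    simp only [zw_cons, List.length_cons] at a2
    rw [zw_cons] at h
    rw [← h] at key
    have hjs : ((l.length : ℝ) + 2) ≤ 2 * s + 1 := by
      have : l.length + 2 ≤ 2 * s + 1 := by omega
      exact_mod_cast this
    calc b (l.length + 1) ^ 2 ≤ _ := key
      _ ≤ b l.length * (b (l.length + 1 + 1) + 2 * (2 * s + 1) * K * b (l.length + 1)) := by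
          have := hb0 (l.length + 1)
          gcongr
          exact hb0 _
      _ ≤ b l.length * ((1 + 2 * (2 * s + 1) * K) * (b (l.length + 1 + 1) + b (l.length + 1))) := by
          have h1 := hb0 (l.length + 1)
          have h2 := hb0 (l.length + 1 + 1)
          refine mul_le_mul_of_nonneg_left ?_ (hb0 _)
          have : 0 ≤ 2 * (2 * s + 1) * K := by positivity
          nlinarith [mul_nonneg this h2]
      _ = _ := by simp; ring
  have hlow := hinterp b hb0 hrec
  set ε : ℝ := 1 / (2 * (R + 1)) with hε
  have hε0 : 0 < ε := by positivity
  set S : ℝ := ε * b (2 * s) + D * b 0 with hS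
  have hS0 : 0 ≤ S := by have := hb0 (2 * s); have := hb0 0; positivity
  have hcomm : ∀ β : List ι, β.length = 2 * s →
      ‖zw Z β (tpow θ (2 * s) * w) - tpow θ (2 * s) * zw Z β w‖ ≤ C2 * S := by
    intro β hβ
    rw [zw_mul Z hL, add_sub_cancel_left]
    refine (norm_list_sum_le_length_mul _ _ (C1 * S) ?_).trans ?_
    · intro p hp
      have hp' := mem_psplits β p hp
      have h2 : ‖zw Z p.1 (tpow θ (2 * s)) * zw Z p.2 w‖ ≤ C1 * ‖tpow θ p.2.length * zw Z p.2 w‖ := by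
        refine norm_le_mul_of_abs_le _ _ hC1 fun x => ?_
        simp only [coe_mul, Pi.mul_apply, abs_mul, tpow_apply, abs_of_nonneg (pow_nonneg (h0 x) _)]
        rw [← mul_assoc]
        refine mul_le_mul_of_nonneg_right ?_ (abs_nonneg _)
        have := hder Z hL θ h0 h1 hθ p.1 (by omega) x
        rwa [show 2 * s + 1 - p.1.length = p.2.length + 1 by omega] at this
      exact h2.trans (mul_le_mul_of_nonneg_left ((hb_le _).trans (hlow _ (by omega))) hC1)
    · rw [hC2, mul_assoc]
      refine mul_le_mul_of_nonneg_right ?_ (by positivity)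
      rw [← hβ]; exact_mod_cast length_psplits β
  set X := ‖(sqsum Z ^ s) (tpow θ (2 * s) * w)‖ with hX
  set Y := ‖tpow θ (2 * s) * (sqsum Z ^ s) w‖ with hY
  have hXY : X ≤ Y + C3 * S := by
    have : (sqsum Z ^ s) (tpow θ (2 * s) * w) = tpow θ (2 * s) * (sqsum Z ^ s) w +
        (-1 : ℝ) ^ s • ((hwords ι s).map fun l =>
          zw Z l (tpow θ (2 * s) * w) - tpow θ (2 * s) * zw Z l w).sum := by
      rw [sqsum_pow, sqsum_pow]
      have e : ∀ f : TestFn E, tpow θ (2 * s) * f = M (tpow θ (2 * s)) (tpow θ (2 * s)).smooth f :=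
        fun f => rfl
      rw [e ((-1 : ℝ) ^ s • _), map_smul, map_list_sum, List.map_map, ← smul_add]
      congr 1
      rw [← List.sum_map_add]
      congr 2; ext1 l
      rw [Function.comp_apply, ← e]
      abel
    rw [hX, this]
    refine (norm_add_le _ _).trans (add_le_add le_rfl ?_)
    rw [norm_smul, norm_pow, norm_neg, norm_one, one_pow, one_mul]
    refine (norm_list_sum_le_length_mul _ _ (C2 * S) fun l hl =>
      hcomm l (length_of_mem_hwords s l hl)).trans (mul_assoc _ _ _).symm.le
  have htop : b (2 * s) ≤ A * X + C2 * S := by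
    obtain ⟨l, hl, h⟩ := hb_ex (2 * s)
    rw [h]
    have h2 := hcomm l hl
    have h3 := hbd l hl (tpow θ (2 * s) * w)
    have := norm_sub_norm_le (tpow θ (2 * s) * zw Z l w) (zw Z l (tpow θ (2 * s) * w))
    rw [norm_sub_rev] at this
    linarith
  have hs1 : (1 : ℝ) ≤ 2 * s := by
    have : (1 : ℝ) ≤ s := by exact_mod_cast hs
    linarith
  have hRS : (A * C3 + C2) * S ≤ R * S := by
    refine mul_le_mul_of_nonneg_right ?_ hS0
    rw [hR]; exact le_mul_of_one_le_right (by positivity) hs1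
  have hεR : R * ε ≤ 1 / 2 := by
    rw [hε, mul_one_div, div_le_div_iff₀ (by positivity) (by norm_num)]; linarith
  have hb2 : b (2 * s) ≤ 2 * (A * Y) + 2 * (R * D) * b 0 := by
    have e1 : A * X ≤ A * Y + A * C3 * S := by nlinarith
    have e2 : R * S = R * ε * b (2 * s) + R * D * b 0 := by rw [hS]; ring
    have e3 : R * ε * b (2 * s) ≤ 1 / 2 * b (2 * s) :=
      mul_le_mul_of_nonneg_right hεR (hb0 _)
    nlinarith
  have hY0 : 0 ≤ Y := norm_nonneg _
  have hb00 := hb0 0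
  rw [← hbz]
  have hfin : S ≤ (ε * 2 * A + ε * 2 * (R * D) + D) * (b 0 + Y) := by
    have e1 : S ≤ ε * (2 * (A * Y) + 2 * (R * D) * b 0) + D * b 0 := by
      rw [hS]; gcongr
    have p1 : 0 ≤ ε * 2 * A * b 0 := by positivity
    have p2 : 0 ≤ ε * 2 * (R * D) * Y := by positivity
    have p3 : 0 ≤ D * Y := by positivity
    nlinarith
  calc X ≤ Y + C3 * S := hXY
    _ ≤ Y + C3 * (2 * s) * ((ε * 2 * A + ε * 2 * (R * D) + D) * (b 0 + Y)) := by
        gcongr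
        exact le_mul_of_one_le_right hC3' hs1
    _ ≤ _ := by nlinarith

end TestFn

namespace Grusin

open TestFn

variable {n m : ℕ}

/-- Multiplication by the affine function `t x_i + ξ_i`. -/
noncomputable def na (t : ℝ) (ξ : Fin n → ℝ) (i : Fin n) : Module.End ℝ (TestFn (Pt n m)) :=
  M (fun z => t * z.1 i + ξ i) (show ContDiff ℝ ∞ (fun z : Pt n m => t * z.1 i + ξ i) by fun_prop)

@[simp] lemma na_apply (t : ℝ) (ξ : Fin n → ℝ) (i : Fin n) (φ : TestFn (Pt n m)) (z) :
    na t ξ i φ z = (t * z.1 i + ξ i) * φ z := rfl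

/-- The operator of a letter in normalized coordinates. -/
noncomputable def Letter.nop (t : ℝ) (ξ : Fin n → ℝ) : Letter n m → Module.End ℝ (TestFn (Pt n m))
  | .x i => na t ξ i
  | .dx i => odx i
  | .dy k => ody k

/-- The operator of a word in normalized coordinates. -/
noncomputable def nwop (t : ℝ) (ξ : Fin n → ℝ) (w : List (Letter n m)) :
    Module.End ℝ (TestFn (Pt n m)) := (w.map (Letter.nop t ξ)).prod

lemma nwop_nil (t : ℝ) (ξ : Fin n → ℝ) : nwop t ξ ([] : List (Letter n m)) = 1 := rfl
lemma nwop_cons (t : ℝ) (ξ : Fin n → ℝ) (l : Letter n m) (w) :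
    nwop t ξ (l :: w) = l.nop t ξ * nwop t ξ w := by simp [nwop]
lemma nwop_append (t : ℝ) (ξ : Fin n → ℝ) (u w : List (Letter n m)) :
    nwop t ξ (u ++ w) = nwop t ξ u * nwop t ξ w := by simp [nwop]

lemma nop_one_zero (l : Letter n m) : l.nop 1 0 = l.op := by
  cases l with
  | x i => ext φ z; simp [Letter.nop, Letter.op]
  | _ => rfl

lemma nwop_one_zero (w : List (Letter n m)) : nwop 1 0 w = wop w := by
  simp only [nwop, wop]
  congr 2; ext1 l; exact nop_one_zero l

/-- The index type of the vector fields `∂_{x_j}` and `x_{f 1} ⋯ x_{f N} ∂_{y_k}`. -/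
abbrev ZIdx (n m N : ℕ) := Fin n ⊕ ((Fin N → Fin n) × Fin m)

/-- The word of a vector field. -/
def zword {N : ℕ} : ZIdx n m N → List (Letter n m)
  | .inl j => [.dx j]
  | .inr (f, k) => (List.ofFn fun j => Letter.x (f j)) ++ [.dy k]

/-- The vector fields in normalized coordinates. -/
noncomputable def nZ (t : ℝ) (ξ : Fin n → ℝ) (N : ℕ) (i : ZIdx n m N) :
    Module.End ℝ (TestFn (Pt n m)) := nwop t ξ (zword i)

lemma nwop_ofFn_x_apply (t : ℝ) (ξ : Fin n → ℝ) (l : List (Fin n)) (φ : TestFn (Pt n m)) (z) :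
    nwop t ξ (l.map Letter.x) φ z = (l.map fun i => t * z.1 i + ξ i).prod * φ z := by
  induction l with
  | nil => simp [nwop_nil]
  | cons i l ih =>
    simp only [List.map_cons, nwop_cons, Module.End.mul_apply, Letter.nop, na_apply, ih,
      List.prod_cons, mul_assoc]

lemma nZ_inl (t : ℝ) (ξ : Fin n → ℝ) (N : ℕ) (j : Fin n) :
    nZ t ξ N (.inl j : ZIdx n m N) = odx j := by simp [nZ, zword, nwop, Letter.nop]

lemma nZ_inr_apply (t : ℝ) (ξ : Fin n → ℝ) (N : ℕ) (f : Fin N → Fin n) (k : Fin m)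
    (φ : TestFn (Pt n m)) (z) :
    nZ t ξ N (.inr (f, k)) φ z = (∏ j, (t * z.1 (f j) + ξ (f j))) * ody k φ z := by
  have e : (List.ofFn fun j => Letter.x (n := n) (m := m) (f j)) = (List.ofFn f).map Letter.x := by
    simp [List.map_ofFn, Function.comp_def]
  simp only [nZ, zword, nwop_append, Module.End.mul_apply, e, nwop_ofFn_x_apply]
  rw [List.map_ofFn, List.prod_ofFn]
  simp [nwop, Letter.nop]

lemma nZ_inr (t : ℝ) (ξ : Fin n → ℝ) (N : ℕ) (f : Fin N → Fin n) (k : Fin m) :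
    nZ t ξ N (.inr (f, k)) = M (fun z : Pt n m => ∏ j, (t * z.1 (f j) + ξ (f j)))
      (by fun_prop) * ody k := by
  ext φ z; rw [nZ_inr_apply]; rfl

lemma nZ_leibniz (t : ℝ) (ξ : Fin n → ℝ) (N : ℕ) (i : ZIdx n m N) (f g : TestFn (Pt n m)) :
    nZ t ξ N i (f * g) = nZ t ξ N i f * g + f * nZ t ξ N i g := by
  rcases i with j | ⟨h, k⟩
  · simp only [nZ_inl, odx, D_mul]
  · ext z
    simp only [nZ_inr_apply, ody, D_mul, coe_add, coe_mul, Pi.add_apply, Pi.mul_apply]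
    ring

lemma fderiv_comp_fst_dy (g : (Fin n → ℝ) → ℝ) (hg : Differentiable ℝ g) (z : Pt n m)
    (v : Fin m → ℝ) : fderiv ℝ (fun z : Pt n m => g z.1) z (0, v) = 0 := by
  have h : HasFDerivAt (fun z : Pt n m => g z.1)
      ((fderiv ℝ g z.1).comp (ContinuousLinearMap.fst ℝ (Fin n → ℝ) (Fin m → ℝ))) z :=
    (hg z.1).hasFDerivAt.comp z hasFDerivAt_fst
  rw [h.fderiv]; simp

lemma nZ_anti (t : ℝ) (ξ : Fin n → ℝ) (N : ℕ) (i : ZIdx n m N) (f g : TestFn (Pt n m)) :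
    inner ℝ (nZ t ξ N i f) g = - inner ℝ f (nZ t ξ N i g) := by
  rcases i with j | ⟨h, k⟩
  · simp only [nZ_inl, odx, D_anti]
  · rw [nZ_inr, Module.End.mul_apply, M_symm, ody, D_anti, Module.End.mul_apply]
    congr 2; ext z
    rw [D_M, fderiv_comp_fst_dy (fun x => ∏ j, (t * x (h j) + ξ (h j))) (by fun_prop)]
    simp

/-- The normalized Grušin operator. -/
noncomputable def ngr (t : ℝ) (ξ : Fin n → ℝ) (m N : ℕ) : Module.End ℝ (TestFn (Pt n m)) :=
  sqsum (nZ t ξ N)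

lemma ngr_one_zero (N : ℕ) : ngr 1 0 m N = gr n m N := by
  ext φ z
  have e : ∀ (f : Fin N → Fin n) (k : Fin m), ody k (nZ 1 0 N (.inr (f, k)) φ) =
      M (fun z : Pt n m => ∏ j, (1 * z.1 (f j) + (0 : Fin n → ℝ) (f j)))
        (by fun_prop) (ody k (ody k φ)) := by
    intro f k
    ext z
    rw [nZ_inr, Module.End.mul_apply]
    simp only [ody]
    rw [D_M, fderiv_comp_fst_dy (fun x : Fin n → ℝ => ∏ j, (1 * x (f j) + (0 : Fin n → ℝ) (f j)))
      (by fun_prop)]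
    simp
  simp only [ngr, sqsum, gr, LinearMap.neg_apply, LinearMap.sub_apply, LinearMap.sum_apply,
    pow_two (nZ _ _ _ _), Module.End.mul_apply, coe_neg, coe_sub, Pi.neg_apply, Pi.sub_apply,
    TestFn.sum_apply, Fintype.sum_sum_type, Fintype.sum_prod_type, nZ_inl, ox_rad_pow_apply,
    LinearMap.add_apply, coe_add, Pi.add_apply,
    nZ_inr_apply, e, M_apply, Fintype.sum_pow, pow_two (odx _), pow_two (ody _)]
  rw [Finset.sum_mul, neg_add, sub_eq_add_neg]
  congr 2
  refine Finset.sum_congr rfl fun f _ => ?_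
  rw [Finset.mul_sum]
  refine Finset.sum_congr rfl fun k _ => ?_
  rw [← mul_assoc, ← Finset.prod_mul_distrib]
  congr 1
  refine Finset.prod_congr rfl fun j _ => ?_
  simp [pow_two]

lemma zw_nZ (t : ℝ) (ξ : Fin n → ℝ) (N : ℕ) (β : List (ZIdx n m N)) :
    zw (nZ t ξ N) β = nwop t ξ (β.flatMap zword) := by
  induction β with
  | nil => rfl
  | cons i β ih =>
    rw [List.flatMap_cons, nwop_append, ← ih]
    simp [zw, nZ]

lemma cx_append (u w : List (Letter n m)) : cx (u ++ w) = cx u + cx w := by simp [cx]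
lemma cdx_append (u w : List (Letter n m)) : cdx (u ++ w) = cdx u + cdx w := by simp [cdx]
lemma cdy_append (u w : List (Letter n m)) : cdy (u ++ w) = cdy u + cdy w := by simp [cdy]

lemma count_zword {N : ℕ} (i : ZIdx n m N) : cdx (zword i) + cdy (zword i) = 1 ∧
    cx (zword i) = N * cdy (zword i) := by
  rcases i with j | ⟨f, k⟩
  · simp [zword, cx, cdx, cdy, Letter.nx, Letter.ndx, Letter.ndy]
  · simp [zword, cx, cdx, cdy, Letter.nx, Letter.ndx, Letter.ndy, Function.comp_def, List.map_ofFn]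

lemma count_flatMap_zword {N : ℕ} (β : List (ZIdx n m N)) :
    cdx (β.flatMap zword) + cdy (β.flatMap zword) = β.length ∧
    cx (β.flatMap zword) = N * cdy (β.flatMap zword) := by
  induction β with
  | nil => simp [cx, cdx, cdy]
  | cons i β ih =>
    have := count_zword i
    simp only [List.flatMap_cons, cx_append, cdx_append, cdy_append, List.length_cons, this.2, ih.2,
      mul_add, and_true]
    omega

end Grusin

namespace Grusin

open TestFn

variable {n m : ℕ}

/-- An anisotropic dilation followed by a translation. -/
def aff (z0 : Pt n m) (r σ : ℝ) (u : Pt n m) : Pt n m := (z0.1 + r • u.1, z0.2 + σ • u.2)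

lemma aff_aff (z0 : Pt n m) {r σ : ℝ} (hr : r ≠ 0) (hσ : σ ≠ 0) (u : Pt n m) :
    aff z0 r σ (aff (-(r⁻¹ • z0.1), -(σ⁻¹ • z0.2)) r⁻¹ σ⁻¹ u) = u := by
  ext i <;> simp [aff] <;> field_simp <;> ring

lemma aff_aff' (z0 : Pt n m) {r σ : ℝ} (hr : r ≠ 0) (hσ : σ ≠ 0) (u : Pt n m) :
    aff (-(r⁻¹ • z0.1), -(σ⁻¹ • z0.2)) r⁻¹ σ⁻¹ (aff z0 r σ u) = u := by
  ext i <;> simp [aff] <;> field_simp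

lemma aff_smooth (z0 : Pt n m) (r σ : ℝ) : ContDiff ℝ ∞ (aff z0 r σ) := by
  unfold aff; fun_prop

/-- The dilation as a homeomorphism. -/
noncomputable def affHomeo (z0 : Pt n m) {r σ : ℝ} (hr : r ≠ 0) (hσ : σ ≠ 0) : Pt n m ≃ₜ Pt n m where
  toFun := aff z0 r σ
  invFun := aff (-(r⁻¹ • z0.1), -(σ⁻¹ • z0.2)) r⁻¹ σ⁻¹
  left_inv := aff_aff' z0 hr hσ
  right_inv := aff_aff z0 hr hσ
  continuous_toFun := (aff_smooth _ _ _).continuous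
  continuous_invFun := (aff_smooth _ _ _).continuous

lemma map_aff (z0 : Pt n m) {r σ : ℝ} (hr : 0 < r) (hσ : 0 < σ) :
    (volume : Measure (Pt n m)).map (aff z0 r σ) = ENNReal.ofReal ((r ^ n * σ ^ m)⁻¹) • volume := by
  have key : ∀ (d : ℕ) (a : Fin d → ℝ) (r : ℝ), 0 < r →
      (volume : Measure (Fin d → ℝ)).map (fun x => a + r • x) =
        ENNReal.ofReal ((r ^ d)⁻¹) • volume := by
    intro d a r hr
    have h1 : (fun x : Fin d → ℝ => a + r • x) = (fun x => a + x) ∘ fun x => r • x := rfl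
    rw [h1, ← Measure.map_map (by fun_prop) (by fun_prop), Measure.map_addHaar_smul _ hr.ne',
      Measure.map_smul, map_add_left_eq_self]
    simp [abs_of_pos (pow_pos hr d)]
  have h2 : aff z0 r σ = Prod.map (fun x => z0.1 + r • x) fun y => z0.2 + σ • y := rfl
  have h3 : (volume : Measure (Pt n m)) = (volume : Measure (Fin n → ℝ)).prod volume := rfl
  rw [h2, h3, ← Measure.map_prod_map _ _ (by fun_prop) (by fun_prop), key _ _ _ hr, key _ _ _ hσ,
    Measure.prod_smul_left, Measure.prod_smul_right, smul_smul, mul_inv,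
    ENNReal.ofReal_mul (by positivity)]

lemma integral_comp_aff (z0 : Pt n m) {r σ : ℝ} (hr : 0 < r) (hσ : 0 < σ) (f : Pt n m → ℝ) :
    ∫ u, f (aff z0 r σ u) = (r ^ n * σ ^ m)⁻¹ * ∫ z, f z := by
  have h := (affHomeo z0 hr.ne' hσ.ne').measurableEmbedding.integral_map (μ := volume) f
  change ∫ y, f y ∂(volume.map (aff z0 r σ)) = ∫ u, f (aff z0 r σ u) at h
  rw [← h, map_aff z0 hr hσ, integral_smul_measure, ENNReal.toReal_ofReal (by positivity),
    smul_eq_mul]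

/-- Composition of a test function with a dilation. -/
noncomputable def pull (z0 : Pt n m) {r σ : ℝ} (hr : r ≠ 0) (hσ : σ ≠ 0) :
    TestFn (Pt n m) →ₗ[ℝ] TestFn (Pt n m) where
  toFun φ := mk (fun u => φ (aff z0 r σ u)) (φ.smooth.comp (aff_smooth _ _ _))
    (φ.compact.comp_homeomorph (affHomeo z0 hr hσ))
  map_add' _ _ := rfl
  map_smul' _ _ := rfl

lemma pull_apply (z0 : Pt n m) {r σ : ℝ} (hr : r ≠ 0) (hσ : σ ≠ 0) (φ : TestFn (Pt n m)) (u) :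
    pull z0 hr hσ φ u = φ (aff z0 r σ u) := rfl

lemma pull_surjective (z0 : Pt n m) {r σ : ℝ} (hr : r ≠ 0) (hσ : σ ≠ 0) :
    Function.Surjective (pull z0 hr hσ) := fun ψ =>
  ⟨pull (-(r⁻¹ • z0.1), -(σ⁻¹ • z0.2)) (inv_ne_zero hr) (inv_ne_zero hσ) ψ, by
    ext u; rw [pull_apply, pull_apply, aff_aff' z0 hr hσ]⟩

lemma norm_pull (z0 : Pt n m) {r σ : ℝ} (hr : 0 < r) (hσ : 0 < σ) (φ : TestFn (Pt n m)) :
    ‖pull z0 hr.ne' hσ.ne' φ‖ = Real.sqrt ((r ^ n * σ ^ m)⁻¹) * ‖φ‖ := by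
  have : ‖pull z0 hr.ne' hσ.ne' φ‖ ^ 2 = (r ^ n * σ ^ m)⁻¹ * ‖φ‖ ^ 2 := by
    rw [norm_sq, norm_sq, ← integral_comp_aff z0 hr hσ fun z => φ z ^ 2]; rfl
  rw [← Real.sqrt_sq (norm_nonneg (pull z0 hr.ne' hσ.ne' φ)), this, Real.sqrt_mul (by positivity),
    Real.sqrt_sq (norm_nonneg _)]

lemma D_pull (z0 : Pt n m) {r σ : ℝ} (hr : r ≠ 0) (hσ : σ ≠ 0) (v : Pt n m) (φ : TestFn (Pt n m)) :
    D v (pull z0 hr hσ φ) = pull z0 hr hσ (D (r • v.1, σ • v.2) φ) := by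
  ext u
  rw [pull_apply, D_apply, D_apply]
  have e : HasFDerivAt (aff z0 r σ) ((r • ContinuousLinearMap.fst ℝ (Fin n → ℝ) (Fin m → ℝ)).prod
      (σ • ContinuousLinearMap.snd ℝ (Fin n → ℝ) (Fin m → ℝ))) u :=
    (((hasFDerivAt_fst).const_smul r).const_add z0.1).prodMk
      (((hasFDerivAt_snd).const_smul σ).const_add z0.2)
  have := ((φ.differentiable _).hasFDerivAt.comp u e).fderiv
  change fderiv ℝ (φ ∘ aff z0 r σ) u v = _
  rw [this]; simp

lemma D_smul_vec (c : ℝ) (v : Pt n m) (φ : TestFn (Pt n m)) : D (c • v) φ = c • D v φ := by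
  ext z; simp [D_apply]

/-- The scaling weight of a letter. -/
noncomputable def Letter.wt (r ρ σ : ℝ) : Letter n m → ℝ
  | .x _ => ρ⁻¹
  | .dx _ => r
  | .dy _ => σ

lemma nop_pull (z0 : Pt n m) {r ρ σ : ℝ} (hr : r ≠ 0) (hσ : σ ≠ 0)
    (l : Letter n m) (φ : TestFn (Pt n m)) :
    l.nop (r / ρ) (ρ⁻¹ • z0.1) (pull z0 hr hσ φ) = l.wt r ρ σ • pull z0 hr hσ (l.op φ) := by
  cases l with
  | x i =>
    ext u
    simp [Letter.nop, Letter.op, Letter.wt, pull_apply, aff]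
    field_simp; ring
  | dx i =>
    simp only [Letter.nop, Letter.op, Letter.wt, odx, D_pull]
    rw [← map_smul, ← D_smul_vec]; simp
  | dy k =>
    simp only [Letter.nop, Letter.op, Letter.wt, ody, D_pull]
    rw [← map_smul, ← D_smul_vec]; simp

lemma nwop_pull (z0 : Pt n m) {r ρ σ : ℝ} (hr : r ≠ 0) (hσ : σ ≠ 0)
    (w : List (Letter n m)) (φ : TestFn (Pt n m)) :
    nwop (r / ρ) (ρ⁻¹ • z0.1) w (pull z0 hr hσ φ) =
      (ρ⁻¹ ^ cx w * r ^ cdx w * σ ^ cdy w) • pull z0 hr hσ (wop w φ) := by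
  induction w with
  | nil => simp [nwop, wop, cx, cdx, cdy]
  | cons l w ih =>
    rw [nwop_cons, Module.End.mul_apply, ih, map_smul, nop_pull, smul_smul, wop_cons,
      Module.End.mul_apply]
    congr 1
    cases l <;> simp [cx, cdx, cdy, Letter.nx, Letter.ndx, Letter.ndy, Letter.wt] <;> ring

lemma nZ_pull (N : ℕ) (z0 : Pt n m) {r ρ : ℝ} (hr : r ≠ 0) (hρ : ρ ≠ 0) (i : ZIdx n m N)
    (φ : TestFn (Pt n m)) :
    nZ (r / ρ) (ρ⁻¹ • z0.1) N i (pull z0 hr (mul_ne_zero hr (pow_ne_zero N hρ)) φ) =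
      r • pull z0 hr (mul_ne_zero hr (pow_ne_zero N hρ)) (nZ 1 0 N i φ) := by
  rw [nZ, nwop_pull, nZ, nwop_one_zero]
  congr 1
  have h := count_zword i
  rw [h.2, mul_pow, ← pow_mul, inv_pow]
  have : ρ ^ (N * cdy (zword i)) ≠ 0 := pow_ne_zero _ hρ
  calc _ = r ^ (cdx (zword i) + cdy (zword i)) := by rw [pow_add]; field_simp
    _ = r := by rw [h.1, pow_one]

lemma ngr_pow_pull (N s : ℕ) (z0 : Pt n m) {r ρ : ℝ} (hr : r ≠ 0) (hρ : ρ ≠ 0)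
    (φ : TestFn (Pt n m)) :
    (ngr (r / ρ) (ρ⁻¹ • z0.1) m N ^ s) (pull z0 hr (mul_ne_zero hr (pow_ne_zero N hρ)) φ) =
      (r ^ 2) ^ s • pull z0 hr (mul_ne_zero hr (pow_ne_zero N hρ)) ((gr n m N ^ s) φ) := by
  induction s with
  | zero => simp
  | succ s ih =>
    have hz := fun i ψ => nZ_pull (m := m) N z0 hr hρ i ψ
    have hg : ∀ ψ : TestFn (Pt n m), ngr (r / ρ) (ρ⁻¹ • z0.1) m N
        (pull z0 hr (mul_ne_zero hr (pow_ne_zero N hρ)) ψ) =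
        r ^ 2 • pull z0 hr (mul_ne_zero hr (pow_ne_zero N hρ)) (gr n m N ψ) := by
      intro ψ
      rw [← ngr_one_zero]
      simp only [ngr, sqsum, LinearMap.neg_apply, LinearMap.sum_apply, pow_two (nZ _ _ _ _),
        Module.End.mul_apply, map_neg, map_sum, smul_neg, Finset.smul_sum]
      congr 1
      refine Finset.sum_congr rfl fun i _ => ?_
      rw [hz, map_smul, hz, smul_smul, pow_two]
    rw [pow_succ', Module.End.mul_apply, ih, map_smul, pow_succ (r ^ 2) s, mul_smul, hg,
      pow_succ' (gr n m N), Module.End.mul_apply]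

/-- The `L²` estimates in normalized coordinates. -/
theorem norm_nwop_le (N : ℕ) (hn : 1 ≤ n) (hm : 1 ≤ m) (hN : 1 ≤ N) (s : ℕ)
    (w : List (Letter n m)) (h1 : cdx w + (N + 1) * cdy w = 2 * s + cx w)
    (h2 : cx w + N * cdx w ≤ 2 * N * s) :
    ∃ C ≥ (0 : ℝ), ∀ (t : ℝ) (ξ : Fin n → ℝ), 0 < t → ∀ φ,
      t ^ (N * cdy w) * ‖nwop t ξ w φ‖ ≤ C * t ^ cx w * ‖(ngr t ξ m N ^ s) φ‖ := by
  obtain ⟨C, hC, h⟩ := Grusin.norm_wop_le N hn hm hN s w h1 h2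
  refine ⟨C, hC, fun t ξ ht φ => ?_⟩
  have ht0 := ht.ne'
  obtain ⟨φ, rfl⟩ := pull_surjective (ξ, 0) ht0 (mul_ne_zero ht0 (pow_ne_zero N one_ne_zero)) φ
  have e1 := nwop_pull (ρ := 1) (ξ, (0 : Fin m → ℝ)) ht0
    (mul_ne_zero ht0 (pow_ne_zero N one_ne_zero)) w φ
  have e2 := ngr_pow_pull N s (ρ := 1) (ξ, (0 : Fin m → ℝ)) ht0 one_ne_zero φ
  simp only [div_one, inv_one, one_smul] at e1 e2
  rw [e1, e2, norm_smul, norm_smul, norm_pull _ ht (by positivity), norm_pull _ ht (by positivity)]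
  simp only [one_pow, mul_one, one_mul]
  rw [Real.norm_of_nonneg (by positivity), Real.norm_of_nonneg (by positivity)]
  set J := Real.sqrt ((t ^ n * t ^ m)⁻¹)
  have e3 : t ^ (N * cdy w) * (t ^ cdx w * t ^ cdy w) = t ^ cx w * (t ^ 2) ^ s := by
    rw [← pow_add, ← pow_add, ← pow_mul, ← pow_add]; congr 1; linarith
  calc _ = (t ^ (N * cdy w) * (t ^ cdx w * t ^ cdy w)) * (J * ‖wop w φ‖) := by ring
    _ ≤ (t ^ cx w * (t ^ 2) ^ s) * (J * (C * ‖(gr n m N ^ s) φ‖)) := by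
        rw [e3]; gcongr; exact h φ
    _ = _ := by ring

end Grusin

lemma enorm_le_lmarginal {F : Type*} {d : ℕ} (ev : F → (Fin d → ℝ) → ℝ) (𝒟 : Fin d → F → F)
    (hm : ∀ f, Measurable (ev f))
    (h : ∀ i f x, ‖ev f x‖ₑ ≤ ∫⁻ t, ‖ev (𝒟 i f) (Function.update x i t)‖ₑ)
    (l : List (Fin d)) (hl : l.Nodup) (f : F) (x : Fin d → ℝ) :
    ‖ev f x‖ₑ ≤ lmarginal (fun _ => volume) l.toFinset (fun x => ‖ev (l.foldr 𝒟 f) x‖ₑ) x := by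
  induction l generalizing x with
  | nil => simp
  | cons i l ih =>
    rw [List.nodup_cons] at hl
    rw [List.toFinset_cons, List.foldr_cons, lmarginal_insert' _ (hm _).enorm (by simpa using hl.1)]
    exact (ih hl.2 x).trans (lmarginal_mono (fun x => h i _ x) x)

namespace TestFn

variable {E : Type*} [NormedAddCommGroup E] [NormedSpace ℝ E]

lemma enorm_le_lintegral_line (φ : TestFn E) (z v : E) (hv : v ≠ 0) (t0 : ℝ) :
    ‖φ (z + t0 • v)‖ₑ ≤ ∫⁻ t : ℝ, ‖D v φ (z + t • v)‖ₑ := by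
  have hc : HasCompactSupport fun t : ℝ => φ (z + t • v) :=
    φ.compact.comp_isClosedEmbedding
      ((Homeomorph.addLeft z).isClosedEmbedding.comp (isClosedEmbedding_smul_left (𝕜 := ℝ) hv))
  have hs : ContDiff ℝ 1 fun t : ℝ => φ (z + t • v) :=
    (φ.smooth.of_le (by exact_mod_cast le_top)).comp (by fun_prop)
  refine (hc.enorm_le_lintegral_Ici_deriv hs t0).trans ((setLIntegral_le_lintegral _ _).trans
    (lintegral_mono fun t => le_of_eq ?_))
  congr 1
  have e : HasDerivAt (fun t : ℝ => z + t • v) v t := by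
    simpa using ((hasDerivAt_id t).smul_const v).const_add z
  exact ((φ.differentiable _).hasFDerivAt.comp_hasDerivAt t e).deriv

end TestFn

namespace Grusin

open TestFn

variable {n m : ℕ}

/-- The word of all the `∂_{x_i}`. -/
def dxs (n m : ℕ) : List (Letter n m) := (List.finRange n).map .dx
/-- The word of all the `∂_{y_k}`. -/
def dys (n m : ℕ) : List (Letter n m) := (List.finRange m).map .dy

lemma count_dxs : cx (dxs n m) = 0 ∧ cdx (dxs n m) = n ∧ cdy (dxs n m) = 0 := by
  simp [dxs, cx, cdx, cdy, Letter.nx, Letter.ndx, Letter.ndy, Function.comp_def]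

lemma count_dys : cx (dys n m) = 0 ∧ cdx (dys n m) = 0 ∧ cdy (dys n m) = m := by
  simp [dys, cx, cdx, cdy, Letter.nx, Letter.ndx, Letter.ndy, Function.comp_def]

lemma nwop_map_dx (t : ℝ) (ξ : Fin n → ℝ) (l : List (Fin n)) (φ : TestFn (Pt n m)) :
    nwop t ξ (l.map Letter.dx) φ = l.foldr (fun i f => odx i f) φ := by
  induction l with
  | nil => rfl
  | cons i l ih => rw [List.map_cons, nwop_cons, Module.End.mul_apply, ih]; rfl

lemma nwop_map_dy (t : ℝ) (ξ : Fin n → ℝ) (l : List (Fin m)) (φ : TestFn (Pt n m)) :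
    nwop t ξ (l.map Letter.dy) φ = l.foldr (fun i f => ody i f) φ := by
  induction l with
  | nil => rfl
  | cons i l ih => rw [List.map_cons, nwop_cons, Module.End.mul_apply, ih]; rfl

lemma enorm_le_lintegral_nwop (t : ℝ) (ξ : Fin n → ℝ) (φ : TestFn (Pt n m)) (z : Pt n m) :
    ‖φ z‖ₑ ≤ ∫⁻ u, ‖nwop t ξ (dys n m ++ dxs n m) φ u‖ₑ := by
  have hx : ∀ (φ : TestFn (Pt n m)) (x y), ‖φ (x, y)‖ₑ ≤
      ∫⁻ x', ‖nwop t ξ (dxs n m) φ (x', y)‖ₑ := by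
    intro φ x y
    have := enorm_le_lmarginal (F := TestFn (Pt n m)) (fun f x => f (x, y)) (fun i f => odx i f)
      (fun f => (f.continuous.comp (by fun_prop)).measurable) (fun i f x => ?_)
      (List.finRange n) (List.nodup_finRange n) φ x
    · rw [List.toFinset_finRange, lmarginal_univ] at this
      rw [dxs, nwop_map_dx]; exact this
    · have hv : ((Pi.single i 1, 0) : Pt n m) ≠ 0 := by
        intro h; have := congrFun (congrArg Prod.fst h) i; simp at this
      have e : ∀ s : ℝ, ((Function.update x i s, y) : Pt n m) =
          (Function.update x i 0, y) + s • ((Pi.single i 1, 0) : Pt n m) := by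
        intro s; ext j
        · by_cases hj : j = i
          · subst hj; simp
          · simp [hj]
        · simp
      have := enorm_le_lintegral_line (E := Pt n m) f (Function.update x i 0, y) _ hv (x i)
      rw [← e] at this
      simp only [← e, Function.update_eq_self] at this
      exact this
  have hy : ∀ (φ : TestFn (Pt n m)) (x y), ‖φ (x, y)‖ₑ ≤
      ∫⁻ y', ‖nwop t ξ (dys n m) φ (x, y')‖ₑ := by
    intro φ x y
    have := enorm_le_lmarginal (F := TestFn (Pt n m)) (fun f y => f (x, y)) (fun i f => ody i f)
      (fun f => (f.continuous.comp (by fun_prop)).measurable) (fun i f y => ?_)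
      (List.finRange m) (List.nodup_finRange m) φ y
    · rw [List.toFinset_finRange, lmarginal_univ] at this
      rw [dys, nwop_map_dy]; exact this
    · have hv : ((0, Pi.single i 1) : Pt n m) ≠ 0 := by
        intro h; have := congrFun (congrArg Prod.snd h) i; simp at this
      have e : ∀ s : ℝ, ((x, Function.update y i s) : Pt n m) =
          (x, Function.update y i 0) + s • ((0, Pi.single i 1) : Pt n m) := by
        intro s; ext j
        · simp
        · by_cases hj : j = i
          · subst hj; simp
          · simp [hj]
      have := enorm_le_lintegral_line (E := Pt n m) f (x, Function.update y i 0) _ hv (y i)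
      rw [← e] at this
      simp only [← e, Function.update_eq_self] at this
      exact this
  calc ‖φ z‖ₑ ≤ ∫⁻ x', ‖nwop t ξ (dxs n m) φ (x', z.2)‖ₑ := hx φ z.1 z.2
    _ ≤ ∫⁻ x', ∫⁻ y', ‖nwop t ξ (dys n m) (nwop t ξ (dxs n m) φ) (x', y')‖ₑ :=
        lintegral_mono fun x' => hy _ _ _
    _ = ∫⁻ u, ‖nwop t ξ (dys n m ++ dxs n m) φ u‖ₑ := by
        rw [nwop_append, Module.End.mul_apply]
        exact (lintegral_prod (μ := (volume : Measure (Fin n → ℝ))) (ν := volume)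
          (fun u : Pt n m => ‖nwop t ξ (dys n m) (nwop t ξ (dxs n m) φ) u‖ₑ)
          (TestFn.continuous _).measurable.enorm.aemeasurable).symm

/-- The support is in the unit ball. -/
def Supp1 (φ : TestFn (Pt n m)) : Prop := tsupport φ ⊆ Metric.closedBall 0 1

lemma Supp1.eq_zero {φ : TestFn (Pt n m)} (h : Supp1 φ) {z} (hz : 1 < ‖z‖) : φ z = 0 :=
  image_eq_zero_of_notMem_tsupport fun h' => absurd (h h') (by simpa using hz)

lemma tsupport_D (v : Pt n m) (φ : TestFn (Pt n m)) : tsupport (D v φ) ⊆ tsupport φ :=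
  (closure_mono fun x hx => by
    rw [Function.mem_support, D_apply] at *
    intro h; rw [h] at hx; simp at hx).trans (tsupport_fderiv_subset ℝ (f := φ))

lemma Supp1.nop {φ : TestFn (Pt n m)} (h : Supp1 φ) (t ξ) (l : Letter n m) :
    Supp1 (l.nop t ξ φ) := by
  cases l with
  | x i => exact (closure_mono fun x hx => by
      rw [Function.mem_support] at *; rw [Letter.nop, na_apply] at hx
      exact right_ne_zero_of_mul hx).trans h
  | dx i => exact (tsupport_D _ _).trans h
  | dy i => exact (tsupport_D _ _).trans h

lemma Supp1.nwop {φ : TestFn (Pt n m)} (h : Supp1 φ) (t ξ) (w : List (Letter n m)) :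
    Supp1 (nwop t ξ w φ) := by
  induction w with
  | nil => exact h
  | cons l w ih => rw [nwop_cons]; exact ih.nop t ξ l

lemma Supp1.norm_le {φ : TestFn (Pt n m)} (h : Supp1 φ) (i : Fin n) : ‖φ‖ ≤ 2 * ‖odx i φ‖ := by
  have e : odx i (ox i φ) = ox i (odx i φ) + φ := by
    ext z
    rw [odx, ox, D_M, coe_add, Pi.add_apply, M_apply]
    have : HasFDerivAt (fun z : Pt n m => z.1 i) ((ContinuousLinearMap.proj i).comp
      (ContinuousLinearMap.fst ℝ (Fin n → ℝ) (Fin m → ℝ))) z :=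
      ((ContinuousLinearMap.proj (R := ℝ) (φ := fun _ : Fin n => ℝ) i).comp
      (ContinuousLinearMap.fst ℝ (Fin n → ℝ) (Fin m → ℝ))).hasFDerivAt
    rw [this.fderiv]; simp
  have h1 : ‖φ‖ ^ 2 = -2 * inner ℝ (ox i φ) (odx i φ) := by
    have a1 : inner ℝ (odx i (ox i φ)) φ = - inner ℝ (ox i φ) (odx i φ) := D_anti _ _ _
    have a2 : inner ℝ (ox i (odx i φ)) φ = inner ℝ (odx i φ) (ox i φ) := M_symm _ _ _ _
    rw [e, inner_add_left, a2, real_inner_comm, real_inner_self_eq_norm_sq] at a1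
    linarith
  have h2 : ‖ox i φ‖ ≤ ‖φ‖ := by
    have := norm_le_of_abs_le {()} (ox i φ) (fun _ => φ) fun z => ?_
    · simpa using this
    · rw [Finset.sum_singleton, ox_apply, abs_mul]
      rcases le_or_gt ‖z‖ 1 with hz | hz
      · refine mul_le_of_le_one_left (abs_nonneg _) ?_
        exact (norm_le_pi_norm z.1 i).trans ((norm_fst_le z).trans hz)
      · rw [h.eq_zero hz]; simp
  have h3 := abs_real_inner_le_norm (ox i φ) (odx i φ)
  have h4 : ‖φ‖ ^ 2 ≤ 2 * (‖φ‖ * ‖odx i φ‖) := by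
    rw [h1]
    have := neg_le_of_abs_le h3
    have : ‖ox i φ‖ * ‖odx i φ‖ ≤ ‖φ‖ * ‖odx i φ‖ := by gcongr
    linarith
  rcases (norm_nonneg φ).eq_or_lt with h0 | h0
  · rw [← h0]; positivity
  · nlinarith

lemma Supp1.norm_le_pow {φ : TestFn (Pt n m)} (h : Supp1 φ) (t ξ) (i : Fin n) (p : ℕ) :
    ‖φ‖ ≤ 2 ^ p * ‖Grusin.nwop t ξ (List.replicate p (.dx i)) φ‖ := by
  induction p with
  | zero => simp [nwop_nil]
  | succ p ih =>
    rw [List.replicate_succ, nwop_cons, Module.End.mul_apply, pow_succ, mul_assoc]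
    refine ih.trans ?_
    gcongr
    exact (h.nwop t ξ _).norm_le i

lemma exists_enorm_le (n m : ℕ) : ∃ C ≥ (0 : ℝ), ∀ (t : ℝ) (ξ : Fin n → ℝ) (φ : TestFn (Pt n m)),
    Supp1 φ → ∀ z, |φ z| ≤ C * ‖nwop t ξ (dys n m ++ dxs n m) φ‖ := by
  set V : ℝ≥0∞ := (volume (Metric.closedBall (0 : Pt n m) 1)) ^ (1 / 2 : ℝ)
  have hV : V ≠ ⊤ := ENNReal.rpow_ne_top_of_nonneg (by norm_num)
    (isCompact_closedBall _ _).measure_lt_top.ne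
  refine ⟨V.toReal, ENNReal.toReal_nonneg, fun t ξ φ hφ z => ?_⟩
  have h1 := enorm_le_lintegral_nwop t ξ φ z
  have h2 := hφ.nwop t ξ (dys n m ++ dxs n m)
  set ψ := nwop t ξ (dys n m ++ dxs n m) φ
  have h3 : ∫⁻ u, ‖ψ u‖ₑ ≤ ENNReal.ofReal ‖ψ‖ * V := by
    have e : ∫⁻ u, ‖ψ u‖ₑ = ∫⁻ u in Metric.closedBall 0 1, ‖ψ u‖ₑ :=
      (setLIntegral_eq_of_support_subset fun u hu => h2 (subset_closure (by
        simpa using hu))).symm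
    rw [e, ← eLpNorm_one_eq_lintegral_enorm]
    refine (eLpNorm_le_eLpNorm_mul_rpow_measure_univ one_le_two
      ψ.continuous.aestronglyMeasurable).trans ?_
    rw [Measure.restrict_apply_univ, ← eLpNorm_eq]
    have : 1 / (1 : ℝ≥0∞).toReal - 1 / (2 : ℝ≥0∞).toReal = 1 / 2 := by norm_num
    rw [this]
    gcongr
    exact Measure.restrict_le_self
  have h4 := h1.trans h3
  rw [← ENNReal.ofReal_toReal hV, ← ENNReal.ofReal_mul (norm_nonneg _),
    Real.enorm_eq_ofReal_abs, ENNReal.ofReal_le_ofReal_iff (by positivity)] at h4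
  rw [mul_comm]; exact h4

end Grusin

lemma Set.Finite.exists_uniform_bound {α : Type*} {S : Set α} (hS : S.Finite) (P : α → ℝ → Prop)
    (hP : ∀ a C C', C ≤ C' → P a C → P a C') (h : ∀ a ∈ S, ∃ C ≥ (0 : ℝ), P a C) :
    ∃ C ≥ (0 : ℝ), ∀ a ∈ S, P a C := by
  classical
  choose! C hC0 hC using h
  refine ⟨∑ a ∈ hS.toFinset, |C a|, by positivity, fun a ha => ?_⟩
  refine hP a (C a) _ ((le_abs_self _).trans ?_) (hC a ha)
  exact Finset.single_le_sum (f := fun a => |C a|) (fun _ _ => abs_nonneg _) (hS.mem_toFinset.mpr ha)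

namespace Grusin

open TestFn

variable {n m : ℕ}

lemma exists_abs_nwop_le (w : List (Letter n m)) (g : TestFn (Pt n m)) : ∃ C ≥ (0 : ℝ),
    ∀ (t : ℝ) (ξ : Fin n → ℝ), 0 ≤ t → t ≤ 1 → ‖ξ‖ ≤ 1 → ∀ z, |nwop t ξ w g z| ≤ C := by
  induction w using List.reverseRecOn generalizing g with
  | nil =>
    obtain ⟨C, hC⟩ := g.compact.exists_bound_of_continuous g.continuous
    exact ⟨|C|, abs_nonneg _, fun t ξ _ _ _ z => (hC z).trans (le_abs_self _)⟩
  | append_singleton u l ih =>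
    cases l with
    | x i =>
      obtain ⟨C1, h1, hb1⟩ := ih (ox i g)
      obtain ⟨C2, h2, hb2⟩ := ih g
      refine ⟨C1 + C2, by positivity, fun t ξ ht0 ht1 hξ z => ?_⟩
      have e : (na t ξ i g : TestFn (Pt n m)) = t • ox i g + ξ i • g := by
        ext z; simp; ring
      have e2 : nwop t ξ (u ++ [.x i]) g = t • nwop t ξ u (ox i g) + ξ i • nwop t ξ u g := by
        rw [nwop_append, Module.End.mul_apply, nwop_cons, nwop_nil, mul_one, Letter.nop, e,
          map_add, map_smul, map_smul]
      rw [e2]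
      simp only [coe_add, coe_smul, Pi.add_apply, Pi.smul_apply, smul_eq_mul]
      refine (abs_add_le _ _).trans (add_le_add ?_ ?_)
      · rw [abs_mul, abs_of_nonneg ht0]
        exact (mul_le_of_le_one_left (abs_nonneg _) ht1).trans (hb1 t ξ ht0 ht1 hξ z)
      · rw [abs_mul]
        exact (mul_le_of_le_one_left (abs_nonneg _) ((norm_le_pi_norm ξ i).trans hξ)).trans
          (hb2 t ξ ht0 ht1 hξ z)
    | dx i =>
      obtain ⟨C, h1, hb⟩ := ih (odx i g)
      refine ⟨C, h1, fun t ξ ht0 ht1 hξ z => ?_⟩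
      rw [nwop_append, Module.End.mul_apply, nwop_cons, nwop_nil, mul_one]
      exact hb t ξ ht0 ht1 hξ z
    | dy i =>
      obtain ⟨C, h1, hb⟩ := ih (ody i g)
      refine ⟨C, h1, fun t ξ ht0 ht1 hξ z => ?_⟩
      rw [nwop_append, Module.End.mul_apply, nwop_cons, nwop_nil, mul_one]
      exact hb t ξ ht0 ht1 hξ z

lemma count_replicate_dx (p : ℕ) (i : Fin n) : cx (List.replicate p (.dx i : Letter n m)) = 0 ∧
    cdx (List.replicate p (.dx i : Letter n m)) = p ∧
    cdy (List.replicate p (.dx i : Letter n m)) = 0 := by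
  simp [cx, cdx, cdy, Letter.nx, Letter.ndx, Letter.ndy]

lemma count_replicate_x (p : ℕ) (i : Fin n) : cx (List.replicate p (.x i : Letter n m)) = p ∧
    cdx (List.replicate p (.x i : Letter n m)) = 0 ∧
    cdy (List.replicate p (.x i : Letter n m)) = 0 := by
  simp [cx, cdx, cdy, Letter.nx, Letter.ndx, Letter.ndy]

lemma norm_le_three_pow {φ : TestFn (Pt n m)} (h : Supp1 φ) (t : ℝ) (ξ : Fin n → ℝ) (ht : 0 < t)
    (ht' : t ≤ 1 / 3) (i : Fin n) (hξ : 2 / 3 ≤ |ξ i|) (a : ℕ) :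
    ‖φ‖ ≤ 3 ^ a * ‖nwop t ξ (List.replicate a (.x i)) φ‖ := by
  refine norm_le_mul_of_abs_le _ _ (by positivity) fun z => ?_
  have e : List.replicate a (Letter.x i : Letter n m) = (List.replicate a i).map .x := by simp
  rw [e, nwop_ofFn_x_apply, List.map_replicate, List.prod_replicate, abs_mul, ← mul_assoc, abs_pow,
    ← mul_pow]
  rcases le_or_gt ‖z‖ 1 with hz | hz
  · refine le_mul_of_one_le_left (abs_nonneg _) (one_le_pow₀ ?_)
    have h1 : |z.1 i| ≤ 1 := (norm_le_pi_norm z.1 i).trans ((norm_fst_le z).trans hz)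
    have h2 : |t * z.1 i| ≤ 1 / 3 := by
      rw [abs_mul, abs_of_pos ht]; nlinarith [abs_nonneg (z.1 i)]
    have h3 : |ξ i| ≤ |t * z.1 i + ξ i| + |t * z.1 i| := by
      have := abs_sub (t * z.1 i + ξ i) (t * z.1 i)
      simpa using this
    linarith
  · rw [h.eq_zero hz]; simp

/-- Derivatives are controlled by the power of the operator for functions supported in the unit
ball. -/
lemma exists_norm_nwop_le (N : ℕ) (hn : 1 ≤ n) (hm : 1 ≤ m) (hN : 1 ≤ N) (s : ℕ)
    (w : List (Letter n m)) (h0 : cx w = 0) (h1 : cdx w + (N + 1) * cdy w ≤ 2 * s) :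
    ∃ C ≥ (0 : ℝ), ∀ (t : ℝ) (ξ : Fin n → ℝ), 0 < t → t + ‖ξ‖ = 1 → ∀ φ : TestFn (Pt n m), Supp1 φ →
      ‖nwop t ξ w φ‖ ≤ C * ‖(ngr t ξ m N ^ s) φ‖ := by
  have : Nonempty (Fin n) := ⟨⟨0, hn⟩⟩
  obtain ⟨p, hp⟩ := Nat.exists_eq_add_of_le h1
  have i0 : Fin n := ⟨0, hn⟩
  have hr := count_replicate_dx (n := n) (m := m)
  have hrx := count_replicate_x (n := n) (m := m)
  obtain ⟨C1, hC1, hb1⟩ := norm_nwop_le N hn hm hN s (List.replicate p (.dx i0) ++ w)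
    (by rw [cx_append, cdx_append, cdy_append, (hr p i0).1, (hr p i0).2.1, (hr p i0).2.2]; linarith)
    (by
      rw [cx_append, cdx_append, (hr p i0).1, (hr p i0).2.1, h0, mul_assoc 2 N s]
      nlinarith [Nat.zero_le ((N + 1) * cdy w)])
  have hx : ∀ i : Fin n, ∃ C ≥ (0 : ℝ), ∀ (t : ℝ) (ξ : Fin n → ℝ), 0 < t → ∀ φ : TestFn (Pt n m),
      t ^ (N * cdy w) * ‖nwop t ξ (List.replicate (p + N * cdy w) (.dx i) ++
        (List.replicate (N * cdy w) (.x i) ++ w)) φ‖ ≤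
        C * t ^ (N * cdy w) * ‖(ngr t ξ m N ^ s) φ‖ := by
    intro i
    obtain ⟨C, hC, hb⟩ := norm_nwop_le N hn hm hN s (List.replicate (p + N * cdy w) (.dx i) ++
        (List.replicate (N * cdy w) (.x i) ++ w))
      (by
        simp only [cx_append, cdx_append, cdy_append, (hr _ i).1, (hr _ i).2.1, (hr _ i).2.2,
          (hrx _ i).1, (hrx _ i).2.1, (hrx _ i).2.2, h0]
        linarith)
      (by
        simp only [cx_append, cdx_append, (hr _ i).1, (hr _ i).2.1,
          (hrx _ i).1, (hrx _ i).2.1, h0]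
        rw [mul_comm 2 N, mul_assoc, hp]; apply le_of_eq; ring)
    refine ⟨C, hC, fun t ξ ht φ => ?_⟩
    have := hb t ξ ht φ
    simpa only [cx_append, cdx_append, cdy_append, (hr _ i).1, (hr _ i).2.1, (hr _ i).2.2,
          (hrx _ i).1, (hrx _ i).2.1, (hrx _ i).2.2, h0, zero_add, add_zero] using this
  choose Cx hCx hbx using hx
  set C2 : ℝ := ∑ i, Cx i
  have hC2 : 0 ≤ C2 := Finset.sum_nonneg fun i _ => hCx i
  have hle : ∀ i, Cx i ≤ C2 := fun i =>
    Finset.single_le_sum (f := Cx) (fun i _ => hCx i) (Finset.mem_univ i)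
  refine ⟨2 ^ p * 3 ^ (N * cdy w) * C1 + 3 ^ (N * cdy w) * 2 ^ (p + N * cdy w) * C2, by positivity,
    fun t ξ ht htξ φ hφ => ?_⟩
  rw [add_mul]
  rcases le_or_gt t (1 / 3) with ht3 | ht3
  · obtain ⟨i, hi⟩ : ∃ i, 2 / 3 ≤ |ξ i| := by
      by_contra! h
      have : ‖ξ‖ < 2 / 3 := (pi_norm_lt_iff (by norm_num)).mpr h
      linarith
    have e1 := norm_le_three_pow (hφ.nwop t ξ w) t ξ ht ht3 i hi (N * cdy w)
    have e2 := ((hφ.nwop t ξ w).nwop t ξ (List.replicate (N * cdy w) (.x i))).norm_le_pow t ξ i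
      (p + N * cdy w)
    have e3 := hbx i t ξ ht φ
    rw [mul_comm (Cx i), mul_assoc] at e3
    have e4 := le_of_mul_le_mul_left e3 (by positivity)
    rw [nwop_append, nwop_append, Module.End.mul_apply, Module.End.mul_apply] at e4
    refine le_add_of_nonneg_of_le (by positivity) ?_
    calc _ ≤ _ := e1
      _ ≤ 3 ^ (N * cdy w) * (2 ^ (p + N * cdy w) * (C2 * ‖(ngr t ξ m N ^ s) φ‖)) := by
          gcongr; exact e2.trans (by gcongr; exact e4.trans (by gcongr; exact hle i))
      _ = _ := by ring
  · have e2 := (hφ.nwop t ξ w).norm_le_pow t ξ i0 p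
    have e3 := hb1 t ξ ht φ
    rw [cx_append, cdy_append, (hr p i0).1, (hr p i0).2.2, h0, nwop_append,
      Module.End.mul_apply] at e3
    simp only [zero_add, pow_zero, mul_one] at e3
    refine le_add_of_le_of_nonneg ?_ (by positivity)
    have e5 : 1 ≤ 3 ^ (N * cdy w) * t ^ (N * cdy w) := by
      rw [← mul_pow]; exact one_le_pow₀ (by linarith)
    set Q := ‖nwop t ξ (List.replicate p (.dx i0)) (nwop t ξ w φ)‖
    calc _ ≤ _ := e2
      _ ≤ 2 ^ p * ((3 ^ (N * cdy w) * t ^ (N * cdy w)) * Q) := by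
          gcongr; exact le_mul_of_one_le_left (norm_nonneg _) e5
      _ = 2 ^ p * (3 ^ (N * cdy w) * (t ^ (N * cdy w) * Q)) := by ring
      _ ≤ 2 ^ p * (3 ^ (N * cdy w) * (C1 * ‖(ngr t ξ m N ^ s) φ‖)) := by gcongr
      _ = _ := by ring

/-- Uniform localized a priori estimate in normalized coordinates. -/
lemma exists_norm_ngr_pow_cutoff_le (N : ℕ) (hn : 1 ≤ n) (hm : 1 ≤ m) (hN : 1 ≤ N) (s : ℕ)
    (hs : 1 ≤ s) (θ : TestFn (Pt n m)) (hθ0 : ∀ z, 0 ≤ θ z) (hθ1 : ∀ z, θ z ≤ 1) :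
    ∃ C ≥ (0 : ℝ), ∀ (t : ℝ) (ξ : Fin n → ℝ), 0 < t → t ≤ 1 → ‖ξ‖ ≤ 1 → ∀ w : TestFn (Pt n m),
      ‖(ngr t ξ m N ^ s) (tpow θ (2 * s) * w)‖ ≤
        C * (‖θ * w‖ + ‖tpow θ (2 * s) * (ngr t ξ m N ^ s) w‖) := by
  have : Nonempty (Fin n) := ⟨⟨0, hn⟩⟩
  obtain ⟨A, hA, hbA⟩ := (List.finite_length_eq (ZIdx n m N) (2 * s)).exists_uniform_bound
    (fun β C => ∀ (t : ℝ) (ξ : Fin n → ℝ), 0 < t → ∀ φ : TestFn (Pt n m),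
      ‖zw (nZ t ξ N) β φ‖ ≤ C * ‖(ngr t ξ m N ^ s) φ‖)
    (fun i C C' hCC h t ξ ht φ => (h t ξ ht φ).trans (by gcongr)) (by
      intro β hβ
      have hβ : β.length = 2 * s := hβ
      have hc := count_flatMap_zword β
      obtain ⟨C, hC, hb⟩ := norm_nwop_le N hn hm hN s (β.flatMap zword)
        (by rw [hc.2]; linarith [hc.1]) (by rw [hc.2, mul_comm 2 N, mul_assoc, ← hβ, ← hc.1]
                                            apply le_of_eq; ring)
      refine ⟨C, hC, fun t ξ ht φ => ?_⟩
      have := hb t ξ ht φ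
      rw [hc.2, mul_comm C, mul_assoc] at this
      rw [zw_nZ]
      exact le_of_mul_le_mul_left this (by positivity))
  obtain ⟨K, hK, hbK⟩ := (List.finite_length_le (ZIdx n m N) (2 * s)).exists_uniform_bound
    (fun β C => ∀ (t : ℝ) (ξ : Fin n → ℝ), 0 ≤ t → t ≤ 1 → ‖ξ‖ ≤ 1 → ∀ z,
      |zw (nZ t ξ N) β θ z| ≤ C)
    (fun i C C' hCC h t ξ ht ht1 hξ z => (h t ξ ht ht1 hξ z).trans hCC) (by
      intro β _
      obtain ⟨C, hC, hb⟩ := exists_abs_nwop_le (β.flatMap zword) θ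
      refine ⟨C, hC, fun t ξ => ?_⟩
      rw [zw_nZ]; exact hb t ξ)
  obtain ⟨C, hC, h⟩ := exists_norm_sqsum_pow_cutoff_le (E := Pt n m) (ZIdx n m N) s hs A K hA hK
  exact ⟨C, hC, fun t ξ ht ht1 hξ w => h (nZ t ξ N) (nZ_leibniz t ξ N) (nZ_anti t ξ N)
    (fun β hβ f => hbA β hβ t ξ ht f) θ hθ0 hθ1 (fun γ hγ z => hbK γ hγ t ξ ht.le ht1 hξ z) w⟩

lemma fderiv_eq_sum (φ : TestFn (Pt n m)) (z v : Pt n m) :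
    fderiv ℝ φ z v = ∑ i, v.1 i * odx i φ z + ∑ k, v.2 k * ody k φ z := by
  have e : v = ∑ i, v.1 i • ((Pi.single i 1, 0) : Pt n m) +
      ∑ k, v.2 k • ((0, Pi.single k 1) : Pt n m) := by
    ext j
    · simp [Prod.fst_sum, Finset.sum_apply, Pi.single_apply]
    · simp [Prod.snd_sum, Finset.sum_apply, Pi.single_apply]
  conv_lhs => rw [e]
  simp only [map_add, map_sum, map_smul, smul_eq_mul]
  rfl

lemma abs_sub_le_of_deriv_le (φ : TestFn (Pt n m)) (L : ℝ) (hL : 0 ≤ L)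
    (hx : ∀ i z, |odx i φ z| ≤ L) (hy : ∀ k z, |ody k φ z| ≤ L) (z z' : Pt n m) :
    |φ z - φ z'| ≤ (n + m) * L * ‖z - z'‖ := by
  refine convex_univ.norm_image_sub_le_of_norm_fderiv_le (𝕜 := ℝ)
    (fun x _ => φ.differentiable x) (fun x _ => ?_) trivial trivial
  refine ContinuousLinearMap.opNorm_le_bound _ (by positivity) fun v => ?_
  rw [fderiv_eq_sum, Real.norm_eq_abs]
  refine (abs_add_le _ _).trans ?_
  have h1 : |∑ i, v.1 i * odx i φ x| ≤ ∑ i : Fin n, L * ‖v‖ := by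
    refine (Finset.abs_sum_le_sum_abs _ _).trans (Finset.sum_le_sum fun i _ => ?_)
    rw [abs_mul, mul_comm]
    exact mul_le_mul (hx i x) ((norm_le_pi_norm v.1 i).trans (norm_fst_le v)) (abs_nonneg _) hL
  have h2 : |∑ i, v.2 i * ody i φ x| ≤ ∑ i : Fin m, L * ‖v‖ := by
    refine (Finset.abs_sum_le_sum_abs _ _).trans (Finset.sum_le_sum fun i _ => ?_)
    rw [abs_mul, mul_comm]
    exact mul_le_mul (hy i x) ((norm_le_pi_norm v.2 i).trans (norm_snd_le v)) (abs_nonneg _) hL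
  simp at h1 h2
  linarith

/-- The interior regularity estimate for smooth functions in normalized coordinates. -/
theorem exists_abs_integral_mul_le (N : ℕ) (hn : 1 ≤ n) (hm : 1 ≤ m) (hN : 1 ≤ N) (s : ℕ)
    (hs : n + 1 + (N + 1) * (m + 1) ≤ 2 * s) (θ : TestFn (Pt n m)) (hθ0 : ∀ z, 0 ≤ θ z)
    (hθ1 : ∀ z, θ z ≤ 1) (hθ : Supp1 θ) (η0 : ℝ) (hη0 : ∀ z, ‖z‖ ≤ η0 → θ z = 1) :
    ∃ C ≥ (0 : ℝ), ∀ (t : ℝ) (ξ : Fin n → ℝ), 0 < t → t + ‖ξ‖ = 1 → ∀ w : TestFn (Pt n m),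
      ∀ η ≤ η0, ∀ b : Pt n m → ℝ, Integrable b → (∀ z, η < ‖z‖ → b z = 0) → ∫ z, b z = 0 →
      |∫ z, w z * b z| ≤ C * η * (‖w‖ + ‖tpow θ (2 * s) * (ngr t ξ m N ^ s) w‖) * ∫ z, |b z| := by
  obtain ⟨CS, hCS, hS⟩ := exists_enorm_le n m
  obtain ⟨CL, hCL, hLoc⟩ := exists_norm_ngr_pow_cutoff_le N hn hm hN s (by omega) θ hθ0 hθ1
  have hdx := count_dxs (n := n) (m := m)
  have hdy := count_dys (n := n) (m := m)
  have hd : ∀ l : Letter n m, l.nx = 0 → ∃ C ≥ (0 : ℝ), ∀ (t : ℝ) (ξ : Fin n → ℝ), 0 < t →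
      t + ‖ξ‖ = 1 → ∀ φ : TestFn (Pt n m), Supp1 φ →
      ‖nwop t ξ (dys n m ++ dxs n m ++ [l]) φ‖ ≤ C * ‖(ngr t ξ m N ^ s) φ‖ := by
    intro l hl
    refine exists_norm_nwop_le N hn hm hN s _ ?_ ?_
    · simp [cx, hl]
      have := hdx.1; have := hdy.1; simp_all [cx]
    · simp only [cdx_append, cdy_append, hdx.2, hdy.2]
      have : (N + 1) * (m + 1) = (N + 1) * m + (N + 1) := by ring
      cases l <;> simp_all [cdx, cdy, Letter.ndx, Letter.ndy, Letter.nx] <;> nlinarith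
  choose! Cd hCd hbd using hd
  set C1 : ℝ := ∑ i : Fin n, Cd (.dx i)
  have hC1 : 0 ≤ C1 := Finset.sum_nonneg fun i _ => hCd _ rfl
  have hle1 : ∀ i, Cd (.dx i) ≤ C1 := fun i =>
    Finset.single_le_sum (f := fun i => Cd (.dx i)) (fun i _ => hCd _ rfl) (Finset.mem_univ i)
  set C2 : ℝ := ∑ i : Fin m, Cd (.dy i)
  have hC2 : 0 ≤ C2 := Finset.sum_nonneg fun i _ => hCd _ rfl
  have hle2 : ∀ i, Cd (.dy i) ≤ C2 := fun i =>
    Finset.single_le_sum (f := fun i => Cd (.dy i)) (fun i _ => hCd _ rfl) (Finset.mem_univ i)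
  refine ⟨(n + m) * (CS * (C1 + C2) * CL), by positivity, fun t ξ ht htξ w η hη b hb hbη hb0 => ?_⟩
  set φ := tpow θ (2 * s) * w with hφdef
  have hφ : Supp1 φ := (closure_mono fun x hx => by
    rw [Function.mem_support] at *
    intro h; apply hx; rw [hφdef, coe_mul, Pi.mul_apply, tpow_apply, h]; simp).trans hθ
  set Y := ‖w‖ + ‖tpow θ (2 * s) * (ngr t ξ m N ^ s) w‖ with hY
  have hθw : ‖θ * w‖ ≤ ‖w‖ := by
    have := norm_le_mul_of_abs_le (θ * w) w (C := 1) zero_le_one fun z => ?_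
    · simpa using this
    · rw [coe_mul, Pi.mul_apply, abs_mul, abs_of_nonneg (hθ0 z)]
      gcongr; exact hθ1 z
  have hG : ‖(ngr t ξ m N ^ s) φ‖ ≤ CL * Y := (hLoc t ξ ht (by linarith [norm_nonneg ξ])
    (by linarith) w).trans (by rw [hY]; gcongr)
  have hY0 : 0 ≤ Y := by positivity
  have hL := abs_sub_le_of_deriv_le φ (CS * (C1 + C2) * CL * Y) (by positivity)
    (fun i z => by
      have a1 := hS t ξ (odx i φ) (hφ.nop t ξ (.dx i)) z
      have a2 := hbd (.dx i) rfl t ξ ht htξ φ hφ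
      rw [nwop_append _ _ _ [_], Module.End.mul_apply, nwop_cons, nwop_nil, mul_one] at a2
      change ‖nwop t ξ _ (odx i φ)‖ ≤ _ at a2
      calc _ ≤ _ := a1
        _ ≤ CS * (C1 * (CL * Y)) := by gcongr; exact a2.trans (mul_le_mul (hle1 i) hG (norm_nonneg _) hC1)
        _ ≤ _ := by
          have : 0 ≤ CS * (C2 * (CL * Y)) := by positivity
          linarith)
    (fun i z => by
      have a1 := hS t ξ (ody i φ) (hφ.nop t ξ (.dy i)) z
      have a2 := hbd (.dy i) rfl t ξ ht htξ φ hφ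
      rw [nwop_append _ _ _ [_], Module.End.mul_apply, nwop_cons, nwop_nil, mul_one] at a2
      change ‖nwop t ξ _ (ody i φ)‖ ≤ _ at a2
      calc _ ≤ _ := a1
        _ ≤ CS * (C2 * (CL * Y)) := by gcongr; exact a2.trans (mul_le_mul (hle2 i) hG (norm_nonneg _) hC2)
        _ ≤ _ := by
          have : 0 ≤ CS * (C1 * (CL * Y)) := by positivity
          linarith)
  set L := CS * (C1 + C2) * CL * Y with hLdef
  have hφi : Integrable fun z => φ z * b z := by
    obtain ⟨B, hB⟩ := φ.compact.exists_bound_of_continuous φ.continuous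
    exact hb.bdd_mul φ.continuous.aestronglyMeasurable (Filter.Eventually.of_forall hB)
  have e1 : ∫ z, w z * b z = ∫ z, (φ z - φ 0) * b z := by
    have : ∫ z, (φ z - φ 0) * b z = ∫ z, φ z * b z := by
      simp_rw [sub_mul]
      rw [integral_sub hφi (hb.const_mul _), integral_const_mul, hb0, mul_zero, sub_zero]
    rw [this]
    congr 1; ext z
    rcases le_or_gt ‖z‖ η with hz | hz
    · rw [hφdef, coe_mul, Pi.mul_apply, tpow_apply, hη0 z (hz.trans hη)]; simp
    · rw [hbη z hz]; simp
  rw [e1]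
  have e2 : ‖∫ z, (φ z - φ 0) * b z‖ ≤ ∫ z, ((n + m) * L * η) * |b z| := by
    refine norm_integral_le_of_norm_le (hb.abs.const_mul _) (Filter.Eventually.of_forall fun z => ?_)
    rw [Real.norm_eq_abs, abs_mul]
    rcases le_or_gt ‖z‖ η with hz | hz
    · gcongr
      refine (hL z 0).trans ?_
      rw [sub_zero]; gcongr
    · rw [hbη z hz]; simp
  rw [integral_const_mul, Real.norm_eq_abs] at e2
  refine e2.trans (le_of_eq ?_)
  rw [hLdef]; ring

end Grusin

namespace Grusin

open TestFn

variable {n m : ℕ}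

/-- The functions against which we regularize. -/
structure Good (v : Pt n m → ℝ) : Prop where
  integrable : Integrable v
  compact : HasCompactSupport v
  memLp : MemLp v 2

/-- Integration against `v`. -/
noncomputable def ivt (v : Pt n m → ℝ) (hv : Good v) : TestFn (Pt n m) →ₗ[ℝ] ℝ where
  toFun φ := ∫ z, v z * φ z
  map_add' φ ψ := by
    have h : ∀ φ : TestFn (Pt n m), Integrable fun z => v z * φ z := fun φ => by
      obtain ⟨B, hB⟩ := φ.compact.exists_bound_of_continuous φ.continuous
      exact hv.integrable.mul_bdd φ.continuous.aestronglyMeasurable (Filter.Eventually.of_forall hB)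
    simp only [coe_add, Pi.add_apply, mul_add]
    exact integral_add (h φ) (h ψ)
  map_smul' c φ := by
    simp only [coe_smul, Pi.smul_apply, smul_eq_mul, RingHom.id_apply, ← integral_const_mul]
    congr 1; ext z; ring

/-- Convolution with `v`. -/
noncomputable def conv (v : Pt n m → ℝ) (hv : Good v) : Module.End ℝ (TestFn (Pt n m)) where
  toFun κ := mk (convolution v κ (ContinuousLinearMap.lsmul ℝ ℝ) volume)
    (κ.compact.contDiff_convolution_right _ hv.integrable.locallyIntegrable κ.smooth)
    (hv.compact.convolution _ κ.compact)
  map_add' κ κ' := by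
    ext z
    have h : ∀ κ : TestFn (Pt n m), ConvolutionExistsAt v κ z (ContinuousLinearMap.lsmul ℝ ℝ) volume :=
      fun κ => κ.compact.convolutionExists_right _ hv.integrable.locallyIntegrable κ.continuous z
    exact (h κ).distrib_add (h κ')
  map_smul' c κ := by
    ext z
    change convolution v (c • ⇑κ) (ContinuousLinearMap.lsmul ℝ ℝ) volume z =
      c • convolution v κ (ContinuousLinearMap.lsmul ℝ ℝ) volume z
    rw [convolution_smul]; rfl

lemma conv_apply (v : Pt n m → ℝ) (hv : Good v) (κ : TestFn (Pt n m)) (z) :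
    conv v hv κ z = ∫ u, v u * κ (z - u) := rfl

lemma D_conv (v : Pt n m → ℝ) (hv : Good v) (a : Pt n m) :
    D a * conv v hv = conv v hv * D a := by
  ext κ z
  have h := κ.compact.hasFDerivAt_convolution_right (ContinuousLinearMap.lsmul ℝ ℝ)
    (hv.integrable.locallyIntegrable (μ := volume)) (κ.smooth.of_le (by exact_mod_cast le_top)) z
  rw [Module.End.mul_apply, Module.End.mul_apply, D_apply, conv_apply]
  change fderiv ℝ (convolution v κ (ContinuousLinearMap.lsmul ℝ ℝ) volume) z a = _
  rw [h.fderiv, convolution_precompR_apply]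
  · rfl
  · exact hv.integrable.locallyIntegrable
  · exact κ.compact.fderiv ℝ
  · exact κ.smooth.continuous_fderiv (by simp)

/-- Reflection and translation of a test function. -/
noncomputable def Rz (z : Pt n m) : Module.End ℝ (TestFn (Pt n m)) where
  toFun κ := mk (fun u => κ (z - u)) (κ.smooth.comp (by fun_prop))
    (κ.compact.comp_homeomorph (Homeomorph.subLeft z))
  map_add' _ _ := rfl
  map_smul' _ _ := rfl

lemma Rz_apply (z : Pt n m) (κ : TestFn (Pt n m)) (u) : Rz z κ u = κ (z - u) := rfl

lemma D_Rz (a z : Pt n m) (κ : TestFn (Pt n m)) : D a (Rz z κ) = - Rz z (D a κ) := by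
  ext u
  rw [D_apply, coe_neg, Pi.neg_apply, Rz_apply, D_apply]
  have e : HasFDerivAt (fun u : Pt n m => z - u) (-ContinuousLinearMap.id ℝ (Pt n m)) u :=
    (hasFDerivAt_id u).const_sub z
  have := ((κ.differentiable (z - u)).hasFDerivAt.comp u e).fderiv
  change fderiv ℝ (κ ∘ fun u => z - u) u a = _
  rw [this]; simp

lemma ox_Rz (i : Fin n) (z : Pt n m) (κ : TestFn (Pt n m)) :
    ox i (Rz z κ) = z.1 i • Rz z κ - Rz z (ox i κ) := by
  ext u
  simp [Rz_apply]; ring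

/-- `G` computes the pairing of `v` with `P` applied to reflected translates. -/
def GRel (v : Pt n m → ℝ) (hv : Good v) (P G : Module.End ℝ (TestFn (Pt n m))) : Prop :=
  ∀ κ z, ivt v hv (P (Rz z κ)) = G κ z

/-- The commutator with `x_i`. -/
noncomputable def adx (i : Fin n) (G : Module.End ℝ (TestFn (Pt n m))) :
    Module.End ℝ (TestFn (Pt n m)) := ox i * G - G * ox i

/-- The iterated commutator with `|x|²`. -/
noncomputable def adr (G : Module.End ℝ (TestFn (Pt n m))) : Module.End ℝ (TestFn (Pt n m)) :=
  ∑ i, adx i (adx i G)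

/-- The operation on kernels which corresponds to the Grušin operator. -/
noncomputable def grk (N : ℕ) (G : Module.End ℝ (TestFn (Pt n m))) :
    Module.End ℝ (TestFn (Pt n m)) :=
  -(∑ i, odx i * (odx i * G)) - ∑ k, ody k * (ody k * adr^[N] G)

/-- `G` commutes with derivatives. -/
def CommD (G : Module.End ℝ (TestFn (Pt n m))) : Prop := ∀ a, D a * G = G * D a

lemma D_ox (a : Pt n m) (i : Fin n) : D a * ox i = ox i * D a +
    a.1 i • (1 : Module.End ℝ (TestFn (Pt n m))) := by
  ext φ z
  have : HasFDerivAt (fun z : Pt n m => z.1 i) ((ContinuousLinearMap.proj i).comp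
      (ContinuousLinearMap.fst ℝ (Fin n → ℝ) (Fin m → ℝ))) z :=
      ((ContinuousLinearMap.proj (R := ℝ) (φ := fun _ : Fin n => ℝ) i).comp
      (ContinuousLinearMap.fst ℝ (Fin n → ℝ) (Fin m → ℝ))).hasFDerivAt
  rw [Module.End.mul_apply, ox, D_M, this.fderiv]
  simp

lemma CommD.adx {G : Module.End ℝ (TestFn (Pt n m))} (h : CommD G) (i : Fin n) :
    CommD (adx i G) := by
  intro a
  rw [Grusin.adx, mul_sub, sub_mul, ← mul_assoc, D_ox, mul_assoc G, ← mul_assoc (D a), h, mul_assoc G,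
    D_ox, add_mul, mul_add, mul_assoc (ox i), h]
  simp [mul_assoc]

lemma CommD.sum {ι : Type*} {s : Finset ι} {G : ι → Module.End ℝ (TestFn (Pt n m))}
    (h : ∀ i ∈ s, CommD (G i)) : CommD (∑ i ∈ s, G i) := fun a => by
  rw [Finset.mul_sum, Finset.sum_mul]
  exact Finset.sum_congr rfl fun i hi => h i hi a

lemma CommD.D_mul {G : Module.End ℝ (TestFn (Pt n m))} (h : CommD G) (b : Pt n m) :
    CommD (D b * G) := fun a => by
  rw [← mul_assoc, D_comm, mul_assoc, h, mul_assoc]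

lemma CommD.adr {G : Module.End ℝ (TestFn (Pt n m))} (h : CommD G) : CommD (adr G) :=
  CommD.sum fun i _ => (h.adx i).adx i

lemma CommD.adr_iterate {G : Module.End ℝ (TestFn (Pt n m))} (h : CommD G) (N : ℕ) :
    CommD (Grusin.adr^[N] G) := by
  induction N with
  | zero => exact h
  | succ N ih => rw [Function.iterate_succ_apply']; exact ih.adr

lemma CommD.grk {G : Module.End ℝ (TestFn (Pt n m))} (h : CommD G) (N : ℕ) :
    CommD (grk N G) := fun a => by
  have h1 := CommD.sum (s := Finset.univ) fun i _ => (h.D_mul (Pi.single i 1, 0)).D_mul (Pi.single i 1, 0)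
  have h2 := CommD.sum (s := Finset.univ) fun k _ =>
    ((h.adr_iterate N).D_mul (0, Pi.single k 1)).D_mul (0, Pi.single k 1)
  have e1 := h1 a
  have e2 := h2 a
  simp only [Grusin.grk, odx, ody]
  rw [mul_sub, sub_mul, mul_neg, neg_mul, e1, e2]

section
variable {v : Pt n m → ℝ} {hv : Good v}

lemma GRel.mul_D {P G : Module.End ℝ (TestFn (Pt n m))} (h : GRel v hv P G) (hG : CommD G)
    (a : Pt n m) : GRel v hv (P * D a) (-(D a * G)) := fun κ z => by
  rw [Module.End.mul_apply, D_Rz, map_neg, map_neg, h, hG]; rfl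

lemma GRel.mul_ox {P G : Module.End ℝ (TestFn (Pt n m))} (h : GRel v hv P G) (i : Fin n) :
    GRel v hv (P * ox i) (adx i G) := fun κ z => by
  rw [Module.End.mul_apply, ox_Rz, map_sub, map_sub, map_smul, map_smul, h, h]; rfl

lemma GRel.sum {ι : Type*} {s : Finset ι} {P G : ι → Module.End ℝ (TestFn (Pt n m))}
    (h : ∀ i ∈ s, GRel v hv (P i) (G i)) : GRel v hv (∑ i ∈ s, P i) (∑ i ∈ s, G i) := fun κ z => by
  rw [LinearMap.sum_apply, map_sum, LinearMap.sum_apply, TestFn.sum_apply]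
  exact Finset.sum_congr rfl fun i hi => h i hi κ z

lemma GRel.mul_D_D {P G : Module.End ℝ (TestFn (Pt n m))} (h : GRel v hv P G) (hG : CommD G)
    (a : Pt n m) : GRel v hv (P * D a ^ 2) (D a * (D a * G)) := fun κ z => by
  have := (h.mul_D hG a).mul_D (fun b => by rw [mul_neg, neg_mul, hG.D_mul]) a κ z
  rw [pow_two, ← mul_assoc, this, mul_neg, neg_neg]

lemma GRel.mul_rad {P G : Module.End ℝ (TestFn (Pt n m))} (h : GRel v hv P G) (N : ℕ) :
    GRel v hv (P * (∑ i, ox i ^ 2) ^ N) (adr^[N] G) := by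
  induction N with
  | zero => simpa using h
  | succ N ih =>
    rw [pow_succ, ← mul_assoc, Finset.mul_sum, Function.iterate_succ_apply']
    refine GRel.sum fun i _ => ?_
    rw [pow_two, ← mul_assoc]
    exact (ih.mul_ox i).mul_ox i

lemma GRel.mul_gr {P G : Module.End ℝ (TestFn (Pt n m))} (h : GRel v hv P G) (hG : CommD G)
    (N : ℕ) : GRel v hv (P * gr n m N) (grk N G) := fun κ z => by
  have h1 : GRel v hv (∑ i, P * odx i ^ 2) (∑ i, odx i * (odx i * G)) :=
    GRel.sum fun i _ => h.mul_D_D hG _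
  have h2 : GRel v hv (∑ k, P * (∑ i, ox i ^ 2) ^ N * ody k ^ 2)
      (∑ k, ody k * (ody k * adr^[N] G)) :=
    GRel.sum fun k _ => (h.mul_rad N).mul_D_D (hG.adr_iterate N) _
  rw [gr, mul_sub, mul_neg, Finset.mul_sum, ← mul_assoc, Finset.mul_sum, LinearMap.sub_apply,
    LinearMap.neg_apply, map_sub, map_neg, h1, h2]
  rfl

lemma gRel_gr_pow (N s : ℕ) : GRel v hv (gr n m N ^ s) ((grk N)^[s] (conv v hv)) ∧
    CommD ((grk N)^[s] (conv v hv)) := by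
  induction s with
  | zero => exact ⟨fun κ z => rfl, D_conv v hv⟩
  | succ s ih =>
    rw [pow_succ, Function.iterate_succ_apply']
    exact ⟨ih.1.mul_gr ih.2 N, ih.2.grk N⟩

end

section
variable (C : Module.End ℝ (TestFn (Pt n m)))

/-- The span of the operators `g B C Q` with `B` a product of at most `k` derivatives in `x` and `Q`
a product of coordinates and derivatives in `y`, with at least `j` coordinates. -/
noncomputable def S (j k : ℕ) : Submodule ℝ (Module.End ℝ (TestFn (Pt n m))) :=
  Submodule.span ℝ {A | ∃ (g : Pt n m → ℝ) (hg : ContDiff ℝ ∞ g) (b q : List (Letter n m)),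
    cx b = 0 ∧ cdy b = 0 ∧ cdx b ≤ k ∧ cdx q = 0 ∧ j ≤ cx q ∧ A = M g hg * wop b * C * wop q}

lemma S_le_of {j k : ℕ} (f : Module.End ℝ (TestFn (Pt n m)) →ₗ[ℝ] Module.End ℝ (TestFn (Pt n m)))
    (T : Submodule ℝ (Module.End ℝ (TestFn (Pt n m))))
    (h : ∀ g hg b q, cx b = 0 → cdy b = 0 → cdx b ≤ k → cdx q = 0 → j ≤ cx q →
      f (M g hg * wop b * C * wop q) ∈ T) {A} (hA : A ∈ S C j k) : f A ∈ T := by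
  have : S C j k ≤ T.comap f := Submodule.span_le.mpr (by
    rintro _ ⟨g, hg, b, q, h1, h2, h3, h4, h5, rfl⟩
    exact h g hg b q h1 h2 h3 h4 h5)
  exact this hA

lemma mem_S {j k : ℕ} (g : Pt n m → ℝ) (hg) (b q : List (Letter n m)) (h1 : cx b = 0)
    (h2 : cdy b = 0) (h3 : cdx b ≤ k) (h4 : cdx q = 0) (h5 : j ≤ cx q) :
    M g hg * wop b * C * wop q ∈ S C j k := Submodule.subset_span ⟨g, hg, b, q, h1, h2, h3, h4, h5, rfl⟩

lemma S_mono {j k k' : ℕ} (h : k ≤ k') : S C j k ≤ S C j k' := fun _ hA =>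
  S_le_of C LinearMap.id _ (fun g hg b q h1 h2 h3 h4 h5 => mem_S C g hg b q h1 h2 (h3.trans h) h4 h5) hA

lemma D_mul_M (a : Pt n m) (g : Pt n m → ℝ) (hg : ContDiff ℝ ∞ g) :
    D a * M g hg = M g hg * D a + M (fun z => fderiv ℝ g z a)
      ((hg.fderiv_right (m := ∞) (by simp)).clm_apply contDiff_const) := by
  ext φ z
  rw [Module.End.mul_apply, D_M]; rfl

lemma D_wop {b : List (Letter n m)} (h : cx b = 0) (a : Pt n m) : D a * wop b = wop b * D a := by
  induction b with
  | nil => rfl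
  | cons l b ih =>
    have h' : l.nx = 0 ∧ cx b = 0 := by simpa [cx] using h
    have hl : D a * l.op = l.op * D a := by
      cases l with
      | x i => simp [Letter.nx] at h'
      | dx i => exact D_comm _ _
      | dy i => exact D_comm _ _
    rw [wop_cons, ← mul_assoc, hl, mul_assoc, ih h'.2, mul_assoc]

lemma odx_mul_mem {j k : ℕ} (i : Fin n) {A} (hA : A ∈ S C j k) : odx i * A ∈ S C j (k + 1) := by
  refine S_le_of C (LinearMap.mulLeft ℝ (odx i)) _ (fun g hg b q h1 h2 h3 h4 h5 => ?_) hA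
  simp only [LinearMap.mulLeft_apply, ← mul_assoc]
  rw [odx, D_mul_M, add_mul, add_mul, add_mul]
  refine add_mem ?_ (mem_S C _ _ b q h1 h2 (by omega) h4 h5)
  have := mem_S C (k := k + 1) g hg (.dx i :: b) q (by simpa [cx, Letter.nx] using h1)
    (by simpa [cdy, Letter.ndy] using h2) (by simp [cdx, Letter.ndx] at h3 ⊢; omega) h4 h5
  rw [wop_cons, ← mul_assoc] at this
  exact this

lemma ody_mul_mem (hC : CommD C) {j k : ℕ} (i : Fin m) {A} (hA : A ∈ S C j k) :
    ody i * A ∈ S C j k := by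
  refine S_le_of C (LinearMap.mulLeft ℝ (ody i)) _ (fun g hg b q h1 h2 h3 h4 h5 => ?_) hA
  simp only [LinearMap.mulLeft_apply, ← mul_assoc]
  rw [ody, D_mul_M, add_mul, add_mul, add_mul]
  refine add_mem ?_ (mem_S C _ _ b q h1 h2 h3 h4 h5)
  rw [mul_assoc (M g hg), D_wop h1, ← mul_assoc, mul_assoc _ (D _) C, hC, ← mul_assoc, mul_assoc _ (D _)]
  have := mem_S C (k := k) g hg b (.dy i :: q) h1 h2 h3 (by simpa [cdx, Letter.ndx] using h4)
    (j := j) (by simpa [cx, Letter.nx] using h5)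
  rw [wop_cons] at this
  exact this

lemma ox_mul_mem {j k : ℕ} (i : Fin n) {A} (hA : A ∈ S C j k) : ox i * A ∈ S C j k := by
  refine S_le_of C (LinearMap.mulLeft ℝ (ox i)) _ (fun g hg b q h1 h2 h3 h4 h5 => ?_) hA
  simp only [LinearMap.mulLeft_apply, ← mul_assoc]
  have e : ox i * M g hg = M (fun z => z.1 i * g z) ((show ContDiff ℝ ∞ fun z : Pt n m => z.1 i by
      fun_prop).mul hg) := by
    ext φ z; simp [mul_assoc]
  rw [e]
  exact mem_S C _ _ b q h1 h2 h3 h4 h5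

lemma mul_ox_mem {j k : ℕ} (i : Fin n) {A} (hA : A ∈ S C j k) : A * ox i ∈ S C (j + 1) k := by
  refine S_le_of C (LinearMap.mulRight ℝ (ox i)) _ (fun g hg b q h1 h2 h3 h4 h5 => ?_) hA
  simp only [LinearMap.mulRight_apply]
  have := mem_S C (k := k) g hg b (q ++ [.x i]) h1 h2 h3 (by simpa [cdx, Letter.ndx] using h4)
    (j := j + 1) (by simpa [cx, Letter.nx] using h5)
  rw [wop_append, ← mul_assoc] at this
  simpa [wop, Letter.op] using this

/-- `G'` is the leading part of `G`. -/
def Lead (k : ℕ) (G G' : Module.End ℝ (TestFn (Pt n m))) : Prop := G ∈ S C 0 k ∧ G - G' ∈ S C 1 k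

variable {C} {k : ℕ} {G G' : Module.End ℝ (TestFn (Pt n m))}

lemma Lead.mono {k' : ℕ} (hk : k ≤ k') (h : Lead C k G G') : Lead C k' G G' :=
  ⟨S_mono C hk h.1, S_mono C hk h.2⟩

lemma Lead.odx (h : Lead C k G G') (i : Fin n) : Lead C (k + 1) (odx i * G) (odx i * G') :=
  ⟨odx_mul_mem C i h.1, by rw [← mul_sub]; exact odx_mul_mem C i h.2⟩

lemma Lead.ody (hC : CommD C) (h : Lead C k G G') (i : Fin m) : Lead C k (ody i * G) (ody i * G') :=
  ⟨ody_mul_mem C hC i h.1, by rw [← mul_sub]; exact ody_mul_mem C hC i h.2⟩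

lemma S_one_le (j : ℕ) : S C (j + 1) k ≤ S C j k := fun _ hA =>
  S_le_of C LinearMap.id _ (fun g hg b q h1 h2 h3 h4 h5 => mem_S C g hg b q h1 h2 h3 h4 (by omega)) hA

lemma Lead.adx (h : Lead C k G G') (i : Fin n) : Lead C k (adx i G) (ox i * G') := by
  refine ⟨sub_mem (ox_mul_mem C i h.1) (S_one_le 0 (mul_ox_mem C i h.1)), ?_⟩
  rw [Grusin.adx, sub_right_comm, ← mul_sub]
  exact sub_mem (ox_mul_mem C i h.2) (mul_ox_mem C i h.1)

lemma Lead.sum {ι : Type*} {s : Finset ι} {G G' : ι → Module.End ℝ (TestFn (Pt n m))}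
    (h : ∀ i ∈ s, Lead C k (G i) (G' i)) : Lead C k (∑ i ∈ s, G i) (∑ i ∈ s, G' i) :=
  ⟨sum_mem fun i hi => (h i hi).1, by
    rw [← Finset.sum_sub_distrib]; exact sum_mem fun i hi => (h i hi).2⟩

lemma Lead.adr_iterate (h : Lead C k G G') (N : ℕ) :
    Lead C k (adr^[N] G) ((∑ i, ox i ^ 2) ^ N * G') := by
  induction N with
  | zero => simpa using h
  | succ N ih =>
    rw [Function.iterate_succ_apply', pow_succ', mul_assoc, Finset.sum_mul]
    refine Lead.sum fun i _ => ?_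
    rw [pow_two, mul_assoc]
    exact (ih.adx i).adx i

lemma ody_rad_comm (N : ℕ) (k : Fin m) :
    Commute (Grusin.ody k) ((∑ i : Fin n, (ox i : Module.End ℝ (TestFn (Pt n m))) ^ 2) ^ N) := by
  refine (Commute.sum_right _ _ _ fun i _ => Commute.pow_right ?_ 2).pow_right N
  have := D_ox (0, Pi.single k 1) i (n := n) (m := m)
  change D _ * ox i = ox i * D _
  simpa using this

lemma Lead.grk (hC : CommD C) (h : Lead C k G G') (N : ℕ) :
    Lead C (k + 2) (grk N G) (gr n m N * G') := by
  have h1 : Lead C (k + 2) (∑ i, Grusin.odx i * (Grusin.odx i * G)) (∑ i, Grusin.odx i * (Grusin.odx i * G')) :=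
    Lead.sum fun i _ => (h.odx i).odx i
  have h2 : Lead C (k + 2) (∑ i, Grusin.ody i * (Grusin.ody i * adr^[N] G))
      (∑ i, Grusin.ody i * (Grusin.ody i * ((∑ i, ox i ^ 2) ^ N * G'))) :=
    Lead.mono (by omega) (Lead.sum fun i _ => ((h.adr_iterate N).ody hC i).ody hC i)
  have e : gr n m N * G' = -(∑ i, Grusin.odx i * (Grusin.odx i * G')) -
      ∑ i, Grusin.ody i * (Grusin.ody i * ((∑ i, ox i ^ 2) ^ N * G')) := by
    rw [gr, sub_mul, neg_mul, Finset.sum_mul, mul_assoc, Finset.sum_mul, Finset.mul_sum]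
    congr 1
    · refine Finset.sum_congr rfl fun i _ => ?_
      have c : Grusin.ody i * _ = _ := ody_rad_comm (n := n) N i
      rw [pow_two, mul_assoc, ← mul_assoc (Grusin.ody i) (_ ^ N) G', c, mul_assoc,
        ← mul_assoc (Grusin.ody i) (_ ^ N), c, mul_assoc]
  refine ⟨sub_mem (neg_mem h1.1) h2.1, ?_⟩
  rw [e, Grusin.grk]
  have : ∀ a b c d : Module.End ℝ (TestFn (Pt n m)), -a - b - (-c - d) = -(a - c) - (b - d) := by
    intros; abel
  rw [this]
  exact sub_mem (neg_mem h1.2) h2.2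

lemma lead_grk_iterate (hC : CommD C) (N s : ℕ) :
    Lead C (2 * s) ((grk N)^[s] C) (gr n m N ^ s * C) := by
  induction s with
  | zero =>
    have : (C : Module.End ℝ (TestFn (Pt n m))) ∈ S C 0 0 := by
      have := mem_S C (j := 0) (k := 0) (fun _ => 1) contDiff_const [] [] rfl rfl le_rfl rfl le_rfl
      have e : M (fun _ : Pt n m => (1 : ℝ)) contDiff_const = 1 := by ext φ z; simp
      simpa [e, wop] using this
    exact ⟨this, by simp⟩
  | succ s ih =>
    rw [Function.iterate_succ_apply', pow_succ', mul_assoc]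
    exact ih.grk hC N

end

end Grusin

/-- The `L²` norm of a function. -/
noncomputable def l2 {E : Type*} [MeasureSpace E] (v : E → ℝ) : ℝ := (eLpNorm v 2 volume).toReal

lemma l2_nonneg {E : Type*} [MeasureSpace E] (v : E → ℝ) : 0 ≤ l2 v := ENNReal.toReal_nonneg

lemma integrable_mul_of_memLp_two {E : Type*} [MeasureSpace E] {f g : E → ℝ} (hf : MemLp f 2)
    (hg : MemLp g 2) : Integrable fun z => f z * g z := hf.integrable_mul hg

lemma abs_integral_mul_le_l2 {E : Type*} [MeasureSpace E] {f g : E → ℝ} (hf : MemLp f 2)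
    (hg : MemLp g 2) : |∫ z, f z * g z| ≤ l2 f * l2 g := by
  have h := abs_real_inner_le_norm (hf.toLp f) (hg.toLp g)
  rw [Lp.norm_toLp, Lp.norm_toLp, L2.inner_def] at h
  have e : ∫ z, inner ℝ (hf.toLp f z) (hg.toLp g z) = ∫ z, f z * g z := by
    refine integral_congr_ae ?_
    filter_upwards [hf.coeFn_toLp, hg.coeFn_toLp] with z h1 h2
    rw [h1, h2]; simp [mul_comm]
  rwa [e] at h

namespace Grusin

open TestFn

variable {n m : ℕ}

lemma l2_testFn (φ : TestFn (Pt n m)) : l2 φ = ‖φ‖ := by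
  rw [l2, eLpNorm_eq, ENNReal.toReal_ofReal (norm_nonneg _)]

section
variable {v : Pt n m → ℝ} (hv : Good v)

lemma memLp_sub_left (hv : Good v) (h : Pt n m) : MemLp (fun z => v (z - h)) 2 :=
  hv.memLp.comp_measurePreserving (measurePreserving_sub_right volume h)

lemma l2_sub_right (hv : Good v) (h : Pt n m) : l2 (fun z => v (z - h)) = l2 v := by
  have := eLpNorm_comp_measurePreserving (p := 2) hv.memLp.aestronglyMeasurable
    (measurePreserving_sub_right volume h)
  rw [l2, l2, ← this]; rfl

lemma integral_conv_mul (κ : TestFn (Pt n m)) (f : Pt n m → ℝ) (hf : AEStronglyMeasurable f) (B : ℝ)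
    (hB : ∀ z, ‖f z‖ ≤ B) :
    ∫ z, conv v hv κ z * f z = ∫ h, κ h * ∫ z, v (z - h) * f z := by
  have h1 : Integrable (fun p : Pt n m × Pt n m => κ p.2 * v (p.1 - p.2)) (volume.prod volume) :=
    κ.integrable.convolution_integrand (ContinuousLinearMap.lsmul ℝ ℝ) hv.integrable
  have h2 : Integrable (fun p : Pt n m × Pt n m => κ p.2 * v (p.1 - p.2) * f p.1)
      (volume.prod volume) :=
    h1.mul_bdd hf.comp_fst (Filter.Eventually.of_forall fun p => hB p.1)
  calc ∫ z, conv v hv κ z * f z = ∫ z, ∫ h, κ h * v (z - h) * f z := by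
        congr 1; ext z
        rw [conv_apply, integral_mul_const]
        congr 1
        have := Measure.IsAddHaarMeasure.isNegInvariant_of_regular (volume : Measure (Pt n m))
        rw [← integral_sub_left_eq_self _ volume z]
        congr 1; ext u; simp [mul_comm]
    _ = ∫ h, ∫ z, κ h * v (z - h) * f z := integral_integral_swap h2
    _ = _ := by
        congr 1; ext h
        rw [← integral_const_mul]; congr 1; ext z; ring

/-- Young's inequality. -/
lemma norm_conv_le (κ : TestFn (Pt n m)) : ‖conv v hv κ‖ ≤ (∫ z, |κ z|) * l2 v := by
  have h := norm_sq (conv v hv κ)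
  obtain ⟨B, hB⟩ := (conv v hv κ).compact.exists_bound_of_continuous (conv v hv κ).continuous
  simp_rw [pow_two (conv v hv κ _)] at h
  rw [integral_conv_mul hv κ _ (conv v hv κ).continuous.aestronglyMeasurable B hB] at h
  have h2 : ‖conv v hv κ‖ ^ 2 ≤ ∫ z, |κ z| * (l2 v * ‖conv v hv κ‖) := by
    rw [h]
    refine (le_abs_self _).trans ((norm_integral_le_of_norm_le (f := fun h => κ h * ∫ z, v (z - h) * conv v hv κ z)
      (κ.integrable.abs.mul_const _) (Filter.Eventually.of_forall fun z => ?_)))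
    rw [norm_mul, Real.norm_eq_abs, Real.norm_eq_abs]
    gcongr
    refine (abs_integral_mul_le_l2 (memLp_sub_left hv z) ((conv v hv κ).memLp 2)).trans ?_
    rw [l2_sub_right hv, l2_testFn]
  rw [integral_mul_const] at h2
  have h3 : 0 ≤ ∫ z, |κ z| := integral_nonneg fun z => abs_nonneg _
  have h4 := l2_nonneg v
  rcases (norm_nonneg (conv v hv κ)).eq_or_lt with h0 | h0
  · rw [← h0]; positivity
  · nlinarith

end

/-- The dilated kernel. -/
noncomputable def kap (φ : TestFn (Pt n m)) {R : ℝ} (hR : R ≠ 0) : TestFn (Pt n m) :=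
  R ^ n • pull 0 hR one_ne_zero φ

lemma kap_apply (φ : TestFn (Pt n m)) {R : ℝ} (hR : R ≠ 0) (z) :
    kap φ hR z = R ^ n * φ (R • z.1, z.2) := by
  simp [kap, pull_apply, aff]

lemma integral_abs_kap (φ : TestFn (Pt n m)) {R : ℝ} (hR : 0 < R) :
    ∫ z, |kap φ hR.ne' z| = ∫ z, |φ z| := by
  have := integral_comp_aff (0 : Pt n m) hR one_pos fun z => |φ z|
  simp only [aff, Prod.fst_zero, zero_add, Prod.snd_zero, one_smul, one_pow, mul_one] at this
  simp only [kap_apply, abs_mul, integral_const_mul, this]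
  rw [abs_of_pos (by positivity)]
  field_simp

lemma integral_kap (φ : TestFn (Pt n m)) {R : ℝ} (hR : 0 < R) :
    ∫ z, kap φ hR.ne' z = ∫ z, φ z := by
  have := integral_comp_aff (0 : Pt n m) hR one_pos fun z => φ z
  simp only [aff, Prod.fst_zero, zero_add, Prod.snd_zero, one_smul, one_pow, mul_one] at this
  simp only [kap_apply, integral_const_mul, this]
  field_simp

lemma wop_kap (φ : TestFn (Pt n m)) {R : ℝ} (hR : R ≠ 0) (w : List (Letter n m)) :
    wop w (kap φ hR) = (R⁻¹ ^ cx w * R ^ cdx w) • kap (wop w φ) hR := by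
  have := nwop_pull (0 : Pt n m) (ρ := R) hR one_ne_zero w φ
  simp only [div_self hR, Prod.fst_zero, smul_zero, nwop_one_zero, one_pow, mul_one] at this
  rw [kap, map_smul, this, kap, smul_comm]

/-- The support is contained in a box. -/
def Narrow (ε : ℝ) (φ : TestFn (Pt n m)) : Prop := ∀ z, φ z ≠ 0 → ‖z.1‖ ≤ 1 ∧ ‖z.2‖ ≤ ε

lemma Narrow.iff_tsupport {ε : ℝ} {φ : TestFn (Pt n m)} :
    Narrow ε φ ↔ tsupport φ ⊆ {z : Pt n m | ‖z.1‖ ≤ 1 ∧ ‖z.2‖ ≤ ε} := by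
  constructor
  · intro h
    refine closure_minimal h ?_
    exact (isClosed_le continuous_fst.norm continuous_const).inter
      (isClosed_le continuous_snd.norm continuous_const)
  · exact fun h z hz => h (subset_closure hz)

lemma tsupport_wop (w : List (Letter n m)) (φ : TestFn (Pt n m)) : tsupport (wop w φ) ⊆ tsupport φ := by
  induction w with
  | nil => exact subset_rfl
  | cons l w ih =>
    rw [wop_cons, Module.End.mul_apply]
    refine subset_trans ?_ ih
    cases l with
    | x i =>
      refine closure_mono fun z hz => ?_
      rw [Function.mem_support] at *
      rw [Letter.op, ox_apply] at hz
      exact right_ne_zero_of_mul hz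
    | dx i => exact tsupport_D _ _
    | dy i => exact tsupport_D _ _

lemma Narrow.wop {ε : ℝ} {φ : TestFn (Pt n m)} (h : Narrow ε φ) (w : List (Letter n m)) :
    Narrow ε (wop w φ) := Narrow.iff_tsupport.mpr ((tsupport_wop w φ).trans (Narrow.iff_tsupport.mp h))

lemma Narrow.mono {ε ε' : ℝ} (hε : ε ≤ ε') {φ : TestFn (Pt n m)} (h : Narrow ε φ) : Narrow ε' φ :=
  fun z hz => ⟨(h z hz).1, (h z hz).2.trans hε⟩

lemma Narrow.kap {ε : ℝ} {φ : TestFn (Pt n m)} (h : Narrow ε φ) {R : ℝ} (hR : 0 < R) (hR' : ε⁻¹ ≤ R)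
    (hε : 0 < ε) {z} (hz : kap φ hR.ne' z ≠ 0) : ‖z‖ ≤ ε := by
  rw [kap_apply] at hz
  have := h _ (right_ne_zero_of_mul hz)
  rw [norm_smul, Real.norm_of_nonneg hR.le] at this
  refine norm_prod_le_iff.mpr ⟨?_, this.2⟩
  have h1 : ‖z.1‖ ≤ R⁻¹ := by rw [← mul_one R⁻¹, le_inv_mul_iff₀ hR]; exact this.1
  exact h1.trans (inv_le_of_inv_le₀ hε hR')

lemma mul_wop_congr {χ φ ψ : TestFn (Pt n m)} {O : Set (Pt n m)} (hO : IsOpen O)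
    (hχ : ∀ z, χ z ≠ 0 → z ∈ O) (h : ∀ z ∈ O, φ z = ψ z) (w : List (Letter n m)) :
    χ * wop w φ = χ * wop w ψ := by
  have key : ∀ z ∈ O, wop w φ z = wop w ψ z := by
    induction w with
    | nil => exact h
    | cons l w ih =>
      intro z hz
      rw [wop_cons, Module.End.mul_apply, Module.End.mul_apply]
      have hD : ∀ a : Pt n m, D a (wop w φ) z = D a (wop w ψ) z := fun a => by
        rw [D_apply, D_apply, Filter.EventuallyEq.fderiv_eq]
        filter_upwards [hO.mem_nhds hz] with y hy using ih y hy
      cases l with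
      | x i => rw [Letter.op, ox_apply, ox_apply, ih z hz]
      | dx i => exact hD _
      | dy i => exact hD _
  ext z
  rw [coe_mul, coe_mul, Pi.mul_apply, Pi.mul_apply]
  by_cases hz : χ z = 0
  · rw [hz, zero_mul, zero_mul]
  · rw [key z (hχ z hz)]

lemma norm_le_of_support {φ : TestFn (Pt n m)} {R : ℝ} (hR : 0 ≤ R) (h : ∀ z, φ z ≠ 0 → ‖z‖ ≤ R)
    (i : Fin n) : ‖φ‖ ≤ 2 * R * ‖odx i φ‖ := by
  have e : odx i (ox i φ) = ox i (odx i φ) + φ := by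
    have := LinearMap.congr_fun (D_ox (Pi.single i 1, 0) i (m := m)) φ
    change D _ _ = ox i (D _ φ) + φ
    simpa using this
  have h1 : ‖φ‖ ^ 2 = -2 * inner ℝ (ox i φ) (odx i φ) := by
    have a1 : inner ℝ (odx i (ox i φ)) φ = - inner ℝ (ox i φ) (odx i φ) := D_anti _ _ _
    have a2 : inner ℝ (ox i (odx i φ)) φ = inner ℝ (odx i φ) (ox i φ) := M_symm _ _ _ _
    rw [e, inner_add_left, a2, real_inner_comm, real_inner_self_eq_norm_sq] at a1
    linarith
  have h2 : ‖ox i φ‖ ≤ R * ‖φ‖ := norm_le_mul_of_abs_le _ _ hR fun z => by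
    rw [ox_apply, abs_mul]
    by_cases hz : φ z = 0
    · simp [hz]
    · gcongr
      exact (norm_le_pi_norm z.1 i).trans ((norm_fst_le z).trans (h z hz))
  have h3 := neg_le_of_abs_le (abs_real_inner_le_norm (ox i φ) (odx i φ))
  have h4 : ‖φ‖ ^ 2 ≤ 2 * (R * ‖φ‖ * ‖odx i φ‖) := by
    rw [h1]
    have : ‖ox i φ‖ * ‖odx i φ‖ ≤ R * ‖φ‖ * ‖odx i φ‖ := by gcongr
    linarith
  rcases (norm_nonneg φ).eq_or_lt with h0 | h0
  · rw [← h0]; positivity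
  · nlinarith

lemma norm_le_pow_of_support {φ : TestFn (Pt n m)} {R : ℝ} (hR : 0 ≤ R)
    (h : tsupport φ ⊆ Metric.closedBall 0 R) (i : Fin n) (p : ℕ) :
    ‖φ‖ ≤ (2 * R) ^ p * ‖wop (List.replicate p (.dx i)) φ‖ := by
  induction p with
  | zero => simp [wop]
  | succ p ih =>
    rw [List.replicate_succ, wop_cons, Module.End.mul_apply, pow_succ, mul_assoc]
    refine ih.trans ?_
    gcongr
    exact norm_le_of_support hR (fun z hz => by
      simpa using h (tsupport_wop _ φ (subset_closure hz))) i

end Grusin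

namespace Grusin

open TestFn

variable {n m : ℕ}

/-- Test functions equal to one near a given compact set. -/
lemma exists_cutoff {K U : Set (Pt n m)} (hK : IsCompact K) (hU : IsOpen U) (h : K ⊆ U) :
    ∃ θ : TestFn (Pt n m), (∀ z, 0 ≤ θ z) ∧ (∀ z, θ z ≤ 1) ∧ tsupport θ ⊆ U ∧
      ∃ O, IsOpen O ∧ K ⊆ O ∧ ∀ z ∈ O, θ z = 1 := by
  obtain ⟨δ, hδ, hδU⟩ := hK.exists_cthickening_subset_open hU h
  obtain ⟨f, hf1, hf0, hf⟩ := exists_contMDiffMap_one_nhds_of_subset_interior (n := (⊤ : ℕ∞))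
    (modelWithCornersSelf ℝ (Pt n m)) hK.isClosed
    ((Metric.self_subset_thickening hδ K).trans (interior_maximal
      (Metric.thickening_subset_cthickening δ K) Metric.isOpen_thickening))
  have hs : tsupport f ⊆ Metric.cthickening δ K :=
    closure_minimal (fun z hz => by_contra fun h => hz (hf0 z h)) Metric.isClosed_cthickening
  obtain ⟨O, hO, hKO, h1⟩ := (eventually_nhdsSet_iff_exists).mp hf1
  exact ⟨mk f f.contMDiff.contDiff (hK.cthickening.of_isClosed_subset (isClosed_tsupport _) hs), fun z => (hf z).1, fun z => (hf z).2,
    hs.trans hδU, O, hO, hKO, h1⟩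

lemma mul_sub_testFn (f g h : TestFn (Pt n m)) : f * (g - h) = f * g - f * h := by
  ext z; simp [mul_sub]

lemma mul_add_testFn (f g h : TestFn (Pt n m)) : f * (g + h) = f * g + f * h := by
  ext z; simp [mul_add]

lemma exists_abs_le (χ : TestFn (Pt n m)) : ∃ B ≥ (0 : ℝ), ∀ z, |χ z| ≤ B := by
  obtain ⟨B, hB⟩ := χ.compact.exists_bound_of_continuous χ.continuous
  exact ⟨B, (norm_nonneg _).trans (hB 0), hB⟩

lemma norm_mul_le_of_abs_le {χ : TestFn (Pt n m)} {B : ℝ} (hB : 0 ≤ B) (h : ∀ z, |χ z| ≤ B)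
    (f : TestFn (Pt n m)) : ‖χ * f‖ ≤ B * ‖f‖ :=
  norm_le_mul_of_abs_le _ _ hB fun z => by
    rw [coe_mul, Pi.mul_apply, abs_mul]; gcongr; exact h z

/-- The growth of `G` on dilated kernels is at most `R ^ (k - e)`, locally on `U`. -/
def Growth (U : Set (Pt n m)) (G : Module.End ℝ (TestFn (Pt n m))) (e k : ℕ) : Prop :=
  ∀ χ : TestFn (Pt n m), tsupport χ ⊆ U → ∃ ε > (0 : ℝ), ε ≤ 1 ∧ ∀ φ, Narrow ε φ → ∃ C : ℝ,
    ∀ (R : ℝ) (hR : 0 < R), ε⁻¹ ≤ R → R ^ e * ‖χ * G (kap φ hR.ne')‖ ≤ C * R ^ k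

variable {U : Set (Pt n m)} {G G' : Module.End ℝ (TestFn (Pt n m))} {e k : ℕ}

lemma Growth.add (h : Growth U G e k) (h' : Growth U G' e k) : Growth U (G + G') e k := by
  intro χ hχ
  obtain ⟨ε, h0, h1, hε⟩ := h χ hχ
  obtain ⟨ε', h0', h1', hε'⟩ := h' χ hχ
  refine ⟨min ε ε', lt_min h0 h0', (min_le_left _ _).trans h1, fun φ hφ => ?_⟩
  obtain ⟨C, hC⟩ := hε φ (hφ.mono (min_le_left _ _))
  obtain ⟨C', hC'⟩ := hε' φ (hφ.mono (min_le_right _ _))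
  refine ⟨C + C', fun R hR hR' => ?_⟩
  have a1 := hC R hR ((inv_anti₀ (lt_min h0 h0') (min_le_left _ _)).trans hR')
  have a2 := hC' R hR ((inv_anti₀ (lt_min h0 h0') (min_le_right _ _)).trans hR')
  rw [LinearMap.add_apply, mul_add_testFn, add_mul]
  refine le_trans ?_ (add_le_add a1 a2)
  rw [← mul_add (R ^ e)]
  exact mul_le_mul_of_nonneg_left (norm_add_le _ _) (pow_nonneg hR.le e)

lemma Growth.smul (h : Growth U G e k) (c : ℝ) : Growth U (c • G) e k := by
  intro χ hχ
  obtain ⟨ε, h0, h1, hε⟩ := h χ hχ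
  refine ⟨ε, h0, h1, fun φ hφ => ?_⟩
  obtain ⟨C, hC⟩ := hε φ hφ
  refine ⟨|c| * C, fun R hR hR' => ?_⟩
  have e : χ * (c • G) (kap φ hR.ne') = c • (χ * G (kap φ hR.ne')) := by
    ext z; simp; ring
  rw [e, norm_smul, Real.norm_eq_abs, mul_assoc, mul_left_comm]
  exact mul_le_mul_of_nonneg_left (hC R hR hR') (abs_nonneg c)

lemma Growth.zero : Growth U 0 e k := by
  intro χ hχ
  refine ⟨1, one_pos, le_rfl, fun φ hφ => ⟨0, fun R hR hR' => ?_⟩⟩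
  have e : χ * (0 : Module.End ℝ (TestFn (Pt n m))) (kap φ hR.ne') = 0 := by
    ext z; simp
  rw [e]; simp

lemma wop_conv {C : Module.End ℝ (TestFn (Pt n m))} (hC : CommD C) {b : List (Letter n m)}
    (h : cx b = 0) : wop b * C = C * wop b := by
  induction b with
  | nil => rfl
  | cons l b ih =>
    have h' : l.nx = 0 ∧ cx b = 0 := by simpa [cx] using h
    have hl : l.op * C = C * l.op := by
      cases l with
      | x i => simp [Letter.nx] at h'
      | dx i => exact hC _
      | dy i => exact hC _
    rw [wop_cons, mul_assoc, ih h'.2, ← mul_assoc, hl, mul_assoc]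

section
variable {v : Pt n m → ℝ} (hv : Good v) (N s : ℕ)

/-- Growth of all pure derivatives in `x` of order at most `2s`. -/
def GrowthD (U : Set (Pt n m)) (s k : ℕ) : Prop :=
  ∀ b : List (Letter n m), cx b = 0 → cdy b = 0 → cdx b ≤ 2 * s → Growth U (wop b * conv v hv) 0 k

lemma growthD_top : GrowthD hv U s (2 * s) := by
  intro b h1 h2 h3 χ hχ
  obtain ⟨B, hB, hχB⟩ := exists_abs_le χ
  refine ⟨1, one_pos, le_rfl, fun φ hφ => ⟨B * ((∫ z, |wop b φ z|) * l2 v), fun R hR hR' => ?_⟩⟩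
  rw [inv_one] at hR'
  rw [wop_conv (D_conv v hv) h1, Module.End.mul_apply, wop_kap, h1, pow_zero, one_mul, pow_zero, one_mul,
    map_smul]
  have := norm_conv_le hv (kap (wop b φ) hR.ne')
  rw [integral_abs_kap _ hR] at this
  refine (norm_mul_le_of_abs_le hB hχB _).trans ?_
  rw [norm_smul, Real.norm_of_nonneg (by positivity), mul_assoc B, mul_comm _ (R ^ (2 * s))]
  have h5 : R ^ cdx b ≤ R ^ (2 * s) := pow_le_pow_right₀ hR' h3
  gcongr

lemma growth_of_mem_S (h : GrowthD hv U s k) {G} (hG : G ∈ S (conv v hv) 1 (2 * s)) :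
    Growth U G 1 k := by
  induction hG using Submodule.span_induction with
  | zero => exact Growth.zero
  | add _ _ _ _ h1 h2 => exact h1.add h2
  | smul c _ _ h => exact h.smul c
  | mem A hA =>
    obtain ⟨g, hg, b, q, h1, h2, h3, h4, h5, rfl⟩ := hA
    intro χ hχ
    have hs : tsupport (M g hg χ) ⊆ U := (closure_mono fun z hz => by
      rw [Function.mem_support, M_apply] at hz; exact right_ne_zero_of_mul hz).trans hχ
    obtain ⟨ε, h0, h1', hε⟩ := h b h1 h2 h3 (M g hg χ) hs
    refine ⟨ε, h0, h1', fun φ hφ => ?_⟩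
    obtain ⟨C, hC⟩ := hε (wop q φ) (hφ.wop q)
    refine ⟨C, fun R hR hR' => ?_⟩
    have hR1 : 1 ≤ R := (one_le_inv₀ h0 |>.mpr h1').trans hR'
    have e : χ * (M g hg * wop b * conv v hv * wop q) (kap φ hR.ne') =
        R⁻¹ ^ cx q • (M g hg χ * (wop b * conv v hv) (kap (wop q φ) hR.ne')) := by
      rw [Module.End.mul_apply, wop_kap, h4, pow_zero, mul_one, map_smul]
      ext z
      simp [Module.End.mul_apply]; ring
    rw [e, norm_smul, Real.norm_of_nonneg (by positivity), ← mul_assoc]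
    have h6 : R ^ 1 * R⁻¹ ^ cx q ≤ 1 := by
      rw [inv_pow, ← div_eq_mul_inv, div_le_one (by positivity)]
      exact pow_le_pow_right₀ hR1 h5
    refine le_trans ?_ (hC R hR hR')
    rw [pow_zero]
    gcongr

lemma mul_grk_eq_zero
    (hw : ∀ φ : TestFn (Pt n m), tsupport φ ⊆ U → ivt v hv ((gr n m N ^ s) φ) = 0)
    (hU : IsOpen U) (χ : TestFn (Pt n m)) (hχ : tsupport χ ⊆ U) :
    ∃ ε > (0 : ℝ), ε ≤ 1 ∧ ∀ φ, Narrow ε φ → ∀ (R : ℝ) (hR : 0 < R), ε⁻¹ ≤ R →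
      χ * (grk N)^[s] (conv v hv) (kap φ hR.ne') = 0 := by
  obtain ⟨δ, hδ, hδU⟩ := χ.compact.isCompact.exists_cthickening_subset_open hU hχ
  refine ⟨min δ 1, by positivity, min_le_right _ _, fun φ hφ R hR hR' => ?_⟩
  ext z
  rw [coe_mul, Pi.mul_apply, coe_zero, Pi.zero_apply]
  by_cases hz : χ z = 0
  · rw [hz, zero_mul]
  · rw [← (gRel_gr_pow N s).1, hw, mul_zero]
    refine (closure_minimal (fun u hu => ?_) Metric.isClosed_closedBall).trans
      ((Metric.closedBall_subset_cthickening (subset_tsupport _ hz) δ).trans hδU)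
    rw [Function.mem_support, Rz_apply] at hu
    have := (hφ.kap hR hR' (by positivity) hu).trans (min_le_left _ _)
    rwa [Metric.mem_closedBall, dist_comm, dist_eq_norm]

lemma growth_gr
    (hw : ∀ φ : TestFn (Pt n m), tsupport φ ⊆ U → ivt v hv ((gr n m N ^ s) φ) = 0)
    (hU : IsOpen U) (h : GrowthD hv U s k) : Growth U (gr n m N ^ s * conv v hv) 1 k := by
  intro χ hχ
  obtain ⟨ε, h0, h1, hε⟩ := growth_of_mem_S hv s h (lead_grk_iterate (D_conv v hv) N s).2 χ hχ
  obtain ⟨ε', h0', h1', hε'⟩ := mul_grk_eq_zero hv N s hw hU χ hχ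
  refine ⟨min ε ε', lt_min h0 h0', (min_le_left _ _).trans h1, fun φ hφ => ?_⟩
  obtain ⟨C, hC⟩ := hε φ (hφ.mono (min_le_left _ _))
  refine ⟨C, fun R hR hR' => ?_⟩
  have a1 := hC R hR ((inv_anti₀ (lt_min h0 h0') (min_le_left _ _)).trans hR')
  have a2 := hε' φ (hφ.mono (min_le_right _ _)) R hR
    ((inv_anti₀ (lt_min h0 h0') (min_le_right _ _)).trans hR')
  rwa [LinearMap.sub_apply, mul_sub_testFn, a2, zero_sub, norm_neg] at a1

lemma GrowthD.pred
    (hw : ∀ φ : TestFn (Pt n m), tsupport φ ⊆ U → ivt v hv ((gr n m N ^ s) φ) = 0)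
    (hn : 1 ≤ n) (hm : 1 ≤ m) (hN : 1 ≤ N) (hs : 1 ≤ s) (hU : IsOpen U)
    (h : GrowthD hv U s (k + 1)) : GrowthD hv U s k := by
  intro b h1 h2 h3 χ hχ
  obtain ⟨B, hB, hχB⟩ := exists_abs_le χ
  obtain ⟨θ, hθ0, hθ1, hθU, O, hO, hχO, hθO⟩ := exists_cutoff χ.compact.isCompact hU hχ
  have hts : tsupport (tpow θ (2 * s)) ⊆ tsupport θ := closure_mono fun z hz => by
    rw [Function.mem_support, tpow_apply] at hz
    exact fun h => hz (by rw [h]; simp)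
  obtain ⟨R0, hR0⟩ := θ.compact.isCompact.isBounded.subset_closedBall 0
  have hR0' : 0 ≤ max R0 0 := le_max_right _ _
  obtain ⟨ε, h0, h1', hε⟩ := growth_gr hv N s hw hU h (tpow θ (2 * s)) (hts.trans hθU)
  obtain ⟨CA, hCA, hA⟩ := Grusin.norm_wop_le N hn hm hN s
    (List.replicate (2 * s - cdx b) (.dx ⟨0, hn⟩) ++ b)
    (by simp only [cdx_append, cdy_append, cx_append, count_replicate_dx, h1, h2]; omega)
    (by simp only [cdx_append, cx_append, count_replicate_dx, h1]
        rw [Nat.sub_add_cancel h3]; simp only [zero_add]; apply le_of_eq; ring)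
  obtain ⟨CL, hCL, hL⟩ := exists_norm_ngr_pow_cutoff_le N hn hm hN s hs θ hθ0 hθ1
  refine ⟨ε, h0, h1', fun φ hφ => ?_⟩
  obtain ⟨C, hC⟩ := hε φ hφ
  refine ⟨B * ((2 * max R0 0) ^ (2 * s - cdx b) * (CA * (CL * ((∫ z, |φ z|) * l2 v + C)))),
    fun R hR hR' => ?_⟩
  have hR1 : 1 ≤ R := (one_le_inv₀ h0 |>.mpr h1').trans hR'
  have hC1 := hC R hR hR'
  rw [Module.End.mul_apply] at hC1 ⊢
  set w := conv v hv (kap φ hR.ne')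
  have hw1 : ‖θ * w‖ ≤ (∫ z, |φ z|) * l2 v := by
    refine (norm_mul_le_of_abs_le zero_le_one (fun z => ?_) w).trans ?_
    · rw [abs_of_nonneg (hθ0 z)]; exact hθ1 z
    · rw [one_mul, ← integral_abs_kap φ hR]
      exact norm_conv_le hv _
  have hw2 : ‖tpow θ (2 * s) * (gr n m N ^ s) w‖ ≤ C * R ^ k := by
    rw [pow_one, pow_succ, ← mul_assoc, mul_comm R] at hC1
    exact le_of_mul_le_mul_right hC1 hR
  have e : χ * wop b w = χ * wop b (tpow θ (2 * s) * w) :=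
    mul_wop_congr hO (fun z hz => hχO (subset_tsupport _ hz)) (fun z hz => by
      simp [tpow_apply, hθO z hz]) b
  have hL1 := hL 1 0 one_pos le_rfl (by simp) w
  rw [ngr_one_zero] at hL1
  have hP := norm_le_pow_of_support (φ := wop b (tpow θ (2 * s) * w)) hR0' (((tsupport_wop _ _).trans
    ((tsupport_mul_subset_left (f := tpow θ (2 * s)) (g := w)).trans (hts.trans hR0))).trans
      (Metric.closedBall_subset_closedBall (le_max_left R0 0))) ⟨0, hn⟩ (2 * s - cdx b)
  rw [← Module.End.mul_apply, ← wop_append] at hP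
  have hR2 : 1 ≤ R ^ k := one_le_pow₀ hR1
  have hI : 0 ≤ (∫ z, |φ z|) * l2 v :=
    mul_nonneg (integral_nonneg fun z => abs_nonneg _) (l2_nonneg v)
  rw [pow_zero, one_mul, e]
  calc ‖χ * wop b (tpow θ (2 * s) * w)‖
      ≤ B * ((2 * max R0 0) ^ (2 * s - cdx b) * (CA * (CL * ((∫ z, |φ z|) * l2 v + C * R ^ k)))) := by
        refine (norm_mul_le_of_abs_le hB hχB _).trans ?_
        gcongr
        refine hP.trans ?_
        gcongr
        refine (hA _).trans ?_
        gcongr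
        refine hL1.trans ?_
        gcongr
    _ ≤ B * ((2 * max R0 0) ^ (2 * s - cdx b) *
          (CA * (CL * ((∫ z, |φ z|) * l2 v * R ^ k + C * R ^ k)))) := by
        gcongr ?_ * (?_ * (?_ * (?_ * (?_ + ?_))))
        · exact le_mul_of_one_le_right hI hR2
        · exact le_rfl
    _ = _ := by ring

lemma growthD_zero
    (hw : ∀ φ : TestFn (Pt n m), tsupport φ ⊆ U → ivt v hv ((gr n m N ^ s) φ) = 0)
    (hn : 1 ≤ n) (hm : 1 ≤ m) (hN : 1 ≤ N) (hs : 1 ≤ s) (hU : IsOpen U) :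
    GrowthD hv U s 0 := by
  have : ∀ k ≤ 2 * s, GrowthD hv U s (2 * s - k) := by
    intro k
    induction k with
    | zero => exact fun _ => growthD_top hv s
    | succ k ih =>
      intro hk
      refine GrowthD.pred hv N s hw hn hm hN hs hU ?_
      have := ih (by omega)
      rwa [show 2 * s - k = 2 * s - (k + 1) + 1 by omega] at this
  simpa using this _ le_rfl

end

lemma exists_conv_approx {v : Pt n m → ℝ} (hv : Good v) {b : Pt n m → ℝ} (hb : MemLp b 2) {ε : ℝ}
    (hε : 0 < ε) : ∃ δ > (0 : ℝ), ∀ κ : TestFn (Pt n m), (∀ z, 0 ≤ κ z) → ∫ z, κ z = 1 →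
      (∀ z, κ z ≠ 0 → ‖z‖ ≤ δ) → |(∫ z, conv v hv κ z * b z) - ∫ z, v z * b z| ≤ ε := by
  have hl := l2_nonneg v
  have hε' : 0 < ε / (4 * (l2 v + 1)) := by positivity
  obtain ⟨g, hg, hbg, hgc, hg2⟩ := hb.exists_hasCompactSupport_eLpNorm_sub_le (by norm_num)
    (ENNReal.ofReal_pos.mpr hε').ne'
  have hbg2 : l2 (b - g) ≤ ε / (4 * (l2 v + 1)) :=
    ENNReal.toReal_le_of_le_ofReal hε'.le hbg
  obtain ⟨B, hB⟩ := hg.exists_bound_of_continuous hgc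
  set F : Pt n m → ℝ := fun h => ∫ z, v (z - h) * g z
  have hF : Continuous F := by
    have h1 := (hg.comp_homeomorph (Homeomorph.neg _)).continuous_convolution_right
      (ContinuousLinearMap.lsmul ℝ ℝ) (hv.integrable.locallyIntegrable)
      (hgc.comp (Homeomorph.neg _).continuous)
    convert h1.comp (Homeomorph.neg (Pt n m)).continuous using 1
    ext h
    change ∫ z, v (z - h) * g z = ∫ u, v u * g (- (- h - u))
    rw [← integral_add_right_eq_self _ h]
    congr 1; ext u
    rw [add_sub_cancel_right]; congr 2; abel
  obtain ⟨δ, hδ, hFδ⟩ := Metric.continuous_iff.mp hF 0 (ε / 2) (by positivity)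
  refine ⟨δ / 2, by positivity, fun κ hκ hκ1 hκδ => ?_⟩
  have hw : ‖conv v hv κ‖ ≤ l2 v := by
    have := norm_conv_le hv κ
    simp_rw [abs_of_nonneg (hκ _)] at this
    rwa [hκ1, one_mul] at this
  have hbg' : MemLp (b - g) 2 := hb.sub hg2
  have a1 : |∫ z, conv v hv κ z * (b - g) z| ≤ l2 v * (ε / (4 * (l2 v + 1))) := by
    refine (abs_integral_mul_le_l2 ((conv v hv κ).memLp 2) hbg').trans ?_
    rw [l2_testFn]
    exact mul_le_mul hw hbg2 (l2_nonneg _) hl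
  have a2 : |∫ z, v z * (b - g) z| ≤ l2 v * (ε / (4 * (l2 v + 1))) :=
    (abs_integral_mul_le_l2 hv.memLp hbg').trans (by gcongr)
  have a3 : |(∫ z, conv v hv κ z * g z) - ∫ z, v z * g z| ≤ ε / 2 := by
    have e0 : ∫ z, v z * g z = ∫ h, κ h * F 0 := by
      rw [integral_mul_const, hκ1, one_mul]; simp [F]
    have hi : Integrable fun h => κ h * F h :=
      (κ.continuous.mul hF).integrable_of_hasCompactSupport κ.compact.mul_right
    rw [integral_conv_mul hv κ g hgc.aestronglyMeasurable B hB, e0,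
      ← integral_sub hi (κ.integrable.mul_const _)]
    refine (norm_integral_le_of_norm_le (f := fun h => κ h * F h - κ h * F 0)
      (κ.integrable.mul_const (ε / 2))
      (Filter.Eventually.of_forall fun h => ?_)).trans ?_
    · rw [← mul_sub, norm_mul, Real.norm_of_nonneg (hκ h)]
      by_cases h0 : κ h = 0
      · rw [h0]; simp
      · have := hFδ h (by rw [dist_zero_right]; linarith [hκδ h h0])
        rw [dist_eq_norm] at this
        exact mul_le_mul_of_nonneg_left this.le (hκ h)
    · rw [integral_mul_const, hκ1, one_mul]
  have s1 : ∫ z, conv v hv κ z * (b - g) z = (∫ z, conv v hv κ z * b z) - ∫ z, conv v hv κ z * g z := by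
    rw [← integral_sub (integrable_mul_of_memLp_two ((conv v hv κ).memLp 2) hb)
      (integrable_mul_of_memLp_two ((conv v hv κ).memLp 2) hg2)]
    congr 1; ext z; simp [mul_sub]
  have s2 : ∫ z, v z * (b - g) z = (∫ z, v z * b z) - ∫ z, v z * g z := by
    rw [← integral_sub (integrable_mul_of_memLp_two hv.memLp hb)
      (integrable_mul_of_memLp_two hv.memLp hg2)]
    congr 1; ext z; simp [mul_sub]
  have a4 : l2 v * (ε / (4 * (l2 v + 1))) ≤ ε / 4 := by
    rw [← mul_div_assoc, div_le_div_iff₀ (by positivity) (by positivity)]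
    nlinarith
  rw [s1] at a1
  rw [s2] at a2
  rw [abs_le] at *
  constructor <;> linarith [a1.1, a1.2, a2.1, a2.2, a3.1, a3.2]

lemma exists_narrow (n m : ℕ) {ε : ℝ} (hε : 0 < ε) (hε1 : ε ≤ 1) : ∃ φ : TestFn (Pt n m),
    (∀ z, 0 ≤ φ z) ∧ ∫ z, φ z = 1 ∧ Narrow ε φ := by
  let f : ContDiffBump (0 : Pt n m) := ⟨ε / 2, ε, by positivity, by linarith⟩
  refine ⟨mk (f.normed volume) f.contDiff_normed f.hasCompactSupport_normed, fun z => f.nonneg_normed z,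
    f.integral_normed, fun z hz => ?_⟩
  have : z ∈ Metric.ball (0 : Pt n m) ε := by
    have := f.support_normed_eq (μ := volume)
    rw [← this]; exact hz
  rw [mem_ball_zero_iff] at this
  exact ⟨((norm_fst_le z).trans this.le).trans hε1, (norm_snd_le z).trans this.le⟩

/-- Local weak solutions can be regularized. -/
theorem exists_regularization {v : Pt n m → ℝ} (hv : Good v) (N s : ℕ) (hn : 1 ≤ n) (hm : 1 ≤ m)
    (hN : 1 ≤ N) (hs : 1 ≤ s) {U : Set (Pt n m)} (hU : IsOpen U)
    (hw : ∀ φ : TestFn (Pt n m), tsupport φ ⊆ U → ∫ z, v z * (gr n m N ^ s) φ z = 0)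
    (χ : TestFn (Pt n m)) (hχ : tsupport χ ⊆ U) {b : Pt n m → ℝ} (hb : MemLp b 2) {ε : ℝ}
    (hε : 0 < ε) : ∃ w : TestFn (Pt n m), ‖w‖ ≤ l2 v ∧ ‖χ * (gr n m N ^ s) w‖ ≤ ε ∧
      |(∫ z, w z * b z) - ∫ z, v z * b z| ≤ ε := by
  obtain ⟨ε1, h1, h1', hG⟩ := growth_gr hv N s hw hU (growthD_zero hv N s hw hn hm hN hs hU) χ hχ
  obtain ⟨δ, hδ, hA⟩ := exists_conv_approx hv hb hε
  have hm0 : 0 < min ε1 δ := lt_min h1 hδ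
  obtain ⟨φ, hφ0, hφ1, hφN⟩ := exists_narrow n m hm0 ((min_le_left _ _).trans h1')
  obtain ⟨C, hC⟩ := hG φ (hφN.mono (min_le_left _ _))
  set R := max (min ε1 δ)⁻¹ (C / ε)
  have hR : 0 < R := (inv_pos.mpr hm0).trans_le (le_max_left _ _)
  have hk0 : ∀ z, 0 ≤ kap φ hR.ne' z := fun z => by
    rw [kap_apply]; exact mul_nonneg (by positivity) (hφ0 _)
  refine ⟨conv v hv (kap φ hR.ne'), ?_, ?_, hA _ hk0 ?_ fun z hz => ?_⟩
  · have := norm_conv_le hv (kap φ hR.ne')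
    simp_rw [abs_of_nonneg (hk0 _)] at this
    rwa [integral_kap φ hR, hφ1, one_mul] at this
  · have := hC R hR ((inv_anti₀ hm0 (min_le_left _ _)).trans (le_max_left _ _))
    rw [pow_zero, mul_one, pow_one, Module.End.mul_apply] at this
    have h2 : C ≤ R * ε := by rw [← div_le_iff₀ hε]; exact le_max_right _ _
    exact le_of_mul_le_mul_left (this.trans h2) hR
  · rw [integral_kap φ hR, hφ1]
  · exact (hφN.kap hR (le_max_left _ _) hm0 hz).trans (min_le_right _ _)

end Grusin

namespace Grusin

open TestFn

variable {n m : ℕ}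

/-- The algebra of operators which do not enlarge supports. -/
def localOps (n m : ℕ) : Subalgebra ℝ (Module.End ℝ (TestFn (Pt n m))) where
  carrier := {P | ∀ φ : TestFn (Pt n m), tsupport (P φ) ⊆ tsupport φ}
  mul_mem' hP hQ φ := (hP _).trans (hQ φ)
  add_mem' hP hQ φ := (closure_mono (Function.support_add _ _)).trans <| by
    rw [closure_union]; exact Set.union_subset (hP φ) (hQ φ)
  algebraMap_mem' c φ := closure_mono (Function.support_const_smul_subset c φ)

lemma op_mem_localOps (l : Letter n m) : l.op ∈ localOps n m := fun φ => by
  simpa [wop] using tsupport_wop [l] φ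

lemma gr_mem_localOps (n m N : ℕ) : gr n m N ∈ localOps n m := by
  have h : ∀ l : Letter n m, l.op ^ 2 ∈ localOps n m := fun l => pow_mem (op_mem_localOps l) 2
  exact sub_mem (neg_mem (sum_mem fun i _ => h (.dx i)))
    (mul_mem (pow_mem (sum_mem fun i _ => h (.x i)) N) (sum_mem fun k _ => h (.dy k)))

lemma tsupport_gr_pow (N s : ℕ) (φ : TestFn (Pt n m)) :
    tsupport ((gr n m N ^ s) φ) ⊆ tsupport φ := pow_mem (gr_mem_localOps n m N) s φ

/-- The open box of radius `r` adapted to the Grušin geometry. -/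
def Box (N : ℕ) (z0 : Pt n m) (r : ℝ) : Set (Pt n m) :=
  {z | ‖z.1 - z0.1‖ < r ∧ ‖z.2 - z0.2‖ < r * (r + ‖z0.1‖) ^ N}

lemma isOpen_Box (N : ℕ) (z0 : Pt n m) (r : ℝ) : IsOpen (Box N z0 r) :=
  (isOpen_lt (f := fun z : Pt n m => ‖z.1 - z0.1‖) (by fun_prop) continuous_const).inter
    (isOpen_lt (f := fun z : Pt n m => ‖z.2 - z0.2‖) (by fun_prop) continuous_const)

/-- The normalizing factor of a box. -/
noncomputable def jac (N : ℕ) (z0 : Pt n m) (r : ℝ) : ℝ := r ^ n * (r * (r + ‖z0.1‖) ^ N) ^ m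

lemma jac_pos (N : ℕ) (z0 : Pt n m) {r : ℝ} (hr : 0 < r) : 0 < jac N z0 r := by
  have := norm_nonneg z0.1
  unfold jac; positivity

lemma aff_mem_Box_iff (N : ℕ) (z0 : Pt n m) {r : ℝ} (hr : 0 < r) (u : Pt n m) :
    aff z0 r (r * (r + ‖z0.1‖) ^ N) u ∈ Box N z0 r ↔ ‖u‖ < 1 := by
  have hρ : 0 < r * (r + ‖z0.1‖) ^ N := by have := norm_nonneg z0.1; positivity
  rw [Prod.norm_def, max_lt_iff]
  simp only [Box, aff, Set.mem_ofPred_eq, add_sub_cancel_left, norm_smul, Real.norm_eq_abs,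
    abs_of_pos hr, abs_of_pos hρ]
  constructor
  · rintro ⟨h1, h2⟩
    exact ⟨lt_of_mul_lt_mul_left (by linarith) hr.le, lt_of_mul_lt_mul_left (by linarith) hρ.le⟩
  · rintro ⟨h1, h2⟩
    exact ⟨by nlinarith, by nlinarith⟩

lemma l2_indicator_le {v : Pt n m → ℝ} (hv : MemLp v 2) (S : Set (Pt n m)) :
    l2 (S.indicator v) ≤ l2 v :=
  ENNReal.toReal_mono hv.2.ne (eLpNorm_indicator_le v)

/-- The interior estimate for weak solutions: means of weak solutions against functions of
integral zero concentrated near the centre of a box. -/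
theorem exists_abs_integral_mul_le_of_weak (N : ℕ) (hn : 1 ≤ n) (hm : 1 ≤ m) (hN : 1 ≤ N) (s : ℕ)
    (hs : 1 ≤ s) : ∃ C ≥ (0 : ℝ), ∀ v : Pt n m → ℝ, MemLp v 2 → ∀ (z0 : Pt n m) (r : ℝ), 0 < r →
      (∀ φ : TestFn (Pt n m), tsupport φ ⊆ Box N z0 r → ∫ z, v z * (gr n m N ^ s) φ z = 0) →
      ∀ η : ℝ, 0 ≤ η → η ≤ 1 / 4 → ∀ b : Pt n m → ℝ, MemLp b 2 → Integrable b →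
      (∀ z, b z ≠ 0 → ‖z.1 - z0.1‖ ≤ η * r ∧ ‖z.2 - z0.2‖ ≤ η * (r * (r + ‖z0.1‖) ^ N)) →
      ∫ z, b z = 0 →
      |∫ z, v z * b z| ≤ C * η * Real.sqrt ((jac N z0 r)⁻¹) * l2 v * ∫ z, |b z| := by
  obtain ⟨θ, hθ0, hθ1, hθs, O, hO, hKO, hO1⟩ := exists_cutoff (n := n) (m := m)
    (isCompact_closedBall 0 (1 / 4)) (Metric.isOpen_ball (x := 0) (ε := 1))
    (Metric.closedBall_subset_ball (by norm_num))
  set s' := s + (n + 1 + (N + 1) * (m + 1)) with hs'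
  obtain ⟨C, hC, hmain⟩ := exists_abs_integral_mul_le N hn hm hN s' (by omega) θ hθ0 hθ1
    (hθs.trans Metric.ball_subset_closedBall) (1 / 4)
    (fun z hz => hO1 z (hKO (by simpa using hz)))
  refine ⟨C, hC, fun v hv z0 r hr hw η hη0 hη b hb hbi hbs hb0 => ?_⟩
  set ρ := r + ‖z0.1‖ with hρ
  have hρ0 : 0 < ρ := by have := norm_nonneg z0.1; positivity
  set σ := r * ρ ^ N with hσ
  have hσ0 : 0 < σ := by positivity
  have hJ0 : 0 < r ^ n * σ ^ m := by positivity
  set S : Set (Pt n m) := affHomeo z0 hr.ne' hσ0.ne' '' Metric.closedBall 0 1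
  have hS : IsCompact S := (isCompact_closedBall 0 1).image (affHomeo z0 hr.ne' hσ0.ne').continuous
  have hBS : Box N z0 r ⊆ S := fun z hz => by
    refine ⟨aff (-(r⁻¹ • z0.1), -(σ⁻¹ • z0.2)) r⁻¹ σ⁻¹ z, ?_, aff_aff z0 hr.ne' hσ0.ne' z⟩
    rw [mem_closedBall_zero_iff]
    refine ((aff_mem_Box_iff N z0 hr _).mp ?_).le
    rwa [aff_aff z0 hr.ne' hσ0.ne']
  have hvS : MemLp (S.indicator v) 2 := hv.indicator hS.measurableSet
  have hg : Good (S.indicator v) := by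
    refine ⟨?_, ?_, hvS⟩
    · rw [integrable_indicator_iff hS.measurableSet]
      have : IsFiniteMeasure (volume.restrict S) := ⟨by simpa using hS.measure_lt_top⟩
      exact (hv.restrict S).integrable (by norm_num)
    · exact HasCompactSupport.intro hS fun z hz => by simp [hz]
  have hw' : ∀ φ : TestFn (Pt n m), tsupport φ ⊆ Box N z0 r →
      ∫ z, S.indicator v z * (gr n m N ^ s') φ z = 0 := by
    intro φ hφ
    have h1 := hw ((gr n m N ^ (n + 1 + (N + 1) * (m + 1))) φ) ((tsupport_gr_pow _ _ _).trans hφ)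
    rw [← Module.End.mul_apply, ← pow_add] at h1
    rw [← h1]
    refine integral_congr_ae (Filter.Eventually.of_forall fun z => ?_)
    by_cases hz : z ∈ S
    · simp [hz, hs']
    · have : (gr n m N ^ s') φ z = 0 := image_eq_zero_of_notMem_tsupport fun h =>
        hz (hBS (hφ (tsupport_gr_pow _ _ _ h)))
      simp only [← hs', this, mul_zero]
  obtain ⟨χ, hχ⟩ := pull_surjective z0 hr.ne' hσ0.ne' (tpow θ (2 * s'))
  have hχs : tsupport χ ⊆ Box N z0 r := by
    have h1 : tsupport χ ⊆ affHomeo z0 hr.ne' hσ0.ne' '' tsupport θ := by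
      refine closure_minimal (fun z hz => ?_)
        ((affHomeo z0 hr.ne' hσ0.ne').isClosedMap _ (isClosed_tsupport _))
      refine ⟨aff (-(r⁻¹ • z0.1), -(σ⁻¹ • z0.2)) r⁻¹ σ⁻¹ z, subset_tsupport _ fun h0 => hz ?_,
        aff_aff z0 hr.ne' hσ0.ne' z⟩
      have := congrArg (fun ψ : TestFn (Pt n m) => ψ (aff (-(r⁻¹ • z0.1), -(σ⁻¹ • z0.2)) r⁻¹ σ⁻¹ z)) hχ
      simp only [pull_apply, aff_aff z0 hr.ne' hσ0.ne', tpow_apply, h0] at this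
      simpa using this
    rintro z hz
    obtain ⟨u, hu, rfl⟩ := h1 hz
    exact (aff_mem_Box_iff N z0 hr u).mpr (by simpa using hθs hu)
  have hlv := l2_indicator_le hv S
  have hvb : ∫ z, S.indicator v z * b z = ∫ z, v z * b z := by
    refine integral_congr_ae (Filter.Eventually.of_forall fun z => ?_)
    by_cases hz : b z = 0
    · simp [hz]
    · have : z ∈ Box N z0 r := ⟨by have := (hbs z hz).1; nlinarith, by have := (hbs z hz).2; nlinarith⟩
      simp [hBS this]
  set Jr := Real.sqrt ((r ^ n * σ ^ m)⁻¹)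
  have hI0 : 0 ≤ ∫ z, |b z| := integral_nonneg fun _ => abs_nonneg _
  set A := C * η * Jr * l2 v * ∫ z, |b z| with hA
  set B := C * η * Jr * (r ^ 2) ^ s' * ∫ z, |b z| with hB
  have hB0 : 0 ≤ B := by positivity
  have step : ∀ ε : ℝ, 0 < ε → |∫ z, v z * b z| ≤ A + ε * (B + 1) := by
    intro ε hε
    obtain ⟨w, hw1, hw2, hw3⟩ := exists_regularization hg N s' hn hm hN (by omega) (isOpen_Box N z0 r)
      hw' χ hχs hb hε
    rw [hvb] at hw3
    have hbc : ∫ u, b (aff z0 r σ u) = 0 := by rw [integral_comp_aff z0 hr hσ0, hb0, mul_zero]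
    have hbi' : Integrable fun u => b (aff z0 r σ u) := by
      have he := (affHomeo z0 hr.ne' hσ0.ne').measurableEmbedding.integrable_map_iff
        (μ := (volume : Measure (Pt n m))) (g := b)
      refine he.mp ?_
      change Integrable b (volume.map (aff z0 r σ))
      rw [map_aff z0 hr hσ0]
      exact hbi.smul_measure ENNReal.ofReal_ne_top
    have hbs' : ∀ u, η < ‖u‖ → b (aff z0 r σ u) = 0 := by
      intro u hu
      by_contra h
      obtain ⟨h1, h2⟩ := hbs _ h
      simp only [aff, add_sub_cancel_left, norm_smul, Real.norm_eq_abs, abs_of_pos hr,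
        abs_of_pos hσ0] at h1 h2
      refine hu.not_ge (max_le ?_ ?_)
      · exact le_of_mul_le_mul_left (by linarith) hr
      · exact le_of_mul_le_mul_left (by linarith) hσ0
    have h1 := hmain (r / ρ) (ρ⁻¹ • z0.1) (by positivity)
      (by rw [norm_smul, Real.norm_eq_abs, abs_of_pos (inv_pos.mpr hρ0), hρ]; field_simp)
      (pull z0 hr.ne' hσ0.ne' w) η hη _ hbi' hbs' hbc
    have h2 : ∫ u, pull z0 hr.ne' hσ0.ne' w u * b (aff z0 r σ u) =
        (r ^ n * σ ^ m)⁻¹ * ∫ z, w z * b z := integral_comp_aff z0 hr hσ0 fun z => w z * b z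
    have h3 : ∫ u, |b (aff z0 r σ u)| = (r ^ n * σ ^ m)⁻¹ * ∫ z, |b z| :=
      integral_comp_aff z0 hr hσ0 fun z => |b z|
    have h4 : tpow θ (2 * s') * (ngr (r / ρ) (ρ⁻¹ • z0.1) m N ^ s') (pull z0 hr.ne' hσ0.ne' w) =
        (r ^ 2) ^ s' • pull z0 hr.ne' hσ0.ne' (χ * (gr n m N ^ s') w) := by
      rw [ngr_pow_pull N s' z0 hr.ne' hρ0.ne' w, ← hχ]
      ext u
      simp [pull_apply]; ring
    rw [h2, h3, h4, norm_pull z0 hr hσ0, norm_smul, norm_pull z0 hr hσ0, abs_mul,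
      abs_of_pos (inv_pos.mpr hJ0), Real.norm_eq_abs, abs_of_nonneg (by positivity : 0 ≤ (r ^ 2) ^ s')] at h1
    have h5 : |∫ z, w z * b z| ≤ C * η * (Jr * ‖w‖ + (r ^ 2) ^ s' * (Jr * ‖χ * (gr n m N ^ s') w‖)) *
        ∫ z, |b z| := by
      refine le_of_mul_le_mul_left (h1.trans_eq ?_) (inv_pos.mpr hJ0)
      ring
    have h6 : C * η * (Jr * ‖w‖ + (r ^ 2) ^ s' * (Jr * ‖χ * (gr n m N ^ s') w‖)) * ∫ z, |b z| ≤
        C * η * (Jr * l2 v + (r ^ 2) ^ s' * (Jr * ε)) * ∫ z, |b z| := by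
      have := hw1.trans hlv
      gcongr
    have h7 := abs_sub_abs_le_abs_sub (∫ z, v z * b z) (∫ z, w z * b z)
    rw [abs_sub_comm] at h7
    have h8 : C * η * (Jr * l2 v + (r ^ 2) ^ s' * (Jr * ε)) * ∫ z, |b z| = A + ε * B := by
      rw [hA, hB]; ring
    linarith
  refine le_of_forall_pos_le_add fun δ hδ => ?_
  refine (step (δ / (B + 1)) (by positivity)).trans_eq ?_
  rw [div_mul_cancel₀ _ (by positivity)]
  rfl

end Grusin

/-- A map dominated by another map factors through a bounded operator of the Hilbert space. -/
lemma LinearMap.exists_clm_of_norm_le {E H : Type*} [AddCommGroup E] [Module ℝ E]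
    [NormedAddCommGroup H] [InnerProductSpace ℝ H] [CompleteSpace H] (e f : E →ₗ[ℝ] H) {C : ℝ}
    (h : ∀ x, ‖f x‖ ≤ C * ‖e x‖) : ∃ T : H →L[ℝ] H, ∀ x, T (e x) = f x := by
  set K := (LinearMap.range e).topologicalClosure with hK
  have hmem : ∀ x, e x ∈ K := fun x => Submodule.le_topologicalClosure _ ⟨x, rfl⟩
  have : CompleteSpace K := (Submodule.isClosed_topologicalClosure _).completeSpace_coe
  set e' : E →ₗ[ℝ] K := e.codRestrict K hmem
  have hd : DenseRange e' := by
    intro y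
    rw [closure_subtype]
    have : Subtype.val '' Set.range e' = (LinearMap.range e : Set H) := by
      ext z; constructor
      · rintro ⟨_, ⟨x, rfl⟩, rfl⟩; exact ⟨x, rfl⟩
      · rintro ⟨x, rfl⟩; exact ⟨e' x, ⟨x, rfl⟩, rfl⟩
    rw [this]
    exact y.2
  have hn : ∃ C, ∀ x, ‖f x‖ ≤ C * ‖e' x‖ := ⟨C, h⟩
  refine ⟨(f.extendOfNorm e').comp K.orthogonalProjectionOnto, fun x => ?_⟩
  have h1 : K.orthogonalProjectionOnto (e x) = e' x :=
    Submodule.orthogonalProjectionOnto_mem_subspace_eq_self (K := K) ⟨e x, hmem x⟩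
  rw [ContinuousLinearMap.comp_apply, h1, LinearMap.extendOfNorm_eq hd hn]

namespace Grusin

open TestFn

variable {n m : ℕ}

/-- The class of a test function in `L²`. -/
noncomputable def toL2 : TestFn (Pt n m) →ₗ[ℝ] Lp ℝ 2 (volume : Measure (Pt n m)) where
  toFun φ := (φ.memLp 2).toLp φ
  map_add' _ _ := rfl
  map_smul' _ _ := rfl

lemma norm_toLp_eq_l2 {v : Pt n m → ℝ} (hv : MemLp v 2) : ‖hv.toLp v‖ = l2 v := Lp.norm_toLp _ _

lemma norm_toL2 (φ : TestFn (Pt n m)) : ‖toL2 φ‖ = ‖φ‖ := by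
  rw [← l2_testFn]; exact norm_toLp_eq_l2 (φ.memLp 2)

lemma norm_Lp_eq_l2 (v : Lp ℝ 2 (volume : Measure (Pt n m))) : ‖v‖ = l2 v := rfl

lemma inner_toLp_right (v : Lp ℝ 2 (volume : Measure (Pt n m))) {g : Pt n m → ℝ} (hg : MemLp g 2) :
    inner ℝ v (hg.toLp g) = ∫ z, v z * g z := by
  rw [L2.inner_def]
  refine integral_congr_ae ?_
  filter_upwards [hg.coeFn_toLp] with z h1
  rw [h1]; simp [mul_comm]

/-- The off-diagonal bound satisfied by a singular integral operator. -/
def OffDiag (N : ℕ) (T : Lp ℝ 2 (volume : Measure (Pt n m)) →L[ℝ] Lp ℝ 2 (volume : Measure (Pt n m)))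
    (C : ℝ) : Prop :=
  ∀ (z0 : Pt n m) (r : ℝ), 0 < r → ∀ ψ : Pt n m → ℝ, MemLp ψ 2 → (∀ z ∈ Box N z0 r, ψ z = 0) →
    ∀ η : ℝ, 0 ≤ η → η ≤ 1 / 4 → ∀ (b : Pt n m → ℝ) (hb : MemLp b 2), Integrable b →
    (∀ z, b z ≠ 0 → ‖z.1 - z0.1‖ ≤ η * r ∧ ‖z.2 - z0.2‖ ≤ η * (r * (r + ‖z0.1‖) ^ N)) →
    ∫ z, b z = 0 →
    |∫ z, T (hb.toLp b) z * ψ z| ≤ C * η * Real.sqrt ((jac N z0 r)⁻¹) * l2 ψ * ∫ z, |b z|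

/-- The `L²` extension of a homogeneous operator, with its off-diagonal bound. -/
theorem exists_extension_offDiag (N : ℕ) (hn : 1 ≤ n) (hm : 1 ≤ m) (hN : 1 ≤ N) (s : ℕ)
    (hs : 1 ≤ s) (P : Module.End ℝ (TestFn (Pt n m))) (hP : P ∈ localOps n m) {C0 : ℝ}
    (hC0 : ∀ φ, ‖P φ‖ ≤ C0 * ‖(gr n m N ^ s) φ‖) :
    ∃ T : Lp ℝ 2 (volume : Measure (Pt n m)) →L[ℝ] Lp ℝ 2 (volume : Measure (Pt n m)),
      (∀ φ, T (toL2 ((gr n m N ^ s) φ)) = toL2 (P φ)) ∧ ∃ C ≥ (0 : ℝ), OffDiag N T C := by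
  obtain ⟨T, hT⟩ := LinearMap.exists_clm_of_norm_le (toL2 ∘ₗ (gr n m N ^ s)) (toL2 ∘ₗ P) (C := C0)
    (fun φ => by simpa [norm_toL2] using hC0 φ)
  obtain ⟨C, hC, hB⟩ := exists_abs_integral_mul_le_of_weak N hn hm hN s hs
  refine ⟨T, hT, C * ‖T‖, by positivity, ?_⟩
  intro z0 r hr ψ hψ hψ0 η hη0 hη b hb hbi hbs hb0
  set v := T.adjoint (hψ.toLp ψ) with hv
  have h1 : ∫ z, T (hb.toLp b) z * ψ z = ∫ z, v z * b z := by
    rw [← inner_toLp_right, ← inner_toLp_right, hv, ContinuousLinearMap.adjoint_inner_left,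
      real_inner_comm]
  have h2 : l2 v ≤ ‖T‖ * l2 ψ := by
    rw [← norm_Lp_eq_l2, ← norm_toLp_eq_l2 hψ, ← ContinuousLinearMap.adjoint.norm_map T]
    exact T.adjoint.le_opNorm _
  have hw : ∀ φ : TestFn (Pt n m), tsupport φ ⊆ Box N z0 r → ∫ z, v z * (gr n m N ^ s) φ z = 0 := by
    intro φ hφ
    have e1 : ∫ z, v z * (gr n m N ^ s) φ z = inner ℝ v (toL2 ((gr n m N ^ s) φ)) :=
      (inner_toLp_right v (((gr n m N ^ s) φ).memLp 2)).symm
    have e2 : T (toL2 ((gr n m N ^ s) φ)) = toL2 (P φ) := hT φ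
    have e3 : inner ℝ (toL2 (P φ)) (hψ.toLp ψ) = ∫ z, P φ z * ψ z := by
      rw [inner_toLp_right]
      refine integral_congr_ae ?_
      filter_upwards [((P φ).memLp 2).coeFn_toLp] with z hz
      rw [← hz]; rfl
    rw [e1, hv, ContinuousLinearMap.adjoint_inner_left, e2, real_inner_comm, e3]
    refine integral_eq_zero_of_ae (Filter.Eventually.of_forall fun z => ?_)
    by_cases hz : z ∈ Box N z0 r
    · simp [hψ0 z hz]
    · simp [image_eq_zero_of_notMem_tsupport fun h => hz (hφ (hP φ h))]
  rw [h1]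
  refine (hB v (Lp.memLp v) z0 r hr hw η hη0 hη b hb hbi hbs hb0).trans ?_
  have hI0 : 0 ≤ ∫ z, |b z| := integral_nonneg fun _ => abs_nonneg _
  calc _ ≤ C * η * Real.sqrt ((jac N z0 r)⁻¹) * (‖T‖ * l2 ψ) * ∫ z, |b z| := by gcongr
    _ = _ := by ring

lemma volume_Box (N : ℕ) (z0 : Pt n m) {r : ℝ} (hr : 0 < r) :
    volume (Box N z0 r) = ENNReal.ofReal (2 ^ (n + m) * jac N z0 r) := by
  have hσ : 0 < r * (r + ‖z0.1‖) ^ N := by have := norm_nonneg z0.1; positivity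
  have : Box N z0 r = Metric.ball z0.1 r ×ˢ Metric.ball z0.2 (r * (r + ‖z0.1‖) ^ N) := by
    ext z; simp [Box, dist_eq_norm]
  rw [this, Measure.volume_eq_prod, Measure.prod_prod, Real.volume_pi_ball _ hr,
    Real.volume_pi_ball _ hσ, ← ENNReal.ofReal_mul (by positivity)]
  simp only [Fintype.card_fin, jac]
  congr 1
  ring

lemma jac_mul_le (N : ℕ) (z0 : Pt n m) {r κ : ℝ} (hr : 0 < r) (hκ : 1 ≤ κ) :
    jac N z0 (κ * r) ≤ κ ^ (n + m + N * m) * jac N z0 r := by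
  have h0 := norm_nonneg z0.1
  have h1 : κ * r + ‖z0.1‖ ≤ κ * (r + ‖z0.1‖) := by nlinarith
  calc jac N z0 (κ * r) ≤ (κ * r) ^ n * (κ * r * (κ * (r + ‖z0.1‖)) ^ N) ^ m := by
        unfold jac; gcongr
    _ = _ := by unfold jac; generalize r + ‖z0.1‖ = ρ; ring

lemma Box_mono (N : ℕ) (z0 : Pt n m) {r r' : ℝ} (hr : 0 < r) (h : r ≤ r') :
    Box N z0 r ⊆ Box N z0 r' := fun z hz => by
  have h0 := norm_nonneg z0.1
  have h1 : 0 < r' := hr.trans_le h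
  exact ⟨hz.1.trans_le h, hz.2.trans_le (by gcongr)⟩

lemma exists_mem_Box (N : ℕ) (z0 : Pt n m) {r : ℝ} (hr : 0 < r) (z : Pt n m) :
    ∃ k : ℕ, z ∈ Box N z0 (2 ^ k * r) := by
  have h0 := norm_nonneg z0.1
  have hσ : 0 < r * (r + ‖z0.1‖) ^ N := by positivity
  obtain ⟨k, hk⟩ := pow_unbounded_of_one_lt
    (max (‖z.1 - z0.1‖ / r) (‖z.2 - z0.2‖ / (r * (r + ‖z0.1‖) ^ N))) (one_lt_two (α := ℝ))
  rw [max_lt_iff, div_lt_iff₀ hr, div_lt_iff₀ hσ] at hk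
  refine ⟨k, hk.1, hk.2.trans_le ?_⟩
  have : (1 : ℝ) ≤ 2 ^ k := one_le_pow₀ one_le_two
  have : r ≤ 2 ^ k * r := by nlinarith
  calc _ = 2 ^ k * r * (r + ‖z0.1‖) ^ N := by ring
    _ ≤ _ := by gcongr

/-- A unimodular function realizing the integral of the absolute value over a set. -/
lemma lintegral_enorm_le_of_forall {g : Pt n m → ℝ} (hg : MemLp g 2) {A : Set (Pt n m)}
    (hA : MeasurableSet A) {V : ℝ} (hV : 0 ≤ V) (hAV : volume A ≤ ENNReal.ofReal V) {B : ℝ}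
    (h : ∀ ψ : Pt n m → ℝ, MemLp ψ 2 → (∀ z, z ∉ A → ψ z = 0) → l2 ψ ≤ Real.sqrt V →
      |∫ z, g z * ψ z| ≤ B) : ∫⁻ z in A, ‖g z‖ₑ ≤ ENNReal.ofReal B := by
  have hA' : volume A ≠ ⊤ := (hAV.trans_lt ENNReal.ofReal_lt_top).ne
  set ψ0 : Pt n m → ℝ := fun z => g z / |g z|
  set ψ : Pt n m → ℝ := A.indicator ψ0
  have hψ0m : AEStronglyMeasurable ψ0 :=
    (hg.1.aemeasurable.div (measurable_norm.comp_aemeasurable hg.1.aemeasurable)).aestronglyMeasurable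
  have hψ1 : ∀ z, ‖ψ z‖ ≤ A.indicator (fun _ => (1 : ℝ)) z := by
    intro z
    by_cases hz : z ∈ A
    · simp [ψ, ψ0, hz]; exact div_self_le_one _
    · simp [ψ, hz]
  have hc : MemLp (A.indicator fun _ => (1 : ℝ)) 2 := memLp_indicator_const 2 hA 1 (Or.inr hA')
  have hψm : MemLp ψ 2 := hc.of_le (hψ0m.indicator hA) (Filter.Eventually.of_forall fun z =>
    (hψ1 z).trans (le_abs_self _))
  have hl : l2 ψ ≤ Real.sqrt V := by
    have h1 : eLpNorm ψ 2 ≤ ENNReal.ofReal (Real.sqrt V) := by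
      refine (eLpNorm_mono_real hψ1).trans ?_
      rw [eLpNorm_indicator_const hA (by norm_num) (by norm_num)]
      simp only [enorm_one, one_mul, ENNReal.toReal_ofNat]
      rw [Real.sqrt_eq_rpow, ← ENNReal.ofReal_rpow_of_nonneg hV (by norm_num)]
      gcongr
    exact ENNReal.toReal_le_of_le_ofReal (Real.sqrt_nonneg _) h1
  have h2 : ∀ z, g z * ψ z = A.indicator (fun z => ‖g z‖) z := by
    intro z
    by_cases hz : z ∈ A
    · simp only [ψ, ψ0, hz, Set.indicator_of_mem, Real.norm_eq_abs]
      by_cases h0 : g z = 0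
      · simp [h0]
      · have : |g z| ≠ 0 := abs_ne_zero.mpr h0
        field_simp
        exact (sq_abs _).symm
    · simp [ψ, hz]
  have h3 := h ψ hψm (fun z hz => by simp [ψ, hz]) hl
  simp_rw [h2] at h3
  rw [integral_indicator hA] at h3
  have h4 : Integrable g (volume.restrict A) := by
    have : IsFiniteMeasure (volume.restrict A) := ⟨by simpa using hA'.lt_top⟩
    exact (hg.restrict A).integrable (by norm_num)
  rw [← ofReal_integral_norm_eq_lintegral_enorm h4]
  exact ENNReal.ofReal_le_ofReal ((le_abs_self _).trans h3)

/-- The integral estimate away from the support. -/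
theorem exists_lintegral_compl_Box_le (N : ℕ)
    (T : Lp ℝ 2 (volume : Measure (Pt n m)) →L[ℝ] Lp ℝ 2 (volume : Measure (Pt n m)))
    {C0 : ℝ} (hC0 : 0 ≤ C0) (hT : OffDiag N T C0) : ∃ C ≥ (0 : ℝ), ∀ (z0 : Pt n m) (r : ℝ), 0 < r →
      ∀ (b : Pt n m → ℝ) (hb : MemLp b 2), Integrable b →
      (∀ z, b z ≠ 0 → ‖z.1 - z0.1‖ ≤ r ∧ ‖z.2 - z0.2‖ ≤ r * (r + ‖z0.1‖) ^ N) →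
      ∫ z, b z = 0 → ∫⁻ z in (Box N z0 (4 * r))ᶜ, ‖T (hb.toLp b) z‖ₑ ≤
        ENNReal.ofReal (C * ∫ z, |b z|) := by
  set D : ℝ := 2 ^ (n + m) * 2 ^ (n + m + N * m)
  have hD : 0 < D := by positivity
  refine ⟨C0 * (1 / 4) * Real.sqrt D * 2, by positivity, ?_⟩
  intro z0 r hr b hb hbi hbs hb0
  have hI0 : 0 ≤ ∫ z, |b z| := integral_nonneg fun _ => abs_nonneg _
  have hR : ∀ k : ℕ, 0 < 2 ^ k * (4 * r) := fun k => by positivity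
  set A : ℕ → Set (Pt n m) := fun k => Box N z0 (2 ^ (k + 1) * (4 * r)) \ Box N z0 (2 ^ k * (4 * r))
  have hAm : ∀ k, MeasurableSet (A k) := fun k =>
    (isOpen_Box _ _ _).measurableSet.diff (isOpen_Box _ _ _).measurableSet
  have hcov : (Box N z0 (4 * r))ᶜ ⊆ ⋃ k, A k := by
    intro z hz
    have hex := exists_mem_Box N z0 (by positivity : 0 < 4 * r) z
    classical
    have h1 := Nat.find_spec hex
    have h0 : Nat.find hex ≠ 0 := fun h => hz (by rw [h] at h1; simpa using h1)
    obtain ⟨k, hk⟩ := Nat.exists_eq_succ_of_ne_zero h0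
    refine Set.mem_iUnion.mpr ⟨k, ?_, Nat.find_min hex (by omega)⟩
    rw [hk] at h1; exact h1
  have hk : ∀ k : ℕ, ∫⁻ z in A k, ‖T (hb.toLp b) z‖ₑ ≤
      ENNReal.ofReal (C0 * (1 / 4) * Real.sqrt D * (∫ z, |b z|) * (1 / 2) ^ k) := by
    intro k
    set R := 2 ^ k * (4 * r) with hRdef
    have hJ : 0 < jac N z0 R := jac_pos N z0 (hR k)
    have hV : volume (A k) ≤ ENNReal.ofReal (D * jac N z0 R) := by
      refine (measure_mono Set.sdiff_subset).trans ?_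
      rw [volume_Box N z0 (hR (k + 1))]
      refine ENNReal.ofReal_le_ofReal ?_
      have := jac_mul_le (n := n) (m := m) N z0 (hR k) one_le_two
      rw [show (2 : ℝ) ^ (k + 1) * (4 * r) = 2 * (2 ^ k * (4 * r)) by ring]
      calc _ ≤ (2 : ℝ) ^ (n + m) * (2 ^ (n + m + N * m) * jac N z0 R) := by gcongr
        _ = _ := by ring
    refine lintegral_enorm_le_of_forall (Lp.memLp _) (hAm k) (by positivity) hV fun ψ hψ hψ0 hl => ?_
    have hη : (1 / 4 * (1 / 2) ^ k) * R = r := by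
      rw [hRdef, one_div_pow]; field_simp
    have h1k : (1 : ℝ) ≤ 2 ^ k := one_le_pow₀ one_le_two
    have hrR : r ≤ R := by rw [hRdef]; nlinarith
    refine (hT z0 R (hR k) ψ hψ (fun z hz => hψ0 z fun h => h.2 hz) (1 / 4 * (1 / 2) ^ k)
      (by positivity) ?_ b hb hbi (fun z hz => ?_) hb0).trans ?_
    · have : (1 / 2 : ℝ) ^ k ≤ 1 := pow_le_one₀ (by norm_num) (by norm_num)
      linarith
    · rw [← mul_assoc (1 / 4 * (1 / 2) ^ k) R, hη]
      refine ⟨(hbs z hz).1, (hbs z hz).2.trans ?_⟩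
      have := norm_nonneg z0.1
      gcongr
    · have : Real.sqrt ((jac N z0 R)⁻¹) * l2 ψ ≤ Real.sqrt D := by
        calc _ ≤ Real.sqrt ((jac N z0 R)⁻¹) * Real.sqrt (D * jac N z0 R) := by gcongr
          _ = Real.sqrt D := by
            rw [← Real.sqrt_mul (by positivity)]; congr 1; field_simp
      calc _ = C0 * (1 / 4 * (1 / 2) ^ k) * (Real.sqrt ((jac N z0 R)⁻¹) * l2 ψ) * ∫ z, |b z| := by ring
        _ ≤ C0 * (1 / 4 * (1 / 2) ^ k) * Real.sqrt D * ∫ z, |b z| := by gcongr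
        _ = _ := by ring
  calc _ ≤ ∫⁻ z in ⋃ k, A k, ‖T (hb.toLp b) z‖ₑ := lintegral_mono_set hcov
    _ ≤ ∑' k, ∫⁻ z in A k, ‖T (hb.toLp b) z‖ₑ := lintegral_iUnion_le _ _
    _ ≤ ∑' k : ℕ, ENNReal.ofReal (C0 * (1 / 4) * Real.sqrt D * (∫ z, |b z|) * (1 / 2) ^ k) :=
      ENNReal.tsum_le_tsum hk
    _ = ENNReal.ofReal (∑' k : ℕ, C0 * (1 / 4) * Real.sqrt D * (∫ z, |b z|) * (1 / 2) ^ k) :=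
      (ENNReal.ofReal_tsum_of_nonneg (fun k => by positivity)
        (summable_geometric_two.mul_left _)).symm
    _ = _ := by
      rw [tsum_mul_left, tsum_geometric_two]; congr 1; ring

end Grusin

namespace Grusin

open TestFn

variable {n m : ℕ}

/-- The Lebesgue measure of a box. -/
noncomputable def boxVol (N : ℕ) (z0 : Pt n m) (r : ℝ) : ℝ := 2 ^ (n + m) * jac N z0 r

lemma boxVol_pos (N : ℕ) (z0 : Pt n m) {r : ℝ} (hr : 0 < r) : 0 < boxVol N z0 r :=
  mul_pos (by positivity) (jac_pos N z0 hr)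

lemma volume_Box_real (N : ℕ) (z0 : Pt n m) {r : ℝ} (hr : 0 < r) :
    volume.real (Box N z0 r) = boxVol N z0 r := by
  rw [Measure.real, volume_Box N z0 hr]
  exact ENNReal.toReal_ofReal (boxVol_pos N z0 hr).le

lemma volume_Box_ne_top (N : ℕ) (z0 : Pt n m) {r : ℝ} (hr : 0 < r) :
    volume (Box N z0 r) ≠ ⊤ := by rw [volume_Box N z0 hr]; exact ENNReal.ofReal_ne_top

lemma boxVol_mul_le (N : ℕ) (z0 : Pt n m) {r κ : ℝ} (hr : 0 < r) (hκ : 1 ≤ κ) :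
    boxVol N z0 (κ * r) ≤ κ ^ (n + m + N * m) * boxVol N z0 r := by
  have := jac_mul_le N z0 hr hκ
  calc _ ≤ 2 ^ (n + m) * (κ ^ (n + m + N * m) * jac N z0 r) := by unfold boxVol; gcongr
    _ = _ := by unfold boxVol; ring

lemma mem_Box_self (N : ℕ) (z0 : Pt n m) {r : ℝ} (hr : 0 < r) : z0 ∈ Box N z0 r := by
  have := norm_nonneg z0.1
  exact ⟨by simpa using hr, by simpa using (by positivity : 0 < r * (r + ‖z0.1‖) ^ N)⟩

lemma exists_Box_subset_ball (N : ℕ) (z0 : Pt n m) {δ : ℝ} (hδ : 0 < δ) :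
    ∃ r > 0, Box N z0 r ⊆ Metric.ball z0 δ := by
  have hc : Continuous fun r : ℝ => max r (r * (r + ‖z0.1‖) ^ N) := by fun_prop
  have h0 : (fun r : ℝ => max r (r * (r + ‖z0.1‖) ^ N)) 0 < δ := by simpa using hδ
  have h1 : ∀ᶠ r : ℝ in nhdsWithin 0 (Set.Ioi 0), max r (r * (r + ‖z0.1‖) ^ N) < δ :=
    nhdsWithin_le_nhds (hc.continuousAt.eventually_lt continuousAt_const h0)
  obtain ⟨r, hr, hr0⟩ := (h1.and self_mem_nhdsWithin).exists
  refine ⟨r, hr0, fun z hz => ?_⟩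
  rw [max_lt_iff] at hr
  rw [Metric.mem_ball, dist_eq_norm, Prod.norm_def, max_lt_iff]
  exact ⟨hz.1.trans hr.1, hz.2.trans hr.2⟩

/-- The stopping radius at a point where the function is large. -/
lemma exists_stopping_radius (N : ℕ) (hn : 1 ≤ n) {f : Pt n m → ℝ} (hf : Continuous f)
    (hfi : Integrable f) {lam : ℝ} (hl : 0 < lam) (z : Pt n m) (hz : 2 * lam ≤ |f z|) :
    ∃ r > 0, lam * boxVol N z r < ∫ w in Box N z r, |f w| ∧
      ∀ r', 2 * r ≤ r' → ∫ w in Box N z r', |f w| ≤ lam * boxVol N z r' := by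
  set S : Set ℝ := {r | 0 < r ∧ lam * boxVol N z r < ∫ w in Box N z r, |f w|} with hS
  have hne : S.Nonempty := by
    have h1 : ∀ᶠ w in nhds z, 3 / 2 * lam < |f w| :=
      continuousAt_const.eventually_lt hf.abs.continuousAt (by linarith)
    obtain ⟨δ, hδ, hδ'⟩ := Metric.eventually_nhds_iff_ball.mp h1
    obtain ⟨r, hr, hrB⟩ := exists_Box_subset_ball N z hδ
    refine ⟨r, hr, ?_⟩
    have hV := boxVol_pos N z hr
    have h2 : ∫ w in Box N z r, 3 / 2 * lam ≤ ∫ w in Box N z r, |f w| :=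
      setIntegral_mono_on (integrableOn_const (volume_Box_ne_top N z hr)) hfi.abs.integrableOn
        (isOpen_Box N z r).measurableSet fun w hw => (hδ' w (hrB hw)).le
    rw [setIntegral_const, volume_Box_real N z hr, smul_eq_mul] at h2
    have := mul_pos hl hV
    linarith
  have hbd : BddAbove S := by
    refine ⟨max 1 ((∫ w, |f w|) / lam), ?_⟩
    rintro r ⟨hr, hr'⟩
    by_contra! h
    rw [max_lt_iff, div_lt_iff₀ hl] at h
    have h1 : ∫ w in Box N z r, |f w| ≤ ∫ w, |f w| :=
      setIntegral_le_integral hfi.abs (Filter.Eventually.of_forall fun _ => abs_nonneg _)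
    have h2 : r ≤ boxVol N z r := by
      have h0 := norm_nonneg z.1
      have e1 : r ≤ r ^ n := le_self_pow₀ h.1.le (by omega)
      have e2 : 1 ≤ (r * (r + ‖z.1‖) ^ N) ^ m := by
        refine one_le_pow₀ ?_
        have : 1 ≤ (r + ‖z.1‖) ^ N := one_le_pow₀ (by linarith)
        nlinarith [h.1]
      have e3 : (1 : ℝ) ≤ 2 ^ (n + m) := one_le_pow₀ one_le_two
      calc r = 1 * (r * 1) := by ring
        _ ≤ 2 ^ (n + m) * (r ^ n * (r * (r + ‖z.1‖) ^ N) ^ m) := by gcongr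
        _ = _ := rfl
    nlinarith
  have hpos : 0 < sSup S := by
    obtain ⟨r, hr⟩ := hne
    exact hr.1.trans_le (le_csSup hbd hr)
  obtain ⟨r, hr, hr'⟩ := exists_lt_of_lt_csSup hne (half_lt_self hpos)
  refine ⟨r, hr.1, hr.2, fun r' h => ?_⟩
  by_contra! hc
  have : r' ≤ sSup S := le_csSup hbd ⟨by linarith [hr.1], hc⟩
  linarith

lemma Box_subset_of_inter (N : ℕ) {a b : Pt n m} {ra rb : ℝ} (ha : 0 < ra) (hb : 0 < rb)
    (h : (Box N a ra ∩ Box N b rb).Nonempty) (hab : ra ≤ 2 * rb) :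
    Box N a ra ⊆ Box N b ((4 * 5 ^ N + 1) * rb) := by
  obtain ⟨p, ⟨ha1, ha2⟩, hb1, hb2⟩ := h
  rintro w ⟨hw1, hw2⟩
  have h0 := norm_nonneg b.1
  have h0' := norm_nonneg a.1
  have h5 : (1 : ℝ) ≤ 5 ^ N := one_le_pow₀ (by norm_num)
  have t1 : ‖w.1 - b.1‖ ≤ ‖w.1 - a.1‖ + ‖p.1 - a.1‖ + ‖p.1 - b.1‖ := by
    calc _ = ‖(w.1 - a.1) - (p.1 - a.1) + (p.1 - b.1)‖ := by congr 1; abel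
      _ ≤ _ := (norm_add_le _ _).trans (by gcongr; exact norm_sub_le _ _)
  have t2 : ‖w.2 - b.2‖ ≤ ‖w.2 - a.2‖ + ‖p.2 - a.2‖ + ‖p.2 - b.2‖ := by
    calc _ = ‖(w.2 - a.2) - (p.2 - a.2) + (p.2 - b.2)‖ := by congr 1; abel
      _ ≤ _ := (norm_add_le _ _).trans (by gcongr; exact norm_sub_le _ _)
  have t3 : ‖a.1‖ ≤ ‖b.1‖ + ‖p.1 - a.1‖ + ‖p.1 - b.1‖ := by
    calc ‖a.1‖ = ‖b.1 - (p.1 - a.1) + (p.1 - b.1)‖ := by congr 1; abel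
      _ ≤ _ := (norm_add_le _ _).trans (by gcongr; exact norm_sub_le _ _)
  refine ⟨?_, ?_⟩
  · nlinarith
  · have e1 : (ra + ‖a.1‖) ^ N ≤ 5 ^ N * (rb + ‖b.1‖) ^ N := by
      rw [← mul_pow]; gcongr; linarith
    have e2 : ra * (ra + ‖a.1‖) ^ N ≤ 2 * rb * (5 ^ N * (rb + ‖b.1‖) ^ N) := by gcongr
    have e3 : rb ≤ (4 * 5 ^ N + 1) * rb := by nlinarith
    calc ‖w.2 - b.2‖ < (4 * 5 ^ N + 1) * rb * (rb + ‖b.1‖) ^ N := by linarith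
      _ ≤ _ := by gcongr

/-- A finite Vitali covering by boxes. -/
lemma exists_finset_disjoint_Box (N : ℕ) {K : Set (Pt n m)} (hK : IsCompact K) (r : Pt n m → ℝ)
    (hr : ∀ z, 0 < r z) : ∃ u : Finset (Pt n m), ↑u ⊆ K ∧
      (u : Set (Pt n m)).PairwiseDisjoint (fun z => Box N z (r z)) ∧
      ∀ z ∈ K, ∃ a ∈ u, z ∈ Box N a ((4 * 5 ^ N + 1) * r a) := by
  obtain ⟨t, htK, hcov⟩ := hK.elim_nhds_subcover (fun z => Box N z (r z)) fun z _ =>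
    (isOpen_Box N z (r z)).mem_nhds (mem_Box_self N z (hr z))
  obtain ⟨u, hut, hd, hu⟩ := Vitali.exists_disjoint_subfamily_covering_enlargement
    (fun z => Box N z (r z)) (t : Set (Pt n m)) r 2 one_lt_two (fun a _ => (hr a).le)
    (∑ a ∈ t, r a) (fun a ha => Finset.single_le_sum (fun i _ => (hr i).le) ha)
    (fun a _ => ⟨a, mem_Box_self N a (hr a)⟩)
  have hfin : u.Finite := t.finite_toSet.subset hut
  refine ⟨hfin.toFinset, ?_, by simpa using hd, fun z hz => ?_⟩
  · intro a ha
    exact htK a (hut (by simpa using ha))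
  · obtain ⟨a, ha, hza⟩ := Set.mem_iUnion₂.mp (hcov hz)
    obtain ⟨b, hb, hne, hab⟩ := hu a ha
    exact ⟨b, by simpa using hb, Box_subset_of_inter N (hr a) (hr b) hne hab hza⟩

lemma sum_indicator_le_one {u : Finset (Pt n m)} {B : Pt n m → Set (Pt n m)}
    (hd : (u : Set (Pt n m)).PairwiseDisjoint B) (z : Pt n m) :
    ∑ i ∈ u, (B i).indicator (fun _ => (1 : ℝ)) z ≤ 1 := by
  by_cases h : ∃ i ∈ u, z ∈ B i
  · obtain ⟨i, hi, hz⟩ := h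
    rw [Finset.sum_eq_single i]
    · simp [hz]
    · intro j hj hji
      exact Set.indicator_of_notMem (fun hzj => Set.disjoint_left.mp (hd hj hi hji) hzj hz) _
    · exact fun h => absurd hi h
  · push Not at h
    rw [Finset.sum_eq_zero fun i hi => Set.indicator_of_notMem (h i hi) _]
    exact zero_le_one

/-- The Calderón–Zygmund decomposition for the boxes of the Grušin geometry. -/
theorem exists_decomposition (n m N : ℕ) (hn : 1 ≤ n) : ∃ C ≥ (0 : ℝ), ∀ f : Pt n m → ℝ,
    Continuous f → HasCompactSupport f → ∀ lam : ℝ, 0 < lam →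
    ∃ (u : Finset (Pt n m)) (R : Pt n m → ℝ) (b : Pt n m → Pt n m → ℝ),
      (∀ i, 0 < R i) ∧ (∀ i, MemLp (b i) 2) ∧ (∀ i, Integrable (b i)) ∧
      (∀ i z, b i z ≠ 0 → ‖z.1 - i.1‖ ≤ R i ∧ ‖z.2 - i.2‖ ≤ R i * (R i + ‖i.1‖) ^ N) ∧
      (∀ i, ∫ z, b i z = 0) ∧ ∑ i ∈ u, ∫ z, |b i z| ≤ 2 * ∫ z, |f z| ∧
      lam * ∑ i ∈ u, boxVol N i (4 * R i) ≤ C * ∫ z, |f z| ∧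
      ∀ z, |f z - ∑ i ∈ u, b i z| ≤ C * lam := by
  set κ : ℝ := 4 * 5 ^ N + 1 with hκ
  have h5 : (1 : ℝ) ≤ 5 ^ N := one_le_pow₀ (by norm_num)
  have hκ2 : 2 ≤ κ := by linarith
  set d := n + m + N * m with hd
  have hκd : (0 : ℝ) ≤ κ ^ d := by positivity
  refine ⟨(4 * κ) ^ d + (2 + κ ^ d), by positivity, fun f hf hfc lam hl => ?_⟩
  have hfi : Integrable f := hf.integrable_of_hasCompactSupport hfc
  have hf2 : MemLp f 2 := hf.memLp_of_hasCompactSupport hfc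
  have hI0 : 0 ≤ ∫ z, |f z| := integral_nonneg fun _ => abs_nonneg _
  have hex : ∀ z : Pt n m, ∃ r > 0, 2 * lam ≤ |f z| → (lam * boxVol N z r < ∫ w in Box N z r, |f w| ∧
      ∀ r', 2 * r ≤ r' → ∫ w in Box N z r', |f w| ≤ lam * boxVol N z r') := by
    intro z
    by_cases hz : 2 * lam ≤ |f z|
    · obtain ⟨r, h0, h⟩ := exists_stopping_radius N hn hf hfi hl z hz
      exact ⟨r, h0, fun _ => h⟩
    · exact ⟨1, one_pos, fun h => absurd h hz⟩
  choose r hr0 hr using hex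
  have hK : IsCompact {z | 2 * lam ≤ |f z|} := by
    refine hfc.isCompact.of_isClosed_subset (isClosed_le continuous_const hf.abs) fun z hz => ?_
    refine subset_tsupport _ fun h => ?_
    have : 2 * lam ≤ |f z| := hz
    rw [h, abs_zero] at this
    linarith
  obtain ⟨u, huK, hdisj, hcov⟩ := exists_finset_disjoint_Box N hK r hr0
  have hm : ∀ (z : Pt n m) (r : ℝ), MeasurableSet (Box N z r) := fun z r =>
    (isOpen_Box N z r).measurableSet
  set χ : Pt n m → Pt n m → ℝ := fun i => (Box N i (κ * r i)).indicator fun _ => 1 with hχ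
  have hχm : ∀ i, Measurable (χ i) := fun i => measurable_const.indicator (hm _ _)
  have hχ0 : ∀ i z, 0 ≤ χ i z := fun i z => Set.indicator_nonneg (fun _ _ => zero_le_one) _
  set wt : Pt n m → Pt n m → ℝ := fun i z => χ i z / max 1 (∑ j ∈ u, χ j z) with hwt
  have hwtm : ∀ i, Measurable (wt i) := fun i => (hχm i).div
    (measurable_const.max (Finset.measurable_fun_sum u fun j _ => hχm j))
  have hwt0 : ∀ i z, 0 ≤ wt i z := fun i z =>
    div_nonneg (hχ0 i z) (zero_le_one.trans (le_max_left _ _))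
  have hwtχ : ∀ i z, wt i z ≤ χ i z := fun i z => div_le_self (hχ0 i z) (le_max_left _ _)
  have hχ1 : ∀ i z, χ i z ≤ 1 := fun i z => Set.indicator_le_self' (fun _ _ => zero_le_one) z
  have hsum0 : ∀ z, 0 ≤ ∑ j ∈ u, χ j z := fun z => Finset.sum_nonneg fun j _ => hχ0 j z
  have hwtsum : ∀ z, ∑ i ∈ u, wt i z ≤ 1 := by
    intro z
    rw [← Finset.sum_div]
    exact div_le_one_of_le₀ (le_max_right _ _) (zero_le_one.trans (le_max_left _ _))
  have hwtsum1 : ∀ z, 2 * lam ≤ |f z| → ∑ i ∈ u, wt i z = 1 := by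
    intro z hz
    obtain ⟨a, ha, hza⟩ := hcov z hz
    have h1 : 1 ≤ ∑ j ∈ u, χ j z := by
      calc (1 : ℝ) = χ a z := (Set.indicator_of_mem (s := Box N a (κ * r a)) hza (fun _ => (1 : ℝ))).symm
        _ ≤ _ := Finset.single_le_sum (f := fun j => χ j z) (fun j _ => hχ0 j z) ha
    rw [← Finset.sum_div, max_eq_right h1, div_self (by linarith)]
  have hwtrest : ∀ z, |f z * (1 - ∑ i ∈ u, wt i z)| ≤ 2 * lam := by
    intro z
    by_cases hz : 2 * lam ≤ |f z|
    · rw [hwtsum1 z hz]; simp; linarith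
    · have h0 : 0 ≤ ∑ i ∈ u, wt i z := Finset.sum_nonneg fun i _ => hwt0 i z
      rw [abs_mul]
      have : |1 - ∑ i ∈ u, wt i z| ≤ 1 := by rw [abs_le]; constructor <;> linarith [hwtsum z]
      push Not at hz
      have h1 := abs_nonneg (f z)
      nlinarith
  set h : Pt n m → Pt n m → ℝ := fun i z => f z * wt i z with hh
  have hhle : ∀ i z, ‖h i z‖ ≤ ‖f z‖ := by
    intro i z
    rw [hh, norm_mul]
    refine mul_le_of_le_one_right (norm_nonneg _) ?_
    rw [Real.norm_eq_abs, abs_of_nonneg (hwt0 i z)]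
    exact (hwtχ i z).trans (hχ1 i z)
  have hhm : ∀ i, AEStronglyMeasurable (h i) := fun i =>
    hf.aestronglyMeasurable.mul (hwtm i).aestronglyMeasurable
  have hh2 : ∀ i, MemLp (h i) 2 := fun i =>
    hf2.of_le (hhm i) (Filter.Eventually.of_forall (hhle i))
  have hhi : ∀ i, Integrable (h i) := fun i =>
    hfi.mono (hhm i) (Filter.Eventually.of_forall (hhle i))
  set β : Pt n m → Pt n m → ℝ := fun i => (Box N i (r i)).indicator fun _ => 1 with hβ
  have hβ2 : ∀ i, MemLp (β i) 2 := fun i =>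
    memLp_indicator_const 2 (hm _ _) 1 (Or.inr (volume_Box_ne_top N i (hr0 i)))
  have hβi : ∀ i, Integrable (β i) := fun i =>
    (integrable_indicator_iff (hm _ _)).mpr (integrableOn_const (volume_Box_ne_top N i (hr0 i)))
  have hβ0 : ∀ i z, 0 ≤ β i z := fun i z => Set.indicator_nonneg (fun _ _ => zero_le_one) _
  have hV := fun i => boxVol_pos N i (hr0 i)
  have hβint : ∀ i, ∫ z, β i z = boxVol N i (r i) := fun i => by
    rw [hβ, integral_indicator (hm _ _), setIntegral_const, volume_Box_real N i (hr0 i),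
      smul_eq_mul, mul_one]
  set c : Pt n m → ℝ := fun i => (∫ z, h i z) / boxVol N i (r i) with hc
  have hcV : ∀ i, |c i| * boxVol N i (r i) ≤ ∫ z, |h i z| := fun i => by
    rw [hc, abs_div, abs_of_pos (hV i), div_mul_cancel₀ _ (hV i).ne']
    exact abs_integral_le_integral_abs
  have hcle : ∀ i ∈ u, |c i| ≤ κ ^ d * lam := by
    intro i hi
    have h1 : ∫ z, |h i z| ≤ ∫ z in Box N i (κ * r i), |f z| := by
      rw [← integral_indicator (hm _ _)]
      refine integral_mono (hhi i).abs (hfi.abs.indicator (hm _ _)) fun z => ?_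
      by_cases hz : z ∈ Box N i (κ * r i)
      · simpa [hz] using hhle i z
      · have : wt i z = 0 := le_antisymm ((hwtχ i z).trans (by simp [hχ, hz])) (hwt0 i z)
        simp [hh, this, hz]
    have h2 := (hr i (huK hi)).2 (κ * r i) (by nlinarith [hr0 i])
    have h3 := boxVol_mul_le N i (hr0 i) (by linarith : 1 ≤ κ)
    refine le_of_mul_le_mul_right ?_ (hV i)
    calc _ ≤ lam * boxVol N i (κ * r i) := (hcV i).trans (h1.trans h2)
      _ ≤ lam * (κ ^ d * boxVol N i (r i)) := by gcongr
      _ = _ := by ring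
  have hhsum : ∑ i ∈ u, ∫ z, |h i z| ≤ ∫ z, |f z| := by
    rw [← integral_finsetSum _ fun i _ => (hhi i).abs]
    refine integral_mono (integrable_finsetSum _ fun i _ => (hhi i).abs) hfi.abs fun z => ?_
    simp only [hh, abs_mul, abs_of_nonneg (hwt0 _ _)]
    rw [← Finset.mul_sum]
    exact mul_le_of_le_one_right (abs_nonneg _) (hwtsum z)
  refine ⟨u, fun i => κ * r i, fun i z => h i z - c i * β i z, fun i => by have := hr0 i; positivity,
    fun i => (hh2 i).sub ((hβ2 i).const_mul _), fun i => (hhi i).sub ((hβi i).const_mul _),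
    fun i z hz => ?_, fun i => ?_, ?_, ?_, fun z => ?_⟩
  · have : z ∈ Box N i (κ * r i) := by
      by_contra hz'
      have h1 : wt i z = 0 := le_antisymm ((hwtχ i z).trans (by simp [hχ, hz'])) (hwt0 i z)
      have h2 : z ∉ Box N i (r i) := fun h =>
        hz' (Box_mono N i (hr0 i) (by nlinarith [hr0 i]) h)
      exact hz (by simp [hh, h1, hβ, h2])
    exact ⟨this.1.le, this.2.le⟩
  · rw [integral_sub (hhi i) ((hβi i).const_mul _), integral_const_mul, hβint, hc,
      div_mul_cancel₀ _ (hV i).ne', sub_self]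
  · have h1 : ∀ i, ∫ z, |h i z - c i * β i z| ≤ 2 * ∫ z, |h i z| := by
      intro i
      calc _ ≤ ∫ z, (|h i z| + |c i| * β i z) := by
            refine integral_mono ((hhi i).sub ((hβi i).const_mul _)).abs
              ((hhi i).abs.add ((hβi i).const_mul _)) fun z => (abs_sub _ _).trans_eq ?_
            rw [abs_mul (c i), abs_of_nonneg (hβ0 i z)]
        _ = (∫ z, |h i z|) + |c i| * boxVol N i (r i) := by
            rw [integral_add (hhi i).abs ((hβi i).const_mul _), integral_const_mul, hβint]
        _ ≤ _ := by linarith [hcV i]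
    calc _ ≤ ∑ i ∈ u, 2 * ∫ z, |h i z| := Finset.sum_le_sum fun i _ => h1 i
      _ ≤ _ := by rw [← Finset.mul_sum]; linarith
  · have h1 : ∑ i ∈ u, ∫ z in Box N i (r i), |f z| ≤ ∫ z, |f z| := by
      simp_rw [← integral_indicator (hm _ _)]
      rw [← integral_finsetSum _ fun i _ => hfi.abs.indicator (hm _ _)]
      refine integral_mono (integrable_finsetSum _ fun i _ => hfi.abs.indicator (hm _ _)) hfi.abs
        fun z => ?_
      have : ∀ i, (Box N i (r i)).indicator (fun z => |f z|) z = |f z| * β i z := fun i => by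
        by_cases hz : z ∈ Box N i (r i) <;> simp [hβ, hz]
      simp_rw [this]
      rw [← Finset.mul_sum]
      exact mul_le_of_le_one_right (abs_nonneg _) (sum_indicator_le_one hdisj z)
    have h2 : ∀ i ∈ u, lam * boxVol N i (4 * (κ * r i)) ≤
        (4 * κ) ^ d * ∫ z in Box N i (r i), |f z| := by
      intro i hi
      have e1 := boxVol_mul_le N i (hr0 i) (by linarith : 1 ≤ 4 * κ)
      have e2 := (hr i (huK hi)).1.le
      rw [← mul_assoc 4 κ]
      calc _ ≤ lam * ((4 * κ) ^ d * boxVol N i (r i)) := by gcongr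
        _ = (4 * κ) ^ d * (lam * boxVol N i (r i)) := by ring
        _ ≤ _ := by gcongr
    rw [Finset.mul_sum]
    calc _ ≤ ∑ i ∈ u, (4 * κ) ^ d * ∫ z in Box N i (r i), |f z| := Finset.sum_le_sum h2
      _ ≤ (4 * κ) ^ d * ∫ z, |f z| := by rw [← Finset.mul_sum]; gcongr
      _ ≤ _ := by nlinarith
  · have e : f z - ∑ i ∈ u, (h i z - c i * β i z) =
        f z * (1 - ∑ i ∈ u, wt i z) + ∑ i ∈ u, c i * β i z := by
      rw [Finset.sum_sub_distrib, hh, ← Finset.mul_sum]; ring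
    have h2 : |∑ i ∈ u, c i * β i z| ≤ κ ^ d * lam := by
      calc _ ≤ ∑ i ∈ u, |c i * β i z| := Finset.abs_sum_le_sum_abs _ _
        _ ≤ ∑ i ∈ u, κ ^ d * lam * β i z := Finset.sum_le_sum fun i hi => by
            rw [abs_mul, abs_of_nonneg (hβ0 i z)]
            exact mul_le_mul_of_nonneg_right (hcle i hi) (hβ0 i z)
        _ ≤ _ := by
            rw [← Finset.mul_sum]
            exact mul_le_of_le_one_right (by positivity) (sum_indicator_le_one hdisj z)
    rw [e]
    have h3 : 0 ≤ (4 * κ) ^ d * lam := by positivity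
    calc _ ≤ 2 * lam + κ ^ d * lam := (abs_add_le _ _).trans (add_le_add (hwtrest z) h2)
      _ ≤ _ := by linarith

end Grusin

namespace Grusin

variable {n m : ℕ}

lemma Lp_norm_sq (v : Lp ℝ 2 (volume : Measure (Pt n m))) : ‖v‖ ^ 2 = ∫ z, v z ^ 2 := by
  rw [← real_inner_self_eq_norm_sq, L2.inner_def]
  refine integral_congr_ae (Filter.Eventually.of_forall fun z => ?_)
  simp [sq]

lemma volume_lt_abs_Lp_le (v : Lp ℝ 2 (volume : Measure (Pt n m))) {a : ℝ} (ha : 0 < a) :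
    volume {z | a < |v z|} ≤ ENNReal.ofReal (‖v‖ ^ 2 / a ^ 2) := by
  have hi : Integrable fun z => v z ^ 2 := (Lp.memLp v).integrable_sq
  have h := meas_ge_le_lintegral_div (μ := volume) (f := fun z => ENNReal.ofReal (v z ^ 2))
    hi.aestronglyMeasurable.aemeasurable.ennreal_ofReal (ε := ENNReal.ofReal (a ^ 2))
    (by simpa using ha.ne') ENNReal.ofReal_ne_top
  rw [← ofReal_integral_eq_lintegral_ofReal hi (Filter.Eventually.of_forall fun z => sq_nonneg _),
    ← Lp_norm_sq, ← ENNReal.ofReal_div_of_pos (by positivity)] at h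
  refine (measure_mono fun z hz => ?_).trans h
  rw [Set.mem_ofPred_eq] at hz ⊢
  rw [← sq_abs (v z)]
  gcongr

/-- The weak-type `(1,1)` bound, by decomposing into a bounded part and atoms of mean zero. -/
theorem exists_volume_lt_abs_le_of_offDiag (N : ℕ) (hn : 1 ≤ n)
    (T : Lp ℝ 2 (volume : Measure (Pt n m)) →L[ℝ] Lp ℝ 2 (volume : Measure (Pt n m)))
    {C0 : ℝ} (hC0 : 0 ≤ C0) (hT : OffDiag N T C0) :
    ∃ c > (0 : ℝ), ∀ f : Pt n m → ℝ, Continuous f → HasCompactSupport f → ∀ hf : MemLp f 2,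
      ∀ lam > (0 : ℝ), volume {z | lam < |T (hf.toLp f) z|} ≤
        ENNReal.ofReal (c / lam * ∫ z, |f z|) := by
  obtain ⟨C1, hC1, h1⟩ := exists_lintegral_compl_Box_le N T hC0 hT
  obtain ⟨C, hC, hdec⟩ := exists_decomposition n m N hn
  refine ⟨4 * ‖T‖ ^ 2 * (3 * C) + C + 4 * C1 + 1, by positivity,
    fun f hfc hfs hf lam hl => ?_⟩
  obtain ⟨u, R, b, hR, hb2, hbi, hbs, hb0, hsum, hvol, hg⟩ := hdec f hfc hfs lam hl
  have hfi : Integrable f := hfc.integrable_of_hasCompactSupport hfs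
  set F := ∫ z, |f z| with hF
  have hF0 : 0 ≤ F := integral_nonneg fun _ => abs_nonneg _
  set v : Lp ℝ 2 (volume : Measure (Pt n m)) := hf.toLp f - ∑ i ∈ u, (hb2 i).toLp (b i) with hv
  have hvae : ∀ᵐ z, v z = f z - ∑ i ∈ u, b i z := by
    have hae : ∀ᵐ z, ∀ i ∈ u, (hb2 i).toLp (b i) z = b i z :=
      (ae_ball_iff u.countable_toSet).mpr fun i _ => (hb2 i).coeFn_toLp
    filter_upwards [Lp.coeFn_sub (hf.toLp f) (∑ i ∈ u, (hb2 i).toLp (b i)), hf.coeFn_toLp, hae,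
      Lp.coeFn_fun_finsetSum u fun i => (hb2 i).toLp (b i)] with z e1 e2 e3 e4
    rw [hv, e1, Pi.sub_apply, e2, e4, Finset.sum_congr rfl e3]
  have hsi : Integrable fun z => ∑ i ∈ u, b i z := integrable_finsetSum _ fun i _ => hbi i
  have hgint : ∫ z, |f z - ∑ i ∈ u, b i z| ≤ 3 * F := by
    have hsi' : Integrable fun z => ∑ i ∈ u, |b i z| :=
      integrable_finsetSum _ fun i _ => (hbi i).abs
    calc _ ≤ ∫ z, (|f z| + ∑ i ∈ u, |b i z|) := by
          refine integral_mono (hfi.sub hsi).abs (hfi.abs.add hsi') fun z => ?_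
          exact (abs_sub _ _).trans (by gcongr; exact Finset.abs_sum_le_sum_abs _ _)
      _ = F + ∑ i ∈ u, ∫ z, |b i z| := by
          rw [integral_add hfi.abs hsi', integral_finsetSum _ fun i _ => (hbi i).abs]
      _ ≤ _ := by linarith
  have hvn : ‖v‖ ^ 2 ≤ C * lam * (3 * F) := by
    have e : ∫ z, v z ^ 2 = ∫ z, (f z - ∑ i ∈ u, b i z) ^ 2 :=
      integral_congr_ae (hvae.mono fun z hz => by simp only [hz])
    have hi : Integrable fun z => (f z - ∑ i ∈ u, b i z) ^ 2 :=
      (Lp.memLp v).integrable_sq.congr (hvae.mono fun z hz => by simp only [hz])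
    rw [Lp_norm_sq, e]
    calc _ ≤ ∫ z, C * lam * |f z - ∑ i ∈ u, b i z| := by
          refine integral_mono hi ((hfi.sub hsi).abs.const_mul _) fun z => ?_
          dsimp only
          rw [← sq_abs, sq]
          exact mul_le_mul_of_nonneg_right (hg z) (abs_nonneg _)
      _ ≤ _ := by rw [integral_const_mul]; gcongr
  have hTv := volume_lt_abs_Lp_le (T v) (half_pos hl)
  set B : Set (Pt n m) := ⋃ i ∈ u, Box N i (4 * R i) with hB
  have hBm : MeasurableSet B :=
    u.measurableSet_biUnion fun i _ => (isOpen_Box N i _).measurableSet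
  have hBv : volume B ≤ ENNReal.ofReal (∑ i ∈ u, boxVol N i (4 * R i)) := by
    have hR4 : ∀ i, 0 < 4 * R i := fun i => by have := hR i; positivity
    rw [ENNReal.ofReal_sum_of_nonneg fun i _ => (boxVol_pos N i (hR4 i)).le]
    refine (measure_biUnion_finset_le u _).trans (Finset.sum_le_sum fun i _ => ?_)
    exact (volume_Box N i (hR4 i)).le
  set S : Pt n m → ℝ≥0∞ := fun z => ∑ i ∈ u, ‖T ((hb2 i).toLp (b i)) z‖ₑ with hS
  have hTm : ∀ i, AEMeasurable (fun z => ‖T ((hb2 i).toLp (b i)) z‖ₑ) := fun i =>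
    (Lp.aestronglyMeasurable _).enorm
  have hSm : AEMeasurable S := Finset.aemeasurable_fun_sum u fun i _ => hTm i
  have hSi : ∫⁻ z in Bᶜ, S z ≤ ENNReal.ofReal (2 * C1 * F) := by
    calc _ = ∑ i ∈ u, ∫⁻ z in Bᶜ, ‖T ((hb2 i).toLp (b i)) z‖ₑ :=
          lintegral_finsetSum' _ fun i _ => (hTm i).restrict
      _ ≤ ∑ i ∈ u, ENNReal.ofReal (C1 * ∫ z, |b i z|) := Finset.sum_le_sum fun i hi =>
          (lintegral_mono_set (Set.compl_subset_compl.mpr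
            (Set.subset_biUnion_of_mem (u := fun i => Box N i (4 * R i)) hi))).trans
            (h1 i (R i) (hR i) (b i) (hb2 i) (hbi i) (hbs i) (hb0 i))
      _ = ENNReal.ofReal (∑ i ∈ u, C1 * ∫ z, |b i z|) :=
          (ENNReal.ofReal_sum_of_nonneg fun i _ =>
            mul_nonneg hC1 (integral_nonneg fun _ => abs_nonneg _)).symm
      _ ≤ _ := by
          refine ENNReal.ofReal_le_ofReal ?_
          rw [← Finset.mul_sum]
          nlinarith
  have hSv : volume ({z | ENNReal.ofReal (lam / 2) ≤ S z} ∩ Bᶜ) ≤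
      ENNReal.ofReal (2 * C1 * F / (lam / 2)) := by
    rw [← Measure.restrict_apply' hBm.compl, ENNReal.ofReal_div_of_pos (half_pos hl)]
    refine (meas_ge_le_lintegral_div hSm.restrict (by simpa using hl)
      ENNReal.ofReal_ne_top).trans ?_
    gcongr
  have hsub : ({z | lam < |T (hf.toLp f) z|} : Set (Pt n m)) ≤ᵐ[volume]
      ({z | lam / 2 < |T v z|} ∪ (B ∪ ({z | ENNReal.ofReal (lam / 2) ≤ S z} ∩ Bᶜ)) :
        Set (Pt n m)) := by
    have e : T (hf.toLp f) = T v + ∑ i ∈ u, T ((hb2 i).toLp (b i)) := by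
      rw [hv, map_sub, map_sum, sub_add_cancel]
    filter_upwards [Lp.coeFn_add (T v) (∑ i ∈ u, T ((hb2 i).toLp (b i))),
      Lp.coeFn_fun_finsetSum u fun i => T ((hb2 i).toLp (b i))] with z e1 e2 hz
    have hz' : lam < |T (hf.toLp f) z| := hz
    rw [e, e1, Pi.add_apply, e2] at hz'
    by_cases h1 : lam / 2 < |T v z|
    · exact Or.inl h1
    by_cases h2 : z ∈ B
    · exact Or.inr (Or.inl h2)
    refine Or.inr (Or.inr ⟨?_, h2⟩)
    have h3 : lam / 2 ≤ |∑ i ∈ u, T ((hb2 i).toLp (b i)) z| := by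
      have := abs_add_le (T v z) (∑ i ∈ u, T ((hb2 i).toLp (b i)) z)
      push Not at h1
      linarith
    calc ENNReal.ofReal (lam / 2) ≤ ENNReal.ofReal |∑ i ∈ u, T ((hb2 i).toLp (b i)) z| :=
          ENNReal.ofReal_le_ofReal h3
      _ = ‖∑ i ∈ u, T ((hb2 i).toLp (b i)) z‖ₑ := (Real.enorm_eq_ofReal_abs _).symm
      _ ≤ S z := enorm_sum_le _ _
  have hT2 : ‖T v‖ ^ 2 / (lam / 2) ^ 2 ≤ 4 * ‖T‖ ^ 2 * (3 * C) / lam * F := by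
    have : ‖T v‖ ^ 2 ≤ ‖T‖ ^ 2 * (C * lam * (3 * F)) := by
      calc _ ≤ (‖T‖ * ‖v‖) ^ 2 := by gcongr; exact T.le_opNorm v
        _ = ‖T‖ ^ 2 * ‖v‖ ^ 2 := by ring
        _ ≤ _ := by gcongr
    rw [div_le_iff₀ (by positivity)]
    refine this.trans_eq ?_
    field_simp
    norm_num
  have hv2 : ∑ i ∈ u, boxVol N i (4 * R i) ≤ C / lam * F := by
    rw [div_mul_eq_mul_div, le_div_iff₀ hl]
    linarith
  calc _ ≤ _ := measure_mono_ae hsub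
    _ ≤ _ + (_ + _) := (measure_union_le _ _).trans (by gcongr; exact measure_union_le _ _)
    _ ≤ ENNReal.ofReal (4 * ‖T‖ ^ 2 * (3 * C) / lam * F) + (ENNReal.ofReal (C / lam * F) +
          ENNReal.ofReal (2 * C1 * F / (lam / 2))) := by
        gcongr
        · exact hTv.trans (ENNReal.ofReal_le_ofReal hT2)
        · exact hBv.trans (ENNReal.ofReal_le_ofReal hv2)
    _ = ENNReal.ofReal (4 * ‖T‖ ^ 2 * (3 * C) / lam * F + (C / lam * F +
          2 * C1 * F / (lam / 2))) := by
        rw [← ENNReal.ofReal_add (by positivity) (by positivity),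
          ← ENNReal.ofReal_add (by positivity) (by positivity)]
    _ ≤ _ := by
        refine ENNReal.ofReal_le_ofReal ?_
        calc _ = (4 * ‖T‖ ^ 2 * (3 * C) + C + 4 * C1) / lam * F := by field_simp; ring
          _ ≤ _ := mul_le_mul_of_nonneg_right
              (div_le_div_of_nonneg_right (by linarith) hl.le) hF0

end Grusin

namespace Grusin

open TestFn

variable {n m : ℕ}

lemma odx_apply (j : Fin n) (φ : TestFn (Pt n m)) : ⇑(odx j φ) = Dx n m j φ := rfl

lemma ody_apply (k : Fin m) (φ : TestFn (Pt n m)) : ⇑(ody k φ) = Dy n m k φ := rfl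

lemma gr_apply (N : ℕ) (φ : TestFn (Pt n m)) : ⇑(gr n m N φ) = grusin n m N φ := by
  funext z
  simp only [gr, LinearMap.sub_apply, LinearMap.neg_apply, LinearMap.sum_apply,
    Module.End.mul_apply, coe_sub, coe_neg, Pi.sub_apply, Pi.neg_apply, ox_rad_pow_apply,
    TestFn.sum_apply, pow_two (odx _), pow_two (ody _), odx_apply, ody_apply, grusin]

lemma gr_pow_apply (N s : ℕ) (φ : TestFn (Pt n m)) :
    ⇑((gr n m N ^ s) φ) = (grusin n m N)^[s] φ := by
  induction s with
  | zero => simp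
  | succ s ih => rw [Function.iterate_succ_apply', pow_succ', Module.End.mul_apply, gr_apply, ih]

/-- The word of coordinates spelling a monomial. -/
def monoWord (ν : Fin n → ℕ) : List (Letter n m) :=
  (List.finRange n).flatMap fun i => List.replicate (ν i) (Letter.x i)

lemma wop_replicate_x_apply (i : Fin n) (k : ℕ) (φ : TestFn (Pt n m)) (z : Pt n m) :
    wop (List.replicate k (Letter.x i)) φ z = z.1 i ^ k * φ z := by
  induction k with
  | zero => simp [wop]
  | succ k ih =>
    rw [List.replicate_succ, wop_cons, Module.End.mul_apply, Letter.op, ox_apply, ih]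
    ring

lemma wop_flatMap_x_apply (ν : Fin n → ℕ) (l : List (Fin n)) (φ : TestFn (Pt n m)) (z : Pt n m) :
    wop (l.flatMap fun i => List.replicate (ν i) (Letter.x i)) φ z =
      (l.map fun i => z.1 i ^ ν i).prod * φ z := by
  induction l with
  | nil => simp [wop]
  | cons a l ih =>
    rw [List.flatMap_cons, wop_append, Module.End.mul_apply, wop_replicate_x_apply, ih,
      List.map_cons, List.prod_cons, mul_assoc]

lemma wop_monoWord_apply (ν : Fin n → ℕ) (φ : TestFn (Pt n m)) (z : Pt n m) :
    wop (monoWord ν) φ z = (∏ i, z.1 i ^ ν i) * φ z := by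
  rw [monoWord, wop_flatMap_x_apply, ← List.ofFn_eq_map, List.prod_ofFn]

lemma cx_monoWord (ν : Fin n → ℕ) : cx (monoWord ν : List (Letter n m)) = ∑ i, ν i := by
  simp only [cx, monoWord, List.map_flatMap, List.map_replicate, Letter.nx]
  rw [← List.sum_ofFn, List.ofFn_eq_map]
  induction List.finRange n with
  | nil => rfl
  | cons a l ih => simp [ih]

lemma cdx_monoWord (ν : Fin n → ℕ) : cdx (monoWord ν : List (Letter n m)) = 0 := by
  refine List.sum_eq_zero fun k hk => ?_
  simp only [monoWord, List.mem_map, List.mem_flatMap, List.mem_replicate] at hk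
  obtain ⟨_, ⟨_, _, _, rfl⟩, rfl⟩ := hk
  rfl

lemma cdy_monoWord (ν : Fin n → ℕ) : cdy (monoWord ν : List (Letter n m)) = 0 := by
  refine List.sum_eq_zero fun k hk => ?_
  simp only [monoWord, List.mem_map, List.mem_flatMap, List.mem_replicate] at hk
  obtain ⟨_, ⟨_, _, _, rfl⟩, rfl⟩ := hk
  rfl

/-- Each first-order operator is a multiple of a word of letters. -/
lemma exists_Xop_eq_wop (N : ℕ) (a : XIdx n m N) :
    ∃ (κ : ℝ) (w : List (Letter n m)), cdx w + (N + 1) * cdy w = 1 + cx w ∧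
      cx w + N * cdx w = N ∧ ∀ φ : TestFn (Pt n m), Xop n m N a φ = κ • ⇑(wop w φ) := by
  match a with
  | Sum.inl j =>
    refine ⟨1, [Letter.dx j], by simp [cx, cdx, cdy, Letter.nx, Letter.ndx, Letter.ndy],
      by simp [cx, cdx, Letter.nx, Letter.ndx], fun φ => ?_⟩
    simp [wop, Letter.op, odx_apply, Xop]
  | Sum.inr (ν, k) =>
    have h1 : cx [(Letter.dy k : Letter n m)] = 0 := by simp [cx, Letter.nx]
    have h2 : cdx [(Letter.dy k : Letter n m)] = 0 := by simp [cdx, Letter.ndx]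
    have h3 : cdy [(Letter.dy k : Letter n m)] = 1 := by simp [cdy, Letter.ndy]
    refine ⟨Real.sqrt ((Nat.factorial N : ℝ) / ∏ i, (Nat.factorial (ν.1 i) : ℝ)),
      monoWord ν.1 ++ [Letter.dy k], ?_, ?_, fun φ => ?_⟩
    · rw [cx_append, cdx_append, cdy_append, cx_monoWord, cdx_monoWord, cdy_monoWord, h1, h2, h3,
        ν.2]
      ring
    · rw [cx_append, cdx_append, cx_monoWord, cdx_monoWord, h1, h2, ν.2]
      ring
    · funext z
      rw [Pi.smul_apply, wop_append, Module.End.mul_apply, wop_monoWord_apply, smul_eq_mul,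
        ← mul_assoc]
      simp [wop, Letter.op, ody_apply, Xop]

lemma Xw_succ {N M : ℕ} (α : Fin (M + 1) → XIdx n m N) (f : Pt n m → ℝ) :
    Xw α f = Xop n m N (α 0) (Xw (fun i => α i.succ) f) := by
  simp [Xw, compOps, List.ofFn_succ]

/-- A word of first-order operators is a multiple of a word of letters. -/
lemma exists_Xw_eq_wop (N : ℕ) : ∀ (M : ℕ) (α : Fin M → XIdx n m N),
    ∃ (κ : ℝ) (w : List (Letter n m)), cdx w + (N + 1) * cdy w = M + cx w ∧
      cx w + N * cdx w = N * M ∧ ∀ φ : TestFn (Pt n m), Xw α φ = ⇑((κ • wop w) φ)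
  | 0, α => ⟨1, [], by simp [cx, cdx, cdy], by simp [cx, cdx], fun φ => by
      simp [Xw, compOps, wop]⟩
  | M + 1, α => by
    obtain ⟨κ1, w1, h1, h1', e1⟩ := exists_Xop_eq_wop N (α 0)
    obtain ⟨κ2, w2, h2, h2', e2⟩ := exists_Xw_eq_wop N M fun i => α i.succ
    refine ⟨κ1 * κ2, w1 ++ w2, ?_, ?_, fun φ => ?_⟩
    · rw [cx_append, cdx_append, cdy_append]
      linarith
    · rw [cx_append, cdx_append]
      linarith
    · rw [Xw_succ, e2, e1, wop_append, ← coe_smul]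
      congr 1
      simp [smul_smul]

lemma wop_mem_localOps (w : List (Letter n m)) : wop w ∈ localOps n m :=
  list_prod_mem fun _ h => by
    obtain ⟨l, -, rfl⟩ := List.mem_map.mp h
    exact op_mem_localOps l

end Grusin

open Grusin

/-- (Weak-type `(1,1)` of the even-order Riesz transforms of the
Gru\v{s}in operator.)  For `n, m, N ≥ 1`, `s ≥ 1` and any word `α` of elements of `𝒳` with
`|α| = 2s`, there is `c > 0` such that for every `φ ∈ C_c^∞(ℝ^(n+m))` and every `λ > 0`,
`|{ z : |(X^α φ)(z)| > λ }| ≤ c λ⁻¹ ‖H_N^s φ‖₁`. -/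
theorem grusin_riesz_even_order_weak_type_one_one
    (n m N : ℕ) (hn : 1 ≤ n) (hm : 1 ≤ m) (hN : 1 ≤ N)
    (s : ℕ) (hs : 1 ≤ s) (α : Fin (2 * s) → XIdx n m N) :
    ∃ c > (0 : ℝ), ∀ φ : Pt n m → ℝ, ContDiff ℝ (⊤ : ℕ∞) φ → HasCompactSupport φ →
      ∀ lam : ℝ, 0 < lam →
        volume {z : Pt n m | lam < |Xw α φ z|} ≤
          ENNReal.ofReal (c / lam) * eLpNorm ((grusin n m N)^[s] φ) 1 volume := by
  obtain ⟨κ, w, h1, h2, hw⟩ := exists_Xw_eq_wop N (2 * s) α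
  obtain ⟨C, hC, hwop⟩ := norm_wop_le N hn hm hN s w h1 (by rw [h2]; exact le_of_eq (by ring))
  obtain ⟨T, hT, C', hC', hoff⟩ := exists_extension_offDiag N hn hm hN s hs (κ • wop w)
    (Subalgebra.smul_mem _ (wop_mem_localOps w) κ) (C0 := |κ| * C) fun φ => by
      rw [LinearMap.smul_apply, norm_smul, Real.norm_eq_abs, mul_assoc]
      exact mul_le_mul_of_nonneg_left (hwop φ) (abs_nonneg _)
  obtain ⟨c, hc, hweak⟩ := exists_volume_lt_abs_le_of_offDiag N hn T hC' hoff
  refine ⟨c, hc, fun φ hφ hφc lam hl => ?_⟩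
  set Φ : TestFn (Pt n m) := TestFn.mk φ hφ hφc with hΦ
  have hcoe : ⇑Φ = φ := rfl
  set g := (gr n m N ^ s) Φ with hg
  have h3 := hweak g g.continuous g.compact (g.memLp 2) lam hl
  have h4 : T ((g.memLp 2).toLp g) = toL2 ((κ • wop w) Φ) := hT Φ
  have h5 : volume {z : Pt n m | lam < |Xw α φ z|} =
      volume {z | lam < |T ((g.memLp 2).toLp g) z|} := by
    refine measure_congr ?_
    rw [h4]
    filter_upwards [(((κ • wop w) Φ).memLp 2).coeFn_toLp] with z hz
    have e : toL2 ((κ • wop w) Φ) z = Xw α φ z := by rw [← hcoe, hw]; exact hz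
    change (lam < |Xw α φ z|) = (lam < |toL2 ((κ • wop w) Φ) z|)
    rw [e]
  have h6 : eLpNorm ((grusin n m N)^[s] φ) 1 volume = ENNReal.ofReal (∫ z, |g z|) := by
    rw [← hcoe, ← gr_pow_apply, eLpNorm_one_eq_lintegral_enorm,
      ← ofReal_integral_norm_eq_lintegral_enorm g.integrable]
    rfl
  rw [h5, h6, ← ENNReal.ofReal_mul (by positivity)]
  exact h3
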